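/- arXiv:1401.0638 — 2 statements merged into one kernel-verified Lean document; each statement's English description precedes it below -/
import Mathlib

section
/- Let f(x) = (1 − x)^α (1 + x)^β log(1 − x) g(x) with α a positive integer, β ≥ 0, and g infinitely differentiable on [−1,1]. Define s = 2α if β is an integer and s = 2 min{α, β} otherwise. Then the error of the (n+1)-point Clenshaw–Curtis quadrature rule applied to ∫_{−1}^{1} f(x) dx satisfies E_n^C[f] = O(n^{−s−2}) as n → ∞. -/
open Real Filter Finset

/-- The Chebyshev coefficients of `f : [-1,1] → ℝ`:
`a_k = (2/π) ∫_0^π f(cos t) cos(kt) dt`. -/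
noncomputable def chebCoeff (f : ℝ → ℝ) (k : ℕ) : ℝ :=
  (2 / π) * ∫ t in (0 : ℝ)..π, f (Real.cos t) * Real.cos ((k : ℝ) * t)

/-- `δ_j = 1/2` if `j = 0` or `j = n`, and `δ_j = 1` otherwise. -/
noncomputable def ccDelta (n j : ℕ) : ℝ := if j = 0 ∨ j = n then 1 / 2 else 1

/-- The Clenshaw–Curtis quadrature weights
`w_j = (4δ_j/n) Σ_{k=0}^{⌊n/2⌋} δ_{2k} cos(2jkπ/n)/(1−4k²)`. -/
noncomputable def ccWeight (n j : ℕ) : ℝ :=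
  (4 * ccDelta n j / (n : ℝ)) * ∑ k ∈ Finset.range (n / 2 + 1),
    ccDelta n (2 * k) * Real.cos (2 * (j : ℝ) * (k : ℝ) * π / (n : ℝ)) / (1 - 4 * (k : ℝ) ^ 2)

/-- The `(n+1)`-point Clenshaw–Curtis quadrature rule
`I_n^C[f] = Σ_{j=0}^{n} w_j f(cos(jπ/n))`. -/
noncomputable def ccQuad (f : ℝ → ℝ) (n : ℕ) : ℝ :=
  ∑ j ∈ Finset.range (n + 1), ccWeight n j * f (Real.cos ((j : ℝ) * π / (n : ℝ)))

/-- The Clenshaw–Curtis quadrature error `E_n^C[f] = ∫_{-1}^1 f − I_n^C[f]`. -/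
noncomputable def ccError (f : ℝ → ℝ) (n : ℕ) : ℝ :=
  (∫ x in (-1 : ℝ)..1, f x) - ccQuad f n

section ChebyshevSeries

/-- The bilateral Chebyshev coefficients of `f`: the Fourier coefficients of `t ↦ f (cos t)`. -/
noncomputable def cosCoeff (f : ℝ → ℝ) (k : ℤ) : ℝ :=
  (2 * π)⁻¹ * ∫ t in (0 : ℝ)..2 * π, f (Real.cos t) * Real.cos (k * t)

/-- The Chebyshev coefficients of `f` decay at least like `|k| ^ (-r)`. -/
def CosDecay (r : ℝ) (f : ℝ → ℝ) : Prop :=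
  ∃ C : ℝ, ∀ k : ℤ, |cosCoeff f k| ≤ C * (1 + |(k : ℝ)|) ^ (-r)

lemma cosCoeff_neg (f : ℝ → ℝ) (k : ℤ) : cosCoeff f (-k) = cosCoeff f k := by
  simp [cosCoeff]

lemma cosCoeff_congr {f g : ℝ → ℝ} (h : ∀ x ∈ Set.Icc (-1 : ℝ) 1, f x = g x) (k : ℤ) :
    cosCoeff f k = cosCoeff g k := by
  simp only [cosCoeff]
  simp_rw [fun t => h (Real.cos t) (Real.cos_mem_Icc t)]

lemma CosDecay.congr {r : ℝ} {f g : ℝ → ℝ} (hf : CosDecay r f)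
    (h : ∀ x ∈ Set.Icc (-1 : ℝ) 1, g x = f x) : CosDecay r g := by
  obtain ⟨C, hC⟩ := hf
  exact ⟨C, fun k => by simpa only [cosCoeff_congr h] using hC k⟩

lemma rpow_neg_le_rpow_neg_of_le {r s : ℝ} (h : r ≤ s) (k : ℤ) :
    (1 + |(k : ℝ)|) ^ (-s) ≤ (1 + |(k : ℝ)|) ^ (-r) :=
  Real.rpow_le_rpow_of_exponent_le (by linarith [abs_nonneg (k : ℝ)]) (by linarith)

lemma CosDecay.exists_nonneg {r : ℝ} {f : ℝ → ℝ} (hf : CosDecay r f) :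
    ∃ C : ℝ, 0 ≤ C ∧ ∀ k : ℤ, |cosCoeff f k| ≤ C * (1 + |(k : ℝ)|) ^ (-r) := by
  obtain ⟨C, hC⟩ := hf
  exact ⟨C, by simpa using (abs_nonneg _).trans (hC 0), hC⟩

lemma CosDecay.mono {r s : ℝ} {f : ℝ → ℝ} (hf : CosDecay s f) (h : r ≤ s) : CosDecay r f := by
  obtain ⟨C, hC0, hC⟩ := hf.exists_nonneg
  exact ⟨C, fun k => (hC k).trans (mul_le_mul_of_nonneg_left (rpow_neg_le_rpow_neg_of_le h k) hC0)⟩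

lemma summable_one_add_abs_rpow_neg {r : ℝ} (hr : 1 < r) :
    Summable fun k : ℤ => (1 + |(k : ℝ)|) ^ (-r) := by
  refine Summable.of_norm_bounded_eventually (Real.summable_abs_int_rpow hr) ?_
  have : ∀ᶠ k : ℤ in Filter.cofinite, k ≠ 0 := by
    simpa using (Set.finite_singleton (0 : ℤ)).compl_mem_cofinite
  filter_upwards [this] with k hk
  have hk' : 0 < |(k : ℝ)| := by positivity
  rw [Real.norm_of_nonneg (by positivity)]
  exact Real.rpow_le_rpow_of_nonpos hk' (by linarith) (by linarith)

lemma CosDecay.summable_abs {r : ℝ} {f : ℝ → ℝ} (hf : CosDecay r f) (hr : 1 < r) :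
    Summable fun k : ℤ => |cosCoeff f k| := by
  obtain ⟨C, hC⟩ := hf
  exact Summable.of_nonneg_of_le (fun k => abs_nonneg _) hC
    ((summable_one_add_abs_rpow_neg hr).mul_left C)

lemma integral_mul_sin_eq_zero (f : ℝ → ℝ) (k : ℤ) :
    ∫ t in (0 : ℝ)..2 * π, f (Real.cos t) * Real.sin (k * t) = 0 := by
  have h := intervalIntegral.integral_comp_sub_left (a := 0) (b := 2 * π)
    (fun t => f (Real.cos t) * Real.sin (k * t)) (2 * π)
  have e : ∀ t : ℝ, f (Real.cos (2 * π - t)) * Real.sin (k * (2 * π - t))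
      = -(f (Real.cos t) * Real.sin (k * t)) := by
    intro t
    rw [Real.cos_two_pi_sub, show (k : ℝ) * (2 * π - t) = k * (2 * π) - k * t by ring,
      Real.sin_int_mul_two_pi_sub]
    ring
  simp only [e, sub_self, sub_zero, intervalIntegral.integral_neg] at h
  linarith

lemma hasSum_cosCoeff {f : ℝ → ℝ} (hf : Continuous fun t => f (Real.cos t))
    (hs : Summable fun k : ℤ => |cosCoeff f k|) (t : ℝ) :
    HasSum (fun k : ℤ => cosCoeff f k * Real.cos (k * t)) (f (Real.cos t)) := by
  have : Fact (0 < 2 * π) := ⟨Real.two_pi_pos⟩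
  have hper : Function.Periodic (fun t => ((f (Real.cos t) : ℝ) : ℂ)) (2 * π) := fun t => by simp
  have hcont : Continuous (fun t => ((f (Real.cos t) : ℝ) : ℂ)) :=
    Complex.continuous_ofReal.comp hf
  let F : C(AddCircle (2 * π), ℂ) := ⟨hper.lift, continuous_coinduced_dom.mpr hcont⟩
  have hF : ∀ x : ℝ, F (x : AddCircle (2 * π)) = ((f (Real.cos x) : ℝ) : ℂ) := fun x => rfl
  have hexp : ∀ (k : ℤ) (x : ℝ), (fourier k) (x : AddCircle (2 * π))
      = (Real.cos (k * x) : ℂ) + (Real.sin (k * x) : ℂ) * Complex.I := by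
    intro k x
    rw [fourier_coe_apply, Complex.ofReal_cos, Complex.ofReal_sin, ← Complex.exp_mul_I]
    congr 1
    have : (π : ℂ) ≠ 0 := by exact_mod_cast Real.pi_ne_zero
    push_cast
    field_simp
  have hcoeff : ∀ k : ℤ, fourierCoeff F k = (cosCoeff f k : ℂ) := by
    intro k
    have e : ∀ x : ℝ, (fourier (-k)) (x : AddCircle (2 * π)) • F (x : AddCircle (2 * π))
        = ((f (Real.cos x) * Real.cos (k * x) : ℝ) : ℂ)
          - ((f (Real.cos x) * Real.sin (k * x) : ℝ) : ℂ) * Complex.I := by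
      intro x
      rw [hexp, hF]
      push_cast
      simp only [neg_mul, Complex.cos_neg, Complex.sin_neg, smul_eq_mul]
      ring
    rw [fourierCoeff_eq_intervalIntegral _ _ 0, zero_add]
    simp_rw [e]
    rw [intervalIntegral.integral_sub, intervalIntegral.integral_mul_const,
      intervalIntegral.integral_ofReal, intervalIntegral.integral_ofReal,
      integral_mul_sin_eq_zero, cosCoeff]
    · simp
    · exact (Complex.continuous_ofReal.comp (hf.mul (by fun_prop))).intervalIntegrable _ _
    · exact ((Complex.continuous_ofReal.comp (hf.mul (by fun_prop))).mul
        continuous_const).intervalIntegrable _ _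
  have hsum : Summable (fourierCoeff F) := by
    refine Summable.of_norm ?_
    simpa [hcoeff] using hs
  have h := has_pointwise_sum_fourier_series_of_summable hsum (t : AddCircle (2 * π))
  have h2 := Complex.hasSum_re h
  simpa [hcoeff, hexp, hF, Complex.cos_ofReal_re, ← Complex.ofReal_cos, ← Complex.ofReal_sin,
    ← Complex.ofReal_intCast, ← Complex.ofReal_mul, -Complex.ofReal_mul] using h2

lemma hasSum_integral_of_summable_bound {F : ℤ → ℝ → ℝ} {G : ℝ → ℝ} {b : ℤ → ℝ} (u v : ℝ)
    (hF : ∀ k, Continuous (F k)) (hb : ∀ k t, |F k t| ≤ b k) (hs : Summable b)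
    (h : ∀ t, HasSum (fun k => F k t) (G t)) :
    HasSum (fun k => ∫ t in u..v, F k t) (∫ t in u..v, G t) :=
  intervalIntegral.hasSum_integral_of_dominated_convergence (fun k _ => b k)
    (fun k => (hF k).aestronglyMeasurable) (fun k => .of_forall fun t _ => hb k t)
    (.of_forall fun _ _ => hs) (by simp) (.of_forall fun t _ => h t)

lemma hasSum_cosCoeff_mul {f g : ℝ → ℝ} (hf : Continuous fun t => f (Real.cos t))
    (hg : Continuous fun t => g (Real.cos t)) (hs : Summable fun k : ℤ => |cosCoeff g k|) (k : ℤ) :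
    HasSum (fun j : ℤ => cosCoeff g j * ((cosCoeff f (k + j) + cosCoeff f (k - j)) / 2))
      (cosCoeff (fun x => f x * g x) k) := by
  obtain ⟨M, hM⟩ : ∃ M, ∀ t, |f (Real.cos t)| ≤ M := by
    have hper : Function.Periodic (fun t => f (Real.cos t)) (2 * π) := fun t => by simp
    obtain ⟨M, hM⟩ := (hper.compact_of_continuous (by positivity) hf).isBounded.exists_norm_le
    exact ⟨M, fun t => hM _ ⟨t, rfl⟩⟩
  have h := hasSum_integral_of_summable_bound
    (F := fun j t => f (Real.cos t) * Real.cos (k * t) * (cosCoeff g j * Real.cos (j * t)))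
    (b := fun j => M * |cosCoeff g j|) 0 (2 * π)
    (fun j => (hf.mul (by fun_prop)).mul (by fun_prop)) (fun j t => by
      rw [abs_mul, abs_mul, abs_mul]
      have h1 := Real.abs_cos_le_one (k * t)
      have h2 := Real.abs_cos_le_one (j * t)
      have h3 := (abs_nonneg _).trans (hM t)
      refine mul_le_mul ?_ (mul_le_of_le_one_right (abs_nonneg _) h2) (by positivity) h3
      exact (mul_le_of_le_one_right (abs_nonneg _) h1).trans (hM t))
    (hs.mul_left M) (fun t => (hasSum_cosCoeff hg hs t).mul_left _)
  have e : ∀ j : ℤ,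
      cosCoeff g j * ((cosCoeff f (k + j) + cosCoeff f (k - j)) / 2) = (2 * π)⁻¹ *
        ∫ t in (0 : ℝ)..2 * π,
          f (Real.cos t) * Real.cos (k * t) * (cosCoeff g j * Real.cos (j * t)) := by
    intro j
    have h1 : ∀ t : ℝ, f (Real.cos t) * Real.cos (k * t) * (cosCoeff g j * Real.cos (j * t))
        = cosCoeff g j / 2 * (f (Real.cos t) * Real.cos ((k + j : ℤ) * t)
          + f (Real.cos t) * Real.cos ((k - j : ℤ) * t)) := by
      intro t
      push_cast
      rw [add_mul, sub_mul, Real.cos_add, Real.cos_sub]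
      ring
    simp_rw [h1]
    rw [intervalIntegral.integral_const_mul, intervalIntegral.integral_add]
    · simp only [cosCoeff]
      ring
    · exact (hf.mul (by fun_prop)).intervalIntegrable _ _
    · exact (hf.mul (by fun_prop)).intervalIntegrable _ _
  simp_rw [e]
  have e2 : cosCoeff (fun x => f x * g x) k = (2 * π)⁻¹ * ∫ t in (0 : ℝ)..2 * π,
      f (Real.cos t) * Real.cos (k * t) * g (Real.cos t) := by
    simp only [cosCoeff, mul_right_comm]
  rw [e2]
  exact h.mul_left _

lemma one_add_abs_rpow_mul_le {r : ℝ} (hr : 0 ≤ r) (i j : ℤ) :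
    (1 + |(i : ℝ)|) ^ (-r) * (1 + |(j : ℝ)|) ^ (-r)
      ≤ 2 ^ r * (1 + |((i + j : ℤ) : ℝ)|) ^ (-r)
        * ((1 + |(i : ℝ)|) ^ (-r) + (1 + |(j : ℝ)|) ^ (-r)) := by
  wlog hij : |(i : ℝ)| ≤ |(j : ℝ)| generalizing i j
  · have := this j i (le_of_not_ge hij)
    rw [add_comm j i] at this
    linarith
  have h1 : 1 + |((i + j : ℤ) : ℝ)| ≤ 2 * (1 + |(j : ℝ)|) := by
    push_cast
    linarith [abs_add_le (i : ℝ) j]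
  have h2 : (1 + |(j : ℝ)|) ^ (-r) ≤ 2 ^ r * (1 + |((i + j : ℤ) : ℝ)|) ^ (-r) := by
    have := Real.rpow_le_rpow_of_nonpos (by positivity) h1 (neg_nonpos.mpr hr)
    rw [Real.mul_rpow (by norm_num) (by positivity), Real.rpow_neg (by norm_num)] at this
    rwa [← inv_mul_le_iff₀ (by positivity)]
  have h3 : 0 ≤ (1 + |(i : ℝ)|) ^ (-r) := by positivity
  have h4 : 0 ≤ (1 + |(j : ℝ)|) ^ (-r) := by positivity
  nlinarith [mul_le_mul_of_nonneg_left h2 h3, mul_nonneg (h4.trans h2) h4]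

lemma CosDecay.mul {r : ℝ} {f g : ℝ → ℝ} (hr : 1 < r) (hf : Continuous fun t => f (Real.cos t))
    (hg : Continuous fun t => g (Real.cos t)) (hfd : CosDecay r f) (hgd : CosDecay r g) :
    CosDecay r (fun x => f x * g x) := by
  obtain ⟨A, hA0, hA⟩ := hfd.exists_nonneg
  obtain ⟨B, hB0, hB⟩ := hgd.exists_nonneg
  have hS := summable_one_add_abs_rpow_neg hr
  set w : ℤ → ℝ := fun k => (1 + |(k : ℝ)|) ^ (-r) with hw
  have hw0 : ∀ k, 0 ≤ w k := fun k => by positivity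
  refine ⟨A * B * 2 ^ r * (2 * ∑' k, w k), fun k => ?_⟩
  have hsum := hasSum_cosCoeff_mul hf hg (hgd.summable_abs hr) k
  have hadd : Summable fun j => w (k + j) := hS.comp_injective (add_right_injective k)
  have hsub : Summable fun j => w (k - j) := hS.comp_injective (sub_right_injective (b := k))
  have hadd' : ∑' j, w (k + j) = ∑' j, w j := (Equiv.addLeft k).tsum_eq w
  have hsub' : ∑' j, w (k - j) = ∑' j, w j := (Equiv.subLeft k).tsum_eq w
  have hbound : ∀ j, |cosCoeff g j * ((cosCoeff f (k + j) + cosCoeff f (k - j)) / 2)|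
      ≤ A * B * 2 ^ r * w k * (w j + (w (k + j) + w (k - j)) / 2) := by
    intro j
    have e1 := one_add_abs_rpow_mul_le (by linarith : 0 ≤ r) (-j) (k + j)
    have e2 := one_add_abs_rpow_mul_le (by linarith : 0 ≤ r) j (k - j)
    rw [show -j + (k + j) = k by ring, Int.cast_neg, abs_neg] at e1
    rw [show j + (k - j) = k by ring] at e2
    change w j * w (k + j) ≤ 2 ^ r * w k * (w j + w (k + j)) at e1
    change w j * w (k - j) ≤ 2 ^ r * w k * (w j + w (k - j)) at e2
    have h3 : |(cosCoeff f (k + j) + cosCoeff f (k - j)) / 2|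
        ≤ A * (w (k + j) + w (k - j)) / 2 := by
      rw [abs_div, abs_two]
      have := abs_add_le (cosCoeff f (k + j)) (cosCoeff f (k - j))
      have h4 : |cosCoeff f (k + j)| ≤ A * w (k + j) := hA _
      have h5 : |cosCoeff f (k - j)| ≤ A * w (k - j) := hA _
      linarith
    rw [abs_mul]
    calc _ ≤ (B * w j) * (A * (w (k + j) + w (k - j)) / 2) :=
          mul_le_mul (hB j) h3 (abs_nonneg _) (mul_nonneg hB0 (hw0 j))
      _ = A * B * ((w j * w (k + j) + w j * w (k - j)) / 2) := by ring
      _ ≤ A * B * ((2 ^ r * w k * (w j + w (k + j)) + 2 ^ r * w k * (w j + w (k - j))) / 2) :=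
          mul_le_mul_of_nonneg_left (by linarith) (mul_nonneg hA0 hB0)
      _ = _ := by ring
  have hbs : HasSum (fun j => A * B * 2 ^ r * w k * (w j + (w (k + j) + w (k - j)) / 2))
      (A * B * 2 ^ r * w k * (∑' j, w j + (∑' j, w j + ∑' j, w j) / 2)) := by
    have h1 := hadd.hasSum
    have h2 := hsub.hasSum
    rw [hadd'] at h1
    rw [hsub'] at h2
    exact (hS.hasSum.add ((h1.add h2).div_const 2)).mul_left _
  have := tsum_of_norm_bounded hbs fun j => (Real.norm_eq_abs _).trans_le (hbound j)
  rw [hsum.tsum_eq, Real.norm_eq_abs] at this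
  refine this.trans (le_of_eq ?_)
  ring

end ChebyshevSeries

section Decay

lemma exists_abs_integral_mul_cos_le (N : ℕ) {H : ℝ → ℝ} (hH : ContDiff ℝ (⊤ : ℕ∞) H)
    (hper : Function.Periodic H (2 * π)) :
    ∃ C : ℝ, ∀ (φ : ℝ) (k : ℤ), k ≠ 0 →
      |∫ t in (0 : ℝ)..2 * π, H t * Real.cos (k * t + φ)| ≤ C * |(k : ℝ)| ^ (-(N : ℝ)) := by
  induction N generalizing H with
  | zero =>
    refine ⟨∫ t in (0 : ℝ)..2 * π, |H t|, fun φ k _ => ?_⟩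
    have hc := hH.continuous
    simp only [Nat.cast_zero, neg_zero, Real.rpow_zero, mul_one]
    refine (intervalIntegral.abs_integral_le_integral_abs Real.two_pi_pos.le).trans
      (intervalIntegral.integral_mono_on Real.two_pi_pos.le ?_ ?_ fun t _ => ?_)
    · exact Continuous.intervalIntegrable (by fun_prop) _ _
    · exact Continuous.intervalIntegrable (by fun_prop) _ _
    · rw [abs_mul]
      exact mul_le_of_le_one_right (abs_nonneg _) (Real.abs_cos_le_one _)
  | succ N ih =>
    have hd : ContDiff ℝ (⊤ : ℕ∞) (deriv H) := (contDiff_infty_iff_deriv.mp hH).2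
    have hdper : Function.Periodic (deriv H) (2 * π) := fun t => by
      rw [← deriv_comp_add_const, show (fun x => H (x + 2 * π)) = H from funext hper]
    obtain ⟨C, hC⟩ := ih hd hdper
    refine ⟨C, fun φ k hk => ?_⟩
    have hk' : (k : ℝ) ≠ 0 := by exact_mod_cast hk
    have hparts := intervalIntegral.integral_mul_deriv_eq_deriv_mul (a := 0) (b := 2 * π)
      (u := H) (u' := deriv H) (v := fun t => Real.sin (k * t + φ) / k)
      (v' := fun t => Real.cos (k * t + φ))
      (fun t _ => ((contDiff_infty_iff_deriv.mp hH).1 t).hasDerivAt)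
      (fun t _ => by
        have := ((((hasDerivAt_id t).const_mul (k : ℝ)).add_const φ).sin).div_const (k : ℝ)
        simpa [hk'] using this)
      (hd.continuous.intervalIntegrable _ _) (Continuous.intervalIntegrable (by fun_prop) _ _)
    have hb : H (2 * π) = H 0 := by simpa using hper 0
    have hs : Real.sin (k * (2 * π) + φ) = Real.sin φ := by
      rw [add_comm, Real.sin_add_int_mul_two_pi]
    have e : ∀ t : ℝ, deriv H t * (Real.sin (k * t + φ) / k)
        = (k : ℝ)⁻¹ * (deriv H t * Real.cos (k * t + (φ - π / 2))) := by
      intro t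
      rw [← add_sub_assoc, Real.cos_sub_pi_div_two]
      ring
    rw [hparts, hb, hs, mul_zero, zero_add, sub_self, zero_sub, abs_neg]
    simp_rw [e]
    rw [intervalIntegral.integral_const_mul, abs_mul, abs_inv]
    have hk0 : 0 < |(k : ℝ)| := abs_pos.mpr hk'
    calc _ ≤ |(k : ℝ)|⁻¹ * (C * |(k : ℝ)| ^ (-(N : ℝ))) :=
          mul_le_mul_of_nonneg_left (hC _ k hk) (by positivity)
      _ = _ := by
        rw [Nat.cast_succ, neg_add, Real.rpow_add hk0, Real.rpow_neg_one]
        ring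

lemma cosDecay_of_contDiffOn {g : ℝ → ℝ} (hg : ContDiffOn ℝ (⊤ : ℕ∞) g (Set.Icc (-1) 1)) (r : ℝ) :
    CosDecay r g := by
  obtain ⟨N, hN⟩ := exists_nat_ge r
  refine CosDecay.mono ?_ hN
  have hH : ContDiff ℝ (⊤ : ℕ∞) (g ∘ Real.cos) :=
    hg.comp_contDiff Real.contDiff_cos Real.cos_mem_Icc
  obtain ⟨C, hC⟩ := exists_abs_integral_mul_cos_le N hH fun t => by simp
  refine ⟨|cosCoeff g 0| + (2 * π)⁻¹ * |C| * 2 ^ (N : ℝ), fun k => ?_⟩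
  rcases eq_or_ne k 0 with rfl | hk
  · simp only [Int.cast_zero, abs_zero, add_zero, Real.one_rpow, mul_one]
    have : 0 ≤ (2 * π)⁻¹ * |C| * 2 ^ (N : ℝ) := by positivity
    linarith
  · have h1 : 1 ≤ |(k : ℝ)| := by exact_mod_cast Int.one_le_abs hk
    have h2 : |(k : ℝ)| ^ (-(N : ℝ)) ≤ 2 ^ (N : ℝ) * (1 + |(k : ℝ)|) ^ (-(N : ℝ)) := by
      have := Real.rpow_le_rpow_of_nonpos (by positivity)
        (by linarith : 1 + |(k : ℝ)| ≤ 2 * |(k : ℝ)|) (by simp : -(N : ℝ) ≤ 0)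
      rw [Real.mul_rpow (by norm_num) (by positivity), Real.rpow_neg (by norm_num)] at this
      rwa [← inv_mul_le_iff₀ (by positivity)]
    have h3 := hC 0 k hk
    simp only [add_zero, Function.comp_apply] at h3
    rw [cosCoeff, abs_mul, abs_of_pos (by positivity : 0 < (2 * π)⁻¹), add_mul]
    have h4 : 0 ≤ |cosCoeff g 0| * (1 + |(k : ℝ)|) ^ (-(N : ℝ)) := by positivity
    calc _ ≤ (2 * π)⁻¹ * (|C| * (2 ^ (N : ℝ) * (1 + |(k : ℝ)|) ^ (-(N : ℝ)))) := by
          refine mul_le_mul_of_nonneg_left (h3.trans ?_) (by positivity)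
          exact mul_le_mul (le_abs_self C) h2 (by positivity) (abs_nonneg _)
      _ ≤ _ := by linarith

lemma exists_abs_le_of_recurrence {γ : ℝ} (hγ : 0 ≤ γ) (b : ℕ → ℝ) (K : ℕ)
    (h : ∀ k : ℕ, K ≤ k → (k + 1 + γ) * |b (k + 1)| = |k - γ| * |b k|) :
    ∃ C : ℝ, ∀ k : ℕ, |b k| ≤ C * (1 + (k : ℝ)) ^ (-(2 * γ + 1)) := by
  obtain ⟨G, hG⟩ := exists_nat_ge γ
  set K' : ℕ := K + G + 1 with hK'
  set p : ℝ := 2 * γ + 1 with hp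
  have hp0 : 0 ≤ p := by positivity
  have hstep : ∀ k : ℕ, K' ≤ k →
      |b (k + 1)| * (((k + 1 : ℕ) : ℝ) + γ) ^ p ≤ |b k| * ((k : ℝ) + γ) ^ p := by
    intro k hk
    have hkG : γ ≤ k := hG.trans (by exact_mod_cast (by omega : G ≤ k))
    have hpos : (0 : ℝ) < k + 1 + γ := by positivity
    have hrec := h k (by omega)
    rw [abs_of_nonneg (sub_nonneg.mpr hkG)] at hrec
    have hbern := one_add_mul_self_le_rpow_one_add (s := -(k + 1 + γ)⁻¹)
      (neg_le_neg (inv_le_one_of_one_le₀ (by linarith [k.cast_nonneg (α := ℝ)])))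
      (p := p) (by linarith)
    have e1 : 1 + p * -((k : ℝ) + 1 + γ)⁻¹ = (k - γ) / (k + 1 + γ) := by
      rw [hp]
      field_simp
      ring
    have e2 : 1 + -((k : ℝ) + 1 + γ)⁻¹ = (k + γ) / (k + 1 + γ) := by
      field_simp
      ring
    rw [e1, e2, Real.div_rpow (by positivity) hpos.le, div_le_div_iff₀ hpos (by positivity)] at hbern
    push_cast
    refine le_of_mul_le_mul_left ?_ hpos
    calc _ = (k + 1 + γ) * |b (k + 1)| * (k + 1 + γ) ^ p := by ring
      _ = |b k| * ((k - γ) * (k + 1 + γ) ^ p) := by rw [hrec]; ring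
      _ ≤ |b k| * ((k + γ) ^ p * (k + 1 + γ)) := mul_le_mul_of_nonneg_left hbern (abs_nonneg _)
      _ = _ := by ring
  have hbound : ∀ k : ℕ, K' ≤ k → |b k| * ((k : ℝ) + γ) ^ p ≤ |b K'| * ((K' : ℝ) + γ) ^ p := by
    intro k hk
    induction k, hk using Nat.le_induction with
    | base => exact le_rfl
    | succ k hk ih => exact (hstep k hk).trans ih
  refine ⟨∑ i ∈ Finset.range K', |b i| * (1 + (i : ℝ)) ^ p
    + 2 ^ p * (|b K'| * ((K' : ℝ) + γ) ^ p), fun k => ?_⟩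
  rw [Real.rpow_neg (by positivity), ← div_eq_mul_inv, le_div_iff₀ (by positivity)]
  rcases lt_or_ge k K' with hk | hk
  · have h1 := Finset.single_le_sum (f := fun i : ℕ => |b i| * (1 + (i : ℝ)) ^ p)
      (fun i _ => by positivity) (Finset.mem_range.mpr hk)
    have h2 : 0 ≤ 2 ^ p * (|b K'| * ((K' : ℝ) + γ) ^ p) := by positivity
    linarith
  · have h1 : 0 ≤ ∑ i ∈ Finset.range K', |b i| * (1 + (i : ℝ)) ^ p :=
      Finset.sum_nonneg fun i _ => by positivity
    have hk1 : (1 : ℝ) ≤ k := by exact_mod_cast (by omega : 1 ≤ k)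
    have h2 : (1 + (k : ℝ)) ^ p ≤ 2 ^ p * ((k : ℝ) + γ) ^ p := by
      rw [← Real.mul_rpow (by norm_num) (by positivity)]
      exact Real.rpow_le_rpow (by positivity) (by linarith) hp0
    have h3 := mul_le_mul_of_nonneg_left h2 (abs_nonneg (b k))
    have h4 := mul_le_mul_of_nonneg_left (hbound k hk) (by positivity : (0 : ℝ) ≤ 2 ^ p)
    linarith

lemma cosDecay_of_recurrence {γ : ℝ} (hγ : 0 ≤ γ) (f : ℝ → ℝ) (K : ℕ)
    (h : ∀ k : ℕ, K ≤ k → (k + 1 + γ) * |cosCoeff f (k + 1)| = |k - γ| * |cosCoeff f k|) :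
    CosDecay (2 * γ + 1) f := by
  obtain ⟨C, hC⟩ := exists_abs_le_of_recurrence hγ (fun k : ℕ => cosCoeff f k) K
    (by simpa using h)
  refine ⟨C, fun k => ?_⟩
  have h1 : cosCoeff f k = cosCoeff f (k.natAbs : ℤ) := by
    rcases Int.natAbs_eq k with h | h
    · rw [← h]
    · conv_lhs => rw [h]
      exact cosCoeff_neg _ _
  have h2 : |(k : ℝ)| = (k.natAbs : ℝ) := by rw [Nat.cast_natAbs, Int.cast_abs]
  rw [h1, h2]
  exact hC _

/-- The recurrence for the Chebyshev coefficients of `(1 + x) ^ β`. -/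
lemma cosCoeff_one_add_rpow_succ {β : ℝ} (hβ : 0 ≤ β) (k : ℕ) :
    (k + 1 + β) * cosCoeff (fun x => (1 + x) ^ β) (k + 1)
      = -(k - β) * cosCoeff (fun x => (1 + x) ^ β) k := by
  have hu : Continuous fun t : ℝ => (1 + Real.cos t) ^ β :=
    Continuous.rpow_const (by fun_prop) fun _ => Or.inr hβ
  have hi : ∀ c : ℝ, IntervalIntegrable (fun t => (1 + Real.cos t) ^ β * Real.cos (c * t))
      MeasureTheory.volume 0 (2 * π) := fun c =>
    (hu.mul (by fun_prop)).intervalIntegrable _ _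
  have h := MeasureTheory.integral_eq_of_hasDerivAt_off_countable
    (fun t => (1 + Real.cos t) ^ β * (Real.sin ((k + 1) * t) + Real.sin (k * t)))
    (fun t => (k + 1 + β) * ((1 + Real.cos t) ^ β * Real.cos ((k + 1) * t))
      + (k - β) * ((1 + Real.cos t) ^ β * Real.cos (k * t)))
    (a := 0) (b := 2 * π) (s := {π}) (Set.countable_singleton _)
    (hu.mul (by fun_prop)).continuousOn (fun t ht => ?_)
    (((hi _).const_mul _).add ((hi _).const_mul _))
  · rw [intervalIntegral.integral_add ((hi _).const_mul _) ((hi _).const_mul _),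
      intervalIntegral.integral_const_mul, intervalIntegral.integral_const_mul] at h
    have h1 : Real.sin ((k + 1) * (2 * π)) = 0 := by
      have := Real.sin_nat_mul_two_pi_sub 0 (k + 1)
      simpa using this
    have h2 : Real.sin (k * (2 * π)) = 0 := by
      have := Real.sin_nat_mul_two_pi_sub 0 k
      simpa using this
    simp only [h1, h2, mul_zero, Real.sin_zero, add_zero, sub_self] at h
    simp only [cosCoeff]
    push_cast
    linear_combination (2 * π)⁻¹ * h
  · rw [min_eq_left Real.two_pi_pos.le, max_eq_right Real.two_pi_pos.le] at ht
    have hpos : 0 < 1 + Real.cos t := by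
      refine lt_of_le_of_ne (by linarith [Real.neg_one_le_cos t]) fun h0 => ht.2 ?_
      obtain ⟨m, hm⟩ := Real.cos_eq_neg_one_iff.mp (by linarith)
      have hm1 : (-1 : ℝ) < m := by nlinarith [ht.1.1, Real.pi_pos]
      have hm2 : (m : ℝ) < 1 := by nlinarith [ht.1.2, Real.pi_pos]
      have hm0 : m = 0 := by
        have h1 : -1 < m := by exact_mod_cast hm1
        have h2 : m < 1 := by exact_mod_cast hm2
        omega
      simpa [hm0] using hm.symm
    have hd := ((Real.hasDerivAt_cos t).const_add 1).rpow_const (p := β) (Or.inl hpos.ne')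
    have hs1 := ((hasDerivAt_id t).const_mul ((k : ℝ) + 1)).sin
    have hs2 := ((hasDerivAt_id t).const_mul (k : ℝ)).sin
    refine (hd.mul (hs1.add hs2)).congr_deriv ?_
    have e : (1 + Real.cos t) ^ β = (1 + Real.cos t) ^ (β - 1) * (1 + Real.cos t) := by
      rw [← Real.rpow_add_one hpos.ne', sub_add_cancel]
    rw [e]
    simp only [id, mul_one, Pi.add_apply, add_mul (k : ℝ) 1 t, one_mul, Real.sin_add, Real.cos_add]
    linear_combination -β * (1 + Real.cos t) ^ (β - 1) * Real.cos (k * t)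
      * Real.sin_sq_add_cos_sq t

lemma cosDecay_one_add_rpow {β : ℝ} (hβ : 0 ≤ β) :
    CosDecay (2 * β + 1) fun x => (1 + x) ^ β := by
  refine cosDecay_of_recurrence hβ _ 0 fun k _ => ?_
  have h := congrArg abs (cosCoeff_one_add_rpow_succ hβ k)
  rwa [abs_mul, abs_mul, abs_neg, abs_of_nonneg (by positivity)] at h

lemma one_sub_cos_pos {t : ℝ} (ht : t ∈ Set.Ioo 0 (2 * π)) : 0 < 1 - Real.cos t := by
  refine lt_of_le_of_ne (by linarith [Real.cos_le_one t]) fun h0 => ht.1.ne' ?_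
  exact (Real.cos_eq_one_iff_of_lt_of_lt (by linarith [ht.1, Real.pi_pos]) ht.2).mp (by linarith)

/-- The recurrence for the Chebyshev coefficients of `(1 - x) ^ (m + 1)`. -/
lemma cosCoeff_one_sub_pow_succ (m k : ℕ) :
    (k + 1 + (m + 1 : ℝ)) * cosCoeff (fun x => (1 - x) ^ (m + 1)) (k + 1)
      = (k - (m + 1 : ℝ)) * cosCoeff (fun x => (1 - x) ^ (m + 1)) k := by
  have hi : ∀ c : ℝ, IntervalIntegrable (fun t => (1 - Real.cos t) ^ (m + 1) * Real.cos (c * t))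
      MeasureTheory.volume 0 (2 * π) := fun c =>
    Continuous.intervalIntegrable (by fun_prop) _ _
  have h := intervalIntegral.integral_eq_sub_of_hasDerivAt
    (f := fun t => (1 - Real.cos t) ^ (m + 1) * (Real.sin ((k + 1) * t) - Real.sin (k * t)))
    (f' := fun t => (k + 1 + (m + 1)) * ((1 - Real.cos t) ^ (m + 1) * Real.cos ((k + 1) * t))
      - (k - (m + 1)) * ((1 - Real.cos t) ^ (m + 1) * Real.cos (k * t)))
    (a := 0) (b := 2 * π) (fun t _ => ?_)
    (((hi _).const_mul _).sub ((hi _).const_mul _))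
  · rw [intervalIntegral.integral_sub ((hi _).const_mul _) ((hi _).const_mul _),
      intervalIntegral.integral_const_mul, intervalIntegral.integral_const_mul] at h
    simp only [Real.cos_two_pi, Real.cos_zero, sub_self, ne_eq, Nat.succ_ne_zero,
      not_false_eq_true, zero_pow, zero_mul] at h
    simp only [cosCoeff]
    push_cast
    linear_combination (2 * π)⁻¹ * h
  · have hd := ((Real.hasDerivAt_cos t).const_sub 1).pow (m + 1)
    have hs1 := ((hasDerivAt_id t).const_mul ((k : ℝ) + 1)).sin
    have hs2 := ((hasDerivAt_id t).const_mul (k : ℝ)).sin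
    refine (hd.mul (hs1.sub hs2)).congr_deriv ?_
    simp only [id, mul_one, Pi.sub_apply, Pi.pow_apply, add_mul (k : ℝ) 1 t, one_mul, Real.sin_add,
      Real.cos_add, Nat.add_sub_cancel]
    push_cast
    linear_combination ((m + 1 : ℝ) * (1 - Real.cos t) ^ m * Real.cos (k * t))
      * Real.sin_sq_add_cos_sq t

lemma cosCoeff_one_sub_pow_eq_zero {m k : ℕ} (hk : m + 2 ≤ k) :
    cosCoeff (fun x => (1 - x) ^ (m + 1)) k = 0 := by
  induction k, hk using Nat.le_induction with
  | base =>
    have h := cosCoeff_one_sub_pow_succ m (m + 1)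
    rw [show ((m + 1 : ℕ) : ℝ) - (m + 1) = 0 by push_cast; ring, zero_mul] at h
    exact (mul_eq_zero.mp h).resolve_left (by positivity)
  | succ k hk ih =>
    have h := cosCoeff_one_sub_pow_succ m k
    rw [ih, mul_zero] at h
    exact (mul_eq_zero.mp h).resolve_left (by positivity)

lemma continuous_one_sub_cos_pow_mul_log (m : ℕ) :
    Continuous fun t : ℝ => (1 - Real.cos t) ^ (m + 1) * Real.log (1 - Real.cos t) := by
  have h : Continuous fun t : ℝ => (1 - Real.cos t) * Real.log (1 - Real.cos t) :=
    Real.continuous_mul_log.comp (by fun_prop : Continuous fun t : ℝ => 1 - Real.cos t)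
  simp_rw [pow_succ, mul_assoc]
  exact Continuous.mul (by fun_prop) h

/-- The recurrence for the Chebyshev coefficients of `(1 - x) ^ (m + 1) * log (1 - x)`. -/
lemma cosCoeff_one_sub_pow_mul_log_succ (m k : ℕ) :
    (k + 1 + (m + 1 : ℝ)) * cosCoeff (fun x => (1 - x) ^ (m + 1) * Real.log (1 - x)) (k + 1)
      = (k - (m + 1 : ℝ)) * cosCoeff (fun x => (1 - x) ^ (m + 1) * Real.log (1 - x)) k
        - (cosCoeff (fun x => (1 - x) ^ (m + 1)) (k + 1)
          + cosCoeff (fun x => (1 - x) ^ (m + 1)) k) := by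
  have hu := continuous_one_sub_cos_pow_mul_log m
  have hi : ∀ c : ℝ, IntervalIntegrable (fun t => (1 - Real.cos t) ^ (m + 1) * Real.cos (c * t))
      MeasureTheory.volume 0 (2 * π) := fun c =>
    Continuous.intervalIntegrable (by fun_prop) _ _
  have hl : ∀ c : ℝ, IntervalIntegrable (fun t =>
      (1 - Real.cos t) ^ (m + 1) * Real.log (1 - Real.cos t) * Real.cos (c * t))
      MeasureTheory.volume 0 (2 * π) := fun c => (hu.mul (by fun_prop)).intervalIntegrable _ _
  have hi1 := ((hl (k + 1)).const_mul (k + 1 + (m + 1 : ℝ))).sub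
    ((hl k).const_mul (k - (m + 1 : ℝ)))
  have hi2 := (hi (k + 1)).add (hi k)
  have h := intervalIntegral.integral_eq_sub_of_hasDerivAt_of_le
    (f := fun t => (1 - Real.cos t) ^ (m + 1) * Real.log (1 - Real.cos t)
      * (Real.sin ((k + 1) * t) - Real.sin (k * t)))
    Real.two_pi_pos.le (hu.mul (by fun_prop)).continuousOn (fun t ht => ?_) (hi1.add hi2)
  · rw [intervalIntegral.integral_add hi1 hi2, intervalIntegral.integral_add (hi _) (hi _),
      intervalIntegral.integral_sub ((hl _).const_mul _) ((hl _).const_mul _),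
      intervalIntegral.integral_const_mul, intervalIntegral.integral_const_mul] at h
    simp only [Real.cos_two_pi, Real.cos_zero, sub_self, ne_eq, Nat.succ_ne_zero,
      not_false_eq_true, zero_pow, zero_mul] at h
    simp only [cosCoeff]
    push_cast
    linear_combination (2 * π)⁻¹ * h
  · have hX := one_sub_cos_pos ht
    have hd := (Real.hasDerivAt_cos t).const_sub 1
    have hs1 := ((hasDerivAt_id t).const_mul ((k : ℝ) + 1)).sin
    have hs2 := ((hasDerivAt_id t).const_mul (k : ℝ)).sin
    refine (((hd.pow (m + 1)).mul (hd.log hX.ne')).mul (hs1.sub hs2)).congr_deriv ?_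
    simp only [id, mul_one, Pi.sub_apply, Pi.pow_apply, Pi.mul_apply, add_mul (k : ℝ) 1 t, one_mul,
      Real.sin_add, Real.cos_add, Nat.add_sub_cancel]
    push_cast
    field_simp
    linear_combination (((m + 1 : ℝ) * Real.log (1 - Real.cos t) + 1) * (1 - Real.cos t) ^ (m + 1)
      * Real.cos (k * t)) * Real.sin_sq_add_cos_sq t

lemma cosDecay_one_sub_pow_mul_log (m : ℕ) :
    CosDecay (2 * (m + 1 : ℝ) + 1) fun x => (1 - x) ^ (m + 1) * Real.log (1 - x) := by
  refine cosDecay_of_recurrence (by positivity) _ (m + 2) fun k hk => ?_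
  have h := cosCoeff_one_sub_pow_mul_log_succ m k
  have h1 : cosCoeff (fun x => (1 - x) ^ (m + 1)) (k + 1) = 0 := by
    exact_mod_cast cosCoeff_one_sub_pow_eq_zero (by omega : m + 2 ≤ k + 1)
  rw [h1, cosCoeff_one_sub_pow_eq_zero hk, add_zero, sub_zero] at h
  have h := congrArg abs h
  rwa [abs_mul, abs_mul, abs_of_nonneg (by positivity)] at h

end Decay

section Quadrature

lemma cosCoeff_second_difference {f : ℝ → ℝ} (hf : Continuous fun t => f (Real.cos t)) (k : ℤ) :
    cosCoeff f (k + 2) + cosCoeff f (k - 2) - 2 * cosCoeff f k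
      = -4 * cosCoeff (fun x => f x * (1 - x ^ 2)) k := by
  have hi : ∀ c : ℝ, IntervalIntegrable (fun t => f (Real.cos t) * Real.cos (c * t))
      MeasureTheory.volume 0 (2 * π) := fun c => (hf.mul (by fun_prop)).intervalIntegrable _ _
  have e : ∀ t : ℝ, f (Real.cos t) * (1 - Real.cos t ^ 2) * Real.cos (k * t)
      = -(1 / 4) * (f (Real.cos t) * Real.cos ((k + 2 : ℤ) * t)
        + f (Real.cos t) * Real.cos ((k - 2 : ℤ) * t) - 2 * (f (Real.cos t) * Real.cos (k * t))) := by
    intro t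
    push_cast
    rw [add_mul, sub_mul, Real.cos_add, Real.cos_sub, Real.cos_two_mul]
    ring
  simp only [cosCoeff, e]
  rw [intervalIntegral.integral_const_mul,
    intervalIntegral.integral_sub ((hi _).add (hi _)) ((hi _).const_mul _),
    intervalIntegral.integral_add (hi _) (hi _), intervalIntegral.integral_const_mul]
  ring

lemma integral_sin_int_mul (c : ℤ) :
    ∫ t in (0 : ℝ)..π, Real.sin (c * t) = (1 - Real.cos (c * π)) / c := by
  rcases eq_or_ne (c : ℝ) 0 with hc | hc
  · simp [hc]
  · rw [intervalIntegral.integral_comp_mul_left (fun t => Real.sin t) hc, integral_sin]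
    simp [div_eq_inv_mul]

lemma integral_cos_int_mul_mul_sin (k : ℤ) :
    ∫ t in (0 : ℝ)..π, Real.cos (k * t) * Real.sin t
      = ((1 - Real.cos ((k + 1 : ℤ) * π)) / (k + 1 : ℤ)
        - (1 - Real.cos ((k - 1 : ℤ) * π)) / (k - 1 : ℤ)) / 2 := by
  have e : ∀ t : ℝ, Real.cos (k * t) * Real.sin t
      = (Real.sin ((k + 1 : ℤ) * t) - Real.sin ((k - 1 : ℤ) * t)) / 2 := by
    intro t
    push_cast
    rw [add_mul, sub_mul, Real.sin_add, Real.sin_sub, one_mul]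
    ring
  simp_rw [e]
  rw [intervalIntegral.integral_div, intervalIntegral.integral_sub, integral_sin_int_mul,
    integral_sin_int_mul]
  · exact Continuous.intervalIntegrable (by fun_prop) _ _
  · exact Continuous.intervalIntegrable (by fun_prop) _ _

lemma integral_cos_odd_mul_mul_sin (i : ℤ) :
    ∫ t in (0 : ℝ)..π, Real.cos ((2 * i + 1 : ℤ) * t) * Real.sin t = 0 := by
  have h1 : Real.cos ((2 * i + 1 + 1 : ℤ) * π) = 1 := by
    rw [← Real.cos_int_mul_two_pi (i + 1)]
    push_cast
    ring_nf
  have h2 : Real.cos ((2 * i + 1 - 1 : ℤ) * π) = 1 := by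
    rw [← Real.cos_int_mul_two_pi i]
    push_cast
    ring_nf
  rw [integral_cos_int_mul_mul_sin, h1, h2]
  simp

lemma integral_cos_even_mul_mul_sin (i : ℤ) :
    ∫ t in (0 : ℝ)..π, Real.cos ((2 * i : ℤ) * t) * Real.sin t = 2 / (1 - 4 * (i : ℝ) ^ 2) := by
  have h1 : Real.cos ((2 * i + 1 : ℤ) * π) = -1 := by
    rw [show ((2 * i + 1 : ℤ) : ℝ) * π = i * (2 * π) + π by push_cast; ring,
      Real.cos_int_mul_two_pi_add_pi]
  have h2 : Real.cos ((2 * i - 1 : ℤ) * π) = -1 := by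
    rw [show ((2 * i - 1 : ℤ) : ℝ) * π = i * (2 * π) - π by push_cast; ring,
      Real.cos_int_mul_two_pi_sub_pi]
  have h3 : ((2 * i + 1 : ℤ) : ℝ) ≠ 0 := by exact_mod_cast (by omega : 2 * i + 1 ≠ 0)
  have h4 : ((2 * i - 1 : ℤ) : ℝ) ≠ 0 := by exact_mod_cast (by omega : 2 * i - 1 ≠ 0)
  rw [integral_cos_int_mul_mul_sin, h1, h2]
  have h5 : (1 : ℝ) - 4 * (i : ℝ) ^ 2 = -((2 * i + 1 : ℤ) * (2 * i - 1 : ℤ)) := by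
    push_cast
    ring
  rw [h5]
  field_simp
  push_cast
  ring

lemma integral_eq_integral_cos {f : ℝ → ℝ} (hf : Continuous fun t => f (Real.cos t)) :
    ∫ x in (-1 : ℝ)..1, f x = ∫ t in (0 : ℝ)..π, f (Real.cos t) * Real.sin t := by
  have hfc : ContinuousOn f (Set.Icc (-1) 1) :=
    (hf.comp Real.continuous_arccos).continuousOn.congr fun x hx => by
      simp [Real.cos_arccos hx.1 hx.2]
  have h := intervalIntegral.integral_comp_mul_deriv'' (a := 0) (b := π) (f := Real.cos)
    (f' := fun t => -Real.sin t) (g := f) Real.continuous_cos.continuousOn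
    (fun t _ => (Real.hasDerivAt_cos t).hasDerivWithinAt) (by fun_prop)
    (hfc.mono (by rintro _ ⟨t, _, rfl⟩; exact Real.cos_mem_Icc t))
  simp only [Function.comp_apply, mul_neg, intervalIntegral.integral_neg, Real.cos_zero,
    Real.cos_pi] at h
  rw [intervalIntegral.integral_symm, ← h, neg_neg]

lemma hasSum_integral_cosCoeff {f : ℝ → ℝ} (hf : Continuous fun t => f (Real.cos t))
    (hs : Summable fun k : ℤ => |cosCoeff f k|) :
    HasSum (fun i : ℕ => 4 * cosCoeff f (2 * i) / (1 - 4 * (i : ℝ) ^ 2))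
      ((∫ x in (-1 : ℝ)..1, f x) + 2 * cosCoeff f 0) := by
  have h1 : HasSum (fun k : ℤ => ∫ t in (0 : ℝ)..π, cosCoeff f k * Real.cos (k * t) * Real.sin t)
      (∫ x in (-1 : ℝ)..1, f x) := by
    rw [integral_eq_integral_cos hf]
    refine hasSum_integral_of_summable_bound _ _ (b := fun k => |cosCoeff f k|)
      (fun k => by fun_prop) (fun k t => ?_) hs fun t => (hasSum_cosCoeff hf hs t).mul_right _
    rw [abs_mul, abs_mul]
    exact mul_le_of_le_one_right (by positivity) (Real.abs_sin_le_one t) |>.trans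
      (mul_le_of_le_one_right (by positivity) (Real.abs_cos_le_one _))
  simp_rw [mul_assoc, intervalIntegral.integral_const_mul] at h1
  have hinj : Function.Injective fun i : ℤ => 2 * i := fun i j h => by simpa using h
  rw [← hinj.hasSum_iff] at h1
  · have h2 := h1.nat_add_neg
    convert h2 using 1
    · ext i
      simp only [Function.comp_apply, mul_neg, cosCoeff_neg, Int.cast_neg, neg_mul, Real.cos_neg]
      rw [integral_cos_even_mul_mul_sin]
      push_cast
      ring
    · have := integral_cos_even_mul_mul_sin 0
      simp only [Function.comp_apply, mul_zero] at this ⊢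
      rw [this]
      simp [mul_comm]
  · intro k hk
    have hodd : Odd k := by
      rw [← Int.not_even_iff_odd]
      rintro ⟨i, rfl⟩
      exact hk ⟨i, by ring⟩
    obtain ⟨i, rfl⟩ := hodd
    rw [integral_cos_odd_mul_mul_sin, mul_zero]

lemma sum_ccDelta_mul {n : ℕ} (hn : 0 < n) (u : ℕ → ℝ) :
    ∑ j ∈ Finset.range (n + 1), ccDelta n j * u j
      = ∑ j ∈ Finset.range n, (u j + u (j + 1)) / 2 := by
  obtain ⟨n, rfl⟩ : ∃ m, n = m + 1 := ⟨n - 1, by omega⟩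
  rw [Finset.sum_range_succ, Finset.sum_range_succ', ← Finset.sum_div, Finset.sum_add_distrib,
    Finset.sum_range_succ' u, Finset.sum_range_succ (fun i => u (i + 1))]
  have h : ∀ j ∈ Finset.range n, ccDelta (n + 1) (j + 1) * u (j + 1) = u (j + 1) := by
    intro j hj
    have := Finset.mem_range.mp hj
    rw [ccDelta, if_neg (by omega), one_mul]
  rw [Finset.sum_congr rfl h]
  simp only [ccDelta, true_or, or_true, if_true]
  ring

/-- Discrete orthogonality for the trapezoidal rule. -/
lemma sum_ccDelta_mul_cos {n : ℕ} (hn : 0 < n) (m : ℤ) :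
    ∑ j ∈ Finset.range (n + 1), ccDelta n j * Real.cos (m * (j * π / n))
      = if (2 * n : ℤ) ∣ m then (n : ℝ) else 0 := by
  have hn' : (n : ℝ) ≠ 0 := by positivity
  rw [sum_ccDelta_mul hn fun j => Real.cos (m * (j * π / n))]
  split_ifs with hd
  · obtain ⟨l, rfl⟩ := hd
    have h : ∀ j : ℕ, Real.cos ((2 * n * l : ℤ) * (j * π / n)) = 1 := by
      intro j
      rw [← Real.cos_int_mul_two_pi (l * j)]
      congr 1
      push_cast
      field_simp
    simp only [h]
    simp
  · have hsin : Real.sin (m * π / (2 * n)) ≠ 0 := by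
      rw [Ne, Real.sin_eq_zero_iff]
      rintro ⟨l, hl⟩
      refine hd ⟨l, ?_⟩
      have hpi := Real.pi_ne_zero
      field_simp at hl
      have : (m : ℝ) = ((2 * n * l : ℤ) : ℝ) := by
        push_cast
        linarith
      exact_mod_cast this
    have htel : ∀ j : ℕ, 2 * Real.sin (m * π / (2 * n))
        * ((Real.cos (m * (j * π / n)) + Real.cos (m * ((j + 1 : ℕ) * π / n))) / 2)
        = Real.cos (m * π / (2 * n))
          * (Real.sin (m * ((j + 1 : ℕ) * π / n)) - Real.sin (m * (j * π / n))) := by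
      intro j
      rw [show (m : ℝ) * ((j + 1 : ℕ) * π / n)
          = m * (j * π / n) + 2 * (m * π / (2 * n)) by push_cast; field_simp,
        Real.cos_add, Real.sin_add, Real.sin_two_mul, Real.cos_two_mul]
      linear_combination (-2 * Real.cos (m * π / (2 * n)) * Real.sin (m * (j * π / n)))
        * Real.sin_sq_add_cos_sq (m * π / (2 * n))
    have h : 2 * Real.sin (m * π / (2 * n)) * ∑ j ∈ Finset.range n,
        (Real.cos (m * (j * π / n)) + Real.cos (m * ((j + 1 : ℕ) * π / n))) / 2 = 0 := by
      rw [Finset.mul_sum, Finset.sum_congr rfl fun j _ => htel j, ← Finset.mul_sum,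
        Finset.sum_range_sub fun j : ℕ => Real.sin (m * (j * π / n)), mul_div_cancel_left₀ _ hn']
      simp [Real.sin_int_mul_pi]
    exact (mul_eq_zero.mp h).resolve_left (mul_ne_zero two_ne_zero hsin)

lemma hasSum_sum_ccDelta_mul {f : ℝ → ℝ} (hf : Continuous fun t => f (Real.cos t))
    (hs : Summable fun k : ℤ => |cosCoeff f k|) {n : ℕ} (hn : 0 < n) (l : ℤ) :
    HasSum (fun m : ℤ => n * cosCoeff f (2 * n * m + l))
      (∑ j ∈ Finset.range (n + 1),
        ccDelta n j * (f (Real.cos (j * π / n)) * Real.cos (l * (j * π / n)))) := by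
  have hn2 : (2 * n : ℤ) ≠ 0 := by positivity
  have h1 : HasSum (fun k : ℤ => (n : ℝ) / 2 * ((if (2 * n : ℤ) ∣ k + l then cosCoeff f k else (0 : ℝ))
        + if (2 * n : ℤ) ∣ k - l then cosCoeff f k else 0))
      (∑ j ∈ Finset.range (n + 1),
        ccDelta n j * (f (Real.cos (j * π / n)) * Real.cos (l * (j * π / n)))) := by
    have h := hasSum_sum (s := Finset.range (n + 1)) fun j _ =>
      ((hasSum_cosCoeff hf hs (j * π / n)).mul_right (Real.cos (l * (j * π / n)))).mul_left
        (ccDelta n j)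
    have e : ∀ (k : ℤ) (j : ℕ), ccDelta n j
        * (cosCoeff f k * Real.cos (k * (j * π / n)) * Real.cos (l * (j * π / n)))
        = cosCoeff f k / 2 * (ccDelta n j * Real.cos (((k + l : ℤ) : ℝ) * (j * π / n))
          + ccDelta n j * Real.cos (((k - l : ℤ) : ℝ) * (j * π / n))) := by
      intro k j
      push_cast
      rw [add_mul, sub_mul, Real.cos_add, Real.cos_sub]
      ring
    simp only [e, ← Finset.mul_sum,
      Finset.sum_add_distrib, sum_ccDelta_mul_cos hn] at h
    refine (congrArg (HasSum · _) (funext fun k => ?_)).mp h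
    split_ifs <;> ring
  have hsum : ∀ l : ℤ, HasSum (fun k : ℤ => if (2 * n : ℤ) ∣ k - l then cosCoeff f k else 0)
      (∑' m : ℤ, cosCoeff f (2 * n * m + l)) := by
    intro l
    have hinj : Function.Injective fun m : ℤ => 2 * n * m + l := fun i j h => by
      simpa [hn.ne'] using h
    rw [← hinj.hasSum_iff]
    · have : Summable fun m : ℤ => cosCoeff f (2 * n * m + l) :=
        hs.of_abs.comp_injective hinj
      simpa [Function.comp_def] using this.hasSum
    · intro k hk
      rw [if_neg]
      rintro ⟨m, hm⟩
      exact hk ⟨m, by linarith⟩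
  have hneg : ∑' m : ℤ, cosCoeff f (2 * n * m + -l) = ∑' m : ℤ, cosCoeff f (2 * n * m + l) := by
    rw [← (Equiv.neg ℤ).tsum_eq]
    refine tsum_congr fun m => ?_
    rw [← cosCoeff_neg]
    congr 1
    simp
    ring
  have h2 := ((hsum (-l)).add (hsum l)).mul_left ((n : ℝ) / 2)
  simp only [sub_neg_eq_add] at h2
  rw [hneg] at h2
  rw [h1.unique h2]
  have hinj : Function.Injective fun m : ℤ => 2 * n * m + l := fun i j h => by
    simpa [hn.ne'] using h
  have h3 : Summable fun m : ℤ => cosCoeff f (2 * n * m + l) := hs.of_abs.comp_injective hinj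
  rw [← two_mul, ← mul_assoc, div_mul_cancel₀ _ two_ne_zero]
  exact h3.hasSum.mul_left (n : ℝ)

lemma ccQuad_eq_sum (f : ℝ → ℝ) (n : ℕ) :
    ccQuad f n = ∑ i ∈ Finset.range (n / 2 + 1), 4 * ccDelta n (2 * i) / (1 - 4 * (i : ℝ) ^ 2)
      * ((∑ j ∈ Finset.range (n + 1), ccDelta n j
        * (f (Real.cos (j * π / n)) * Real.cos ((2 * i : ℤ) * (j * π / n)))) / n) := by
  simp only [ccQuad, ccWeight, Finset.mul_sum, Finset.sum_mul, Finset.sum_div]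
  rw [Finset.sum_comm]
  refine Finset.sum_congr rfl fun i _ => Finset.sum_congr rfl fun j _ => ?_
  rw [show ((2 * i : ℤ) : ℝ) * (j * π / n) = 2 * (j : ℝ) * (i : ℝ) * π / (n : ℝ) by
    push_cast; ring]
  ring

lemma hasSum_ccQuad {f : ℝ → ℝ} (hf : Continuous fun t => f (Real.cos t))
    (hs : Summable fun k : ℤ => |cosCoeff f k|) {n : ℕ} (hn : 0 < n) :
    HasSum (fun m : ℕ => ∑ i ∈ Finset.range (n / 2 + 1),
        4 * ccDelta n (2 * i) / (1 - 4 * (i : ℝ) ^ 2)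
          * (cosCoeff f (2 * n * (m + 1 : ℕ) + 2 * i) + cosCoeff f (2 * n * (m + 1 : ℕ) - 2 * i)))
      (ccQuad f n - ∑ i ∈ Finset.range (n / 2 + 1),
        4 * ccDelta n (2 * i) / (1 - 4 * (i : ℝ) ^ 2) * cosCoeff f (2 * i)) := by
  rw [ccQuad_eq_sum, ← Finset.sum_sub_distrib]
  simp_rw [← mul_sub]
  refine hasSum_sum fun i _ => HasSum.mul_left _ ?_
  have h := ((hasSum_sum_ccDelta_mul hf hs hn (2 * i)).div_const (n : ℝ)).nat_add_neg
  have hn' : (n : ℝ) ≠ 0 := by positivity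
  simp only [mul_div_cancel_left₀ _ hn'] at h
  have e : ∀ m : ℕ, cosCoeff f (2 * n * -(m : ℤ) + 2 * i) = cosCoeff f (2 * n * m - 2 * i) := by
    intro m
    rw [← cosCoeff_neg]
    congr 1
    ring
  simp only [e] at h
  rw [← hasSum_nat_add_iff' 1] at h
  simp only [Finset.range_one, Finset.sum_singleton, Nat.cast_zero, mul_zero, zero_add,
    zero_sub, cosCoeff_neg] at h
  rwa [add_sub_add_right_eq_sub] at h

lemma sum_ccDelta_two_mul {n : ℕ} (hn : 2 ≤ n) (u : ℕ → ℝ) :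
    ∑ i ∈ Finset.range (n / 2 + 1), ccDelta n (2 * i) * u i
      = ∑ i ∈ Finset.range (n / 2 + 1), u i - u 0 / 2
        - if 2 * (n / 2) = n then u (n / 2) / 2 else 0 := by
  obtain ⟨N, hN⟩ : ∃ N, n / 2 = N + 1 := ⟨n / 2 - 1, by omega⟩
  rw [hN, Finset.sum_range_succ, Finset.sum_range_succ', Finset.sum_range_succ,
    Finset.sum_range_succ']
  have h : ∀ i ∈ Finset.range N, ccDelta n (2 * (i + 1)) * u (i + 1) = u (i + 1) := by
    intro i hi
    have := Finset.mem_range.mp hi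
    rw [ccDelta, if_neg (by omega), one_mul]
  rw [Finset.sum_congr rfl h]
  have h0 : ccDelta n (2 * 0) = 1 / 2 := by simp [ccDelta]
  rw [h0]
  split_ifs with hd
  · rw [ccDelta, if_pos (Or.inr hd)]
    ring
  · rw [ccDelta, if_neg (by omega)]
    ring

lemma sum_one_div_one_sub_four_mul_sq (N : ℕ) :
    ∑ i ∈ Finset.range (N + 1), 1 / (1 - 4 * (i : ℝ) ^ 2)
      = (1 / 2 + 1 / (2 * (2 * N + 1)) : ℝ) := by
  induction N with
  | zero => norm_num
  | succ N ih =>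
    rw [Finset.sum_range_succ, ih]
    push_cast
    have h1 : (1 : ℝ) - 4 * (N + 1) ^ 2 = -((2 * N + 1) * (2 * N + 3)) := by ring
    have h2 : (2 : ℝ) * N + 1 ≠ 0 := by positivity
    have h3 : (2 : ℝ) * N + 3 ≠ 0 := by positivity
    have h4 : (2 : ℝ) * (N + 1) + 1 = 2 * N + 3 := by ring
    rw [h1, h4]
    field_simp
    ring

lemma abs_sum_ccDelta_div_le {n : ℕ} (hn : 2 ≤ n) :
    |∑ i ∈ Finset.range (n / 2 + 1), ccDelta n (2 * i) * (1 / (1 - 4 * (i : ℝ) ^ 2))|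
      ≤ (1 / n : ℝ) := by
  have hn' : (2 : ℝ) ≤ n := by exact_mod_cast hn
  rw [sum_ccDelta_two_mul hn, sum_one_div_one_sub_four_mul_sq]
  have h1 : (n : ℝ) ≤ 2 * (n / 2 : ℕ) + 1 := by exact_mod_cast (by omega : n ≤ 2 * (n / 2) + 1)
  have h2 : 1 / (2 * (2 * ((n / 2 : ℕ) : ℝ) + 1)) ≤ 1 / (2 * n) := by gcongr
  have h3 : 0 ≤ 1 / (2 * (2 * ((n / 2 : ℕ) : ℝ) + 1)) := by positivity
  have h4 : (1 : ℝ) / n = 1 / (2 * n) + 1 / (2 * n) := by field_simp; ring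
  have h5 : (0 : ℝ) < 1 / (2 * n) := by positivity
  rw [Nat.cast_zero, show (1 : ℝ) / (1 - 4 * 0 ^ 2) = 1 by norm_num, abs_le]
  split_ifs with hd
  · have h6 : 1 - 4 * (((n / 2 : ℕ) : ℝ)) ^ 2 = -((n : ℝ) ^ 2 - 1) := by
      have : 2 * ((n / 2 : ℕ) : ℝ) = n := by exact_mod_cast hd
      rw [← this]
      ring
    have h7 : 1 / ((n : ℝ) ^ 2 - 1) ≤ 1 / n :=
      one_div_le_one_div_of_le (by linarith) (by nlinarith)
    have h8 : 0 ≤ 1 / ((n : ℝ) ^ 2 - 1) := one_div_nonneg.mpr (by nlinarith)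
    rw [h6, one_div_neg_eq_neg_one_div]
    constructor <;> linarith
  · constructor <;> linarith

/-- A symmetric second difference with a large step is controlled by those with unit step. -/
lemma abs_second_difference_le {u : ℤ → ℝ} {B : ℝ} {N : ℕ}
    (h : ∀ l : ℤ, |l| ≤ N → |u (l + 1) + u (l - 1) - 2 * u l| ≤ B) :
    ∀ i : ℕ, i ≤ N → |u i + u (-i) - 2 * u 0| ≤ i ^ 2 * B := by
  have hB : 0 ≤ B := (abs_nonneg _).trans (h 0 (by simp))
  have key : ∀ i : ℕ, i ≤ N → |u i + u (-i) - 2 * u 0| ≤ i ^ 2 * B ∧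
      |(u (i + 1) + u (-(i + 1))) - (u i + u (-i))| ≤ (2 * i + 1) * B := by
    intro i
    induction i with
    | zero =>
      intro _
      have := h 0 (by simp)
      refine ⟨by simp [two_mul], ?_⟩
      convert this using 2
      · simp
        ring
      · simp
    | succ i ih =>
      intro hi
      obtain ⟨ih1, ih2⟩ := ih (by omega)
      have h1 := h (i + 1) (by rw [abs_of_nonneg (by positivity)]; omega)
      have h2 := h (-(i + 1)) (by rw [abs_neg, abs_of_nonneg (by positivity)]; omega)
      rw [show -((i : ℤ) + 1) + 1 = -i by ring,
        show -((i : ℤ) + 1) - 1 = -(i + 1 + 1) by ring] at h2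
      rw [show (i : ℤ) + 1 - 1 = i by ring] at h1
      simp only [abs_le] at ih1 ih2 h1 h2 ⊢
      push_cast
      refine ⟨⟨by nlinarith, by nlinarith⟩, by nlinarith, by nlinarith⟩
  exact fun i hi => (key i hi).1

lemma hasSum_one_div_four_mul_sq_sub_one (N : ℕ) :
    HasSum (fun i : ℕ => 1 / (4 * ((i + (N + 1) : ℕ) : ℝ) ^ 2 - 1))
      (1 / (2 * (2 * (N : ℝ) + 1))) := by
  rw [hasSum_iff_tendsto_nat_of_nonneg]
  · have e : ∀ M : ℕ, ∑ i ∈ Finset.range M, 1 / (4 * ((i + (N + 1) : ℕ) : ℝ) ^ 2 - 1)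
        = 1 / (2 * (2 * N + 1)) - 1 / (2 * (2 * ((M + N : ℕ) : ℝ) + 1)) := by
      intro M
      have h := sum_one_div_one_sub_four_mul_sq (M + N)
      rw [show M + N + 1 = (N + 1) + M by ring, Finset.sum_range_add,
        sum_one_div_one_sub_four_mul_sq] at h
      rw [← neg_inj, ← Finset.sum_neg_distrib]
      have h2 : ∀ i : ℕ, -(1 / (4 * ((i + (N + 1) : ℕ) : ℝ) ^ 2 - 1))
          = 1 / (1 - 4 * ((N + 1 + i : ℕ) : ℝ) ^ 2) := by
        intro i
        rw [← one_div_neg_eq_neg_one_div, neg_sub, add_comm i]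
      simp only [h2]
      linarith
    simp only [e]
    have h : Tendsto (fun M : ℕ => 1 / (2 * (2 * ((M + N : ℕ) : ℝ) + 1))) atTop (nhds 0) := by
      simp only [one_div]
      refine Tendsto.inv_tendsto_atTop (Tendsto.const_mul_atTop two_pos
        (tendsto_atTop_add_const_right _ _ (Tendsto.const_mul_atTop two_pos ?_)))
      exact tendsto_natCast_atTop_atTop.comp (tendsto_add_atTop_nat N)
    simpa using h.const_sub (1 / (2 * (2 * (N : ℝ) + 1)))
  · intro i
    have : (1 : ℝ) ≤ ((i + (N + 1) : ℕ) : ℝ) := by exact_mod_cast (by omega : 1 ≤ i + (N + 1))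
    exact one_div_nonneg.mpr (by nlinarith)

lemma ccDelta_nonneg (n j : ℕ) : 0 ≤ ccDelta n j := by
  unfold ccDelta
  split_ifs <;> norm_num

lemma ccDelta_le_one (n j : ℕ) : ccDelta n j ≤ 1 := by
  unfold ccDelta
  split_ifs <;> norm_num

lemma abs_four_mul_ccDelta_div_mul_sq_le (n i : ℕ) :
    |4 * ccDelta n (2 * i) / (1 - 4 * (i : ℝ) ^ 2)| * (i : ℝ) ^ 2 ≤ 4 := by
  rcases Nat.eq_zero_or_pos i with rfl | hi
  · simp
  · have h1 : (1 : ℝ) ≤ i := by exact_mod_cast hi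
    have h2 : (i : ℝ) ^ 2 ≤ 4 * (i : ℝ) ^ 2 - 1 := by nlinarith
    have h3 : 0 < 4 * (i : ℝ) ^ 2 - 1 := by nlinarith
    rw [abs_div, abs_of_nonneg (by linarith [ccDelta_nonneg n (2 * i)]), abs_sub_comm,
      abs_of_pos h3, div_mul_eq_mul_div, div_le_iff₀ h3]
    have := ccDelta_le_one n (2 * i)
    have := ccDelta_nonneg n (2 * i)
    nlinarith [mul_le_mul (ccDelta_le_one n (2 * i)) h2 (by positivity) zero_le_one]

lemma one_add_abs_rpow_neg_le {s P : ℝ} (hs : 0 ≤ s) (hP : 0 < P) {k : ℤ} (h : P ≤ |(k : ℝ)|) :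
    (1 + |(k : ℝ)|) ^ (-s) ≤ P ^ (-s) :=
  Real.rpow_le_rpow_of_nonpos hP (by linarith) (by linarith)

lemma abs_aliasing_le {f : ℝ → ℝ} {r C D : ℝ} (hr : 1 < r)
    (hf : Continuous fun t => f (Real.cos t)) (hC0 : 0 ≤ C) (hD0 : 0 ≤ D)
    (hC : ∀ k : ℤ, |cosCoeff f k| ≤ C * (1 + |(k : ℝ)|) ^ (-r))
    (hD : ∀ k : ℤ, |cosCoeff (fun x => f x * (1 - x ^ 2)) k| ≤ D * (1 + |(k : ℝ)|) ^ (-(r + 2)))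
    {n : ℕ} (hn : 2 ≤ n) (m : ℕ) :
    |∑ i ∈ Finset.range (n / 2 + 1), 4 * ccDelta n (2 * i) / (1 - 4 * (i : ℝ) ^ 2)
        * (cosCoeff f (2 * n * (m + 1 : ℕ) + 2 * i) + cosCoeff f (2 * n * (m + 1 : ℕ) - 2 * i))|
      ≤ (8 * C + 16 * D) * (n : ℝ) ^ (-(r + 1)) * ((m + 1 : ℕ) : ℝ) ^ (-r) := by
  set K : ℤ := 2 * n * (m + 1 : ℕ) with hK
  set q : ℝ := ((m + 1 : ℕ) : ℝ) with hq
  have hn0 : (0 : ℝ) < n := by positivity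
  have hq1 : (1 : ℝ) ≤ q := by rw [hq]; exact_mod_cast (by omega : 1 ≤ m + 1)
  have hq0 : 0 < q := by linarith
  have hP : 0 < n * q := by positivity
  have hKq : (K : ℝ) = 2 * (n * q) := by
    rw [hK, hq]
    push_cast
    ring
  have hKa : ∀ l : ℤ, |l| ≤ (n / 2 : ℕ) → n * q ≤ |((K + 2 * l : ℤ) : ℝ)| := by
    intro l hl
    have h1 : -(n : ℤ) ≤ 2 * l := by
      have := neg_abs_le l
      omega
    have h2 : -(n : ℝ) ≤ 2 * l := by exact_mod_cast h1
    refine le_trans ?_ (le_abs_self _)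
    push_cast
    rw [hKq]
    nlinarith
  set B : ℝ := 4 * (D * (n * q) ^ (-(r + 2))) with hB
  have hdiff : ∀ i : ℕ, i ≤ n / 2 →
      |cosCoeff f (K + 2 * i) + cosCoeff f (K - 2 * i) - 2 * cosCoeff f K| ≤ i ^ 2 * B := by
    have h := abs_second_difference_le (u := fun l => cosCoeff f (K + 2 * l)) (B := B)
      (N := n / 2) ?_
    · simpa [← sub_eq_add_neg] using h
    · intro l hl
      have := cosCoeff_second_difference hf (K + 2 * l)
      rw [show K + 2 * (l + 1) = K + 2 * l + 2 by ring,
        show K + 2 * (l - 1) = K + 2 * l - 2 by ring, this, abs_mul, abs_neg,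
        abs_of_pos (by norm_num : (0 : ℝ) < 4)]
      refine mul_le_mul_of_nonneg_left ((hD _).trans ?_) (by norm_num)
      exact mul_le_mul_of_nonneg_left (one_add_abs_rpow_neg_le (by linarith) hP (hKa l hl)) hD0
  have hsplit : ∑ i ∈ Finset.range (n / 2 + 1), 4 * ccDelta n (2 * i) / (1 - 4 * (i : ℝ) ^ 2)
        * (cosCoeff f (K + 2 * i) + cosCoeff f (K - 2 * i))
      = 8 * cosCoeff f K * ∑ i ∈ Finset.range (n / 2 + 1),
          ccDelta n (2 * i) * (1 / (1 - 4 * (i : ℝ) ^ 2))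
        + ∑ i ∈ Finset.range (n / 2 + 1), 4 * ccDelta n (2 * i) / (1 - 4 * (i : ℝ) ^ 2)
          * (cosCoeff f (K + 2 * i) + cosCoeff f (K - 2 * i) - 2 * cosCoeff f K) := by
    rw [Finset.mul_sum, ← Finset.sum_add_distrib]
    refine Finset.sum_congr rfl fun i _ => ?_
    ring
  have hfirst : |8 * cosCoeff f K * ∑ i ∈ Finset.range (n / 2 + 1),
      ccDelta n (2 * i) * (1 / (1 - 4 * (i : ℝ) ^ 2))|
      ≤ 8 * C * ((n : ℝ) ^ (-(r + 1)) * q ^ (-r)) := by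
    have h1 : |cosCoeff f K| ≤ C * (n * q) ^ (-r) := by
      refine (hC K).trans (mul_le_mul_of_nonneg_left ?_ hC0)
      exact one_add_abs_rpow_neg_le (by linarith) hP (by simpa using hKa 0 (by rw [abs_zero]; positivity))
    have h2 : (n : ℝ) ^ (-(r + 1)) * q ^ (-r) = (n * q) ^ (-r) * (1 / n) := by
      rw [Real.mul_rpow hn0.le hq0.le, neg_add, ← sub_eq_add_neg, Real.rpow_sub_one hn0.ne']
      ring
    rw [abs_mul, abs_mul, abs_of_pos (by norm_num : (0 : ℝ) < 8)]
    calc _ ≤ 8 * (C * (n * q) ^ (-r)) * (1 / n) := by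
          gcongr
          exact abs_sum_ccDelta_div_le hn
      _ = _ := by rw [h2]; ring
  have hsecond : |∑ i ∈ Finset.range (n / 2 + 1), 4 * ccDelta n (2 * i) / (1 - 4 * (i : ℝ) ^ 2)
      * (cosCoeff f (K + 2 * i) + cosCoeff f (K - 2 * i) - 2 * cosCoeff f K)|
      ≤ 16 * D * ((n : ℝ) ^ (-(r + 1)) * q ^ (-r)) := by
    have hB0 : 0 ≤ B := by positivity
    have h1 : ∀ i ∈ Finset.range (n / 2 + 1), |4 * ccDelta n (2 * i) / (1 - 4 * (i : ℝ) ^ 2)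
        * (cosCoeff f (K + 2 * i) + cosCoeff f (K - 2 * i) - 2 * cosCoeff f K)| ≤ 4 * B := by
      intro i hi
      rw [abs_mul]
      refine (mul_le_mul_of_nonneg_left
        (hdiff i (Nat.lt_succ_iff.mp (Finset.mem_range.mp hi))) (abs_nonneg _)).trans ?_
      rw [← mul_assoc]
      exact mul_le_mul_of_nonneg_right (abs_four_mul_ccDelta_div_mul_sq_le n i) hB0
    have h2 : (n : ℝ) * (n * q) ^ (-(r + 2)) ≤ (n : ℝ) ^ (-(r + 1)) * q ^ (-r) := by
      have h3 : (n : ℝ) ^ (-(r + 1)) = n * (n : ℝ) ^ (-(r + 2)) := by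
        rw [← Real.rpow_one_add' hn0.le (by linarith)]
        congr 1
        ring
      rw [Real.mul_rpow hn0.le hq0.le, h3, ← mul_assoc]
      gcongr
      linarith
    have h4 : ((n / 2 + 1 : ℕ) : ℝ) ≤ n := by exact_mod_cast (by omega : n / 2 + 1 ≤ n)
    refine (Finset.abs_sum_le_sum_abs _ _).trans ((Finset.sum_le_card_nsmul _ _ _ h1).trans ?_)
    rw [Finset.card_range, nsmul_eq_mul]
    calc ((n / 2 + 1 : ℕ) : ℝ) * (4 * B) ≤ n * (4 * B) := by gcongr
      _ = 16 * D * (n * (n * q) ^ (-(r + 2))) := by rw [hB]; ring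
      _ ≤ _ := by gcongr
  rw [hsplit]
  refine (abs_add_le _ _).trans ((add_le_add hfirst hsecond).trans (le_of_eq ?_))
  ring

lemma abs_ccError_le {f : ℝ → ℝ} {r C D : ℝ} (hr : 1 < r)
    (hf : Continuous fun t => f (Real.cos t)) (hC0 : 0 ≤ C) (hD0 : 0 ≤ D)
    (hC : ∀ k : ℤ, |cosCoeff f k| ≤ C * (1 + |(k : ℝ)|) ^ (-r))
    (hD : ∀ k : ℤ, |cosCoeff (fun x => f x * (1 - x ^ 2)) k| ≤ D * (1 + |(k : ℝ)|) ^ (-(r + 2)))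
    {n : ℕ} (hn : 2 ≤ n) :
    |ccError f n| ≤ (4 * C + (8 * C + 16 * D) * ∑' m : ℕ, ((m + 1 : ℕ) : ℝ) ^ (-r))
      * (n : ℝ) ^ (-(r + 1)) := by
  have hs : Summable fun k : ℤ => |cosCoeff f k| := CosDecay.summable_abs ⟨C, hC⟩ hr
  have hn2 : (2 : ℝ) ≤ n := by exact_mod_cast hn
  have hn0 : (0 : ℝ) < n := by linarith
  have hpow : (n : ℝ) ^ (-(r + 1)) = (n : ℝ) ^ (-r) * (1 / n) := by
    rw [neg_add, ← sub_eq_add_neg, Real.rpow_sub_one hn0.ne']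
    ring
  set N := n / 2 with hN
  set q : ℕ → ℝ := fun i => 4 * cosCoeff f (2 * i) / (1 - 4 * (i : ℝ) ^ 2) with hq
  set T := (∫ x in (-1 : ℝ)..1, f x) + 2 * cosCoeff f 0 - ∑ i ∈ Finset.range (N + 1), q i with hT
  have hTsum : HasSum (fun i => q (i + (N + 1))) T :=
    (hasSum_nat_add_iff' (N + 1)).mpr (hasSum_integral_cosCoeff hf hs)
  have hqle : ∀ i : ℕ, n ≤ 2 * i →
      |q i| ≤ 4 * C * (n : ℝ) ^ (-r) * (1 / (4 * (i : ℝ) ^ 2 - 1)) := by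
    intro i hi
    have h1 : (n : ℝ) ≤ 2 * i := by exact_mod_cast hi
    have h2 : 0 < 4 * (i : ℝ) ^ 2 - 1 := by nlinarith
    have h3 : |cosCoeff f (2 * i)| ≤ C * (n : ℝ) ^ (-r) := by
      refine (hC _).trans (mul_le_mul_of_nonneg_left ?_ hC0)
      refine one_add_abs_rpow_neg_le (by linarith) hn0 (le_trans ?_ (le_abs_self _))
      push_cast
      exact h1
    rw [hq]
    simp only
    rw [abs_div, abs_mul, abs_of_pos (by norm_num : (0 : ℝ) < 4), abs_sub_comm, abs_of_pos h2,
      div_eq_mul_one_div, mul_assoc 4 C]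
    gcongr
  have hTle : |T| ≤ 2 * C * (n : ℝ) ^ (-(r + 1)) := by
    have h1 := hTsum.norm_le_of_bounded
      ((hasSum_one_div_four_mul_sq_sub_one N).mul_left (4 * C * (n : ℝ) ^ (-r)))
      fun i => hqle _ (by omega)
    have h2 : (n : ℝ) ≤ 2 * N + 1 := by exact_mod_cast (by omega : n ≤ 2 * N + 1)
    refine h1.trans ?_
    calc 4 * C * (n : ℝ) ^ (-r) * (1 / (2 * (2 * N + 1)))
        ≤ 4 * C * (n : ℝ) ^ (-r) * (1 / (2 * n)) := by gcongr
      _ = _ := by rw [hpow]; field_simp; ring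
  set S := ccQuad f n - ∑ i ∈ Finset.range (N + 1),
    4 * ccDelta n (2 * i) / (1 - 4 * (i : ℝ) ^ 2) * cosCoeff f (2 * i) with hS
  have hSle : |S| ≤ (8 * C + 16 * D) * (n : ℝ) ^ (-(r + 1))
      * ∑' m : ℕ, ((m + 1 : ℕ) : ℝ) ^ (-r) := by
    have hsum : Summable fun m : ℕ => ((m + 1 : ℕ) : ℝ) ^ (-r) :=
      (summable_nat_add_iff 1).mpr (Real.summable_nat_rpow.mpr (by linarith))
    exact (hasSum_ccQuad hf hs (by omega : 0 < n)).norm_le_of_bounded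
      (hsum.hasSum.mul_left _) fun m => abs_aliasing_le hr hf hC0 hD0 hC hD hn m
  have hdelta : ∑ i ∈ Finset.range (N + 1),
      4 * ccDelta n (2 * i) / (1 - 4 * (i : ℝ) ^ 2) * cosCoeff f (2 * i)
      = ∑ i ∈ Finset.range (N + 1), q i - 2 * cosCoeff f 0
        - if 2 * N = n then q N / 2 else 0 := by
    have h := sum_ccDelta_two_mul hn q
    have h0 : q 0 / 2 = 2 * cosCoeff f 0 := by
      simp [hq]
      ring
    rw [h0] at h
    rw [← h]
    refine Finset.sum_congr rfl fun i _ => ?_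
    rw [hq]
    ring
  have hend : |if 2 * N = n then q N / 2 else 0| ≤ 2 * C * (n : ℝ) ^ (-(r + 1)) := by
    split_ifs with h
    · have h1 : 2 * (N : ℝ) = n := by exact_mod_cast h
      have h2 := hqle N h.ge
      rw [show 4 * (N : ℝ) ^ 2 - 1 = (n : ℝ) ^ 2 - 1 by rw [← h1]; ring] at h2
      have h3 : 1 / ((n : ℝ) ^ 2 - 1) ≤ 1 / n :=
        one_div_le_one_div_of_le hn0 (by nlinarith)
      have h4 : 4 * C * (n : ℝ) ^ (-r) * (1 / ((n : ℝ) ^ 2 - 1))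
          ≤ 4 * C * (n : ℝ) ^ (-r) * (1 / n) := by gcongr
      rw [hpow, abs_div, abs_of_pos (by norm_num : (0 : ℝ) < 2)]
      linarith
    · rw [abs_zero]
      positivity
  have hE : ccError f n = T + (if 2 * N = n then q N / 2 else 0) - S := by
    rw [ccError, hT, hS, hdelta]
    ring
  rw [hE]
  refine (abs_sub _ _).trans ?_
  have := abs_add_le T (if 2 * N = n then q N / 2 else 0)
  linarith

/-- If the Chebyshev coefficients of `f` decay like `k ^ (-r)` and those of `(1 - x ^ 2) f` like
`k ^ (-(r + 2))`, then the Clenshaw–Curtis error is `O(n ^ (-(r + 1)))`. -/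
lemma ccError_isBigO {f : ℝ → ℝ} {r : ℝ} (hr : 1 < r)
    (hf : Continuous fun t => f (Real.cos t)) (hfd : CosDecay r f)
    (hfd' : CosDecay (r + 2) fun x => f x * (1 - x ^ 2)) :
    (fun n : ℕ => ccError f n) =O[atTop] fun n : ℕ => (n : ℝ) ^ (-(r + 1)) := by
  obtain ⟨C, hC0, hC⟩ := hfd.exists_nonneg
  obtain ⟨D, hD0, hD⟩ := hfd'.exists_nonneg
  refine Asymptotics.IsBigO.of_bound
    (4 * C + (8 * C + 16 * D) * ∑' m : ℕ, ((m + 1 : ℕ) : ℝ) ^ (-r)) ?_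
  filter_upwards [eventually_ge_atTop 2] with n hn
  rw [Real.norm_eq_abs, Real.norm_of_nonneg (by positivity)]
  exact abs_ccError_le hr hf hC0 hD0 hC hD hn

end Quadrature

section Singularity

lemma continuous_comp_cos_of_contDiffOn {g : ℝ → ℝ}
    (hg : ContDiffOn ℝ (⊤ : ℕ∞) g (Set.Icc (-1) 1)) : Continuous fun t => g (Real.cos t) :=
  hg.continuousOn.comp_continuous Real.continuous_cos Real.cos_mem_Icc

lemma continuous_one_add_cos_rpow {β : ℝ} (hβ : 0 ≤ β) :
    Continuous fun t => (1 + Real.cos t) ^ β :=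
  (continuous_const.add Real.continuous_cos).rpow_const fun _ => Or.inr hβ

lemma continuous_singular_comp_cos {g : ℝ → ℝ} (m : ℕ) {β : ℝ} (hβ : 0 ≤ β)
    (hg : ContDiffOn ℝ (⊤ : ℕ∞) g (Set.Icc (-1) 1)) :
    Continuous fun t => (1 - Real.cos t) ^ (m + 1) * Real.log (1 - Real.cos t)
      * (1 + Real.cos t) ^ β * g (Real.cos t) :=
  ((continuous_one_sub_cos_pow_mul_log m).mul (continuous_one_add_cos_rpow hβ)).mul
    (continuous_comp_cos_of_contDiffOn hg)

lemma cosDecay_one_add_rpow_of_int_or_le {β r : ℝ} (hβ : 0 ≤ β)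
    (h : (∃ i : ℤ, β = i) ∨ r ≤ 2 * β + 1) : CosDecay r fun x => (1 + x) ^ β := by
  rcases h with ⟨i, rfl⟩ | h
  · obtain ⟨j, rfl⟩ := Int.eq_ofNat_of_zero_le (by exact_mod_cast hβ : 0 ≤ i)
    refine cosDecay_of_contDiffOn ?_ r
    simp only [Int.cast_natCast, Real.rpow_natCast]
    fun_prop
  · exact (cosDecay_one_add_rpow hβ).mono h

lemma cosDecay_singular {g : ℝ → ℝ} (m : ℕ) {β r : ℝ} (hβ : 0 ≤ β) (hr : 1 < r)
    (hm : r ≤ 2 * (m + 1 : ℝ) + 1) (h : (∃ i : ℤ, β = i) ∨ r ≤ 2 * β + 1)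
    (hg : ContDiffOn ℝ (⊤ : ℕ∞) g (Set.Icc (-1) 1)) :
    CosDecay r fun x => (1 - x) ^ (m + 1) * Real.log (1 - x) * (1 + x) ^ β * g x :=
  CosDecay.mul hr
    ((continuous_one_sub_cos_pow_mul_log m).mul (continuous_one_add_cos_rpow hβ))
    (continuous_comp_cos_of_contDiffOn hg)
    (CosDecay.mul hr (continuous_one_sub_cos_pow_mul_log m) (continuous_one_add_cos_rpow hβ)
      ((cosDecay_one_sub_pow_mul_log m).mono hm) (cosDecay_one_add_rpow_of_int_or_le hβ h))
    (cosDecay_of_contDiffOn hg r)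

lemma ccError_singular_isBigO {g : ℝ → ℝ} (m : ℕ) {β r : ℝ} (hβ : 0 ≤ β) (hr : 1 < r)
    (hm : r ≤ 2 * (m + 1 : ℝ) + 1) (h : (∃ i : ℤ, β = i) ∨ r ≤ 2 * β + 1)
    (hg : ContDiffOn ℝ (⊤ : ℕ∞) g (Set.Icc (-1) 1)) :
    (fun n : ℕ =>
        ccError (fun x => (1 - x) ^ (m + 1) * Real.log (1 - x) * (1 + x) ^ β * g x) n)
      =O[atTop] fun n : ℕ => (n : ℝ) ^ (-(r + 1)) := by
  refine ccError_isBigO hr (continuous_singular_comp_cos m hβ hg)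
    (cosDecay_singular m hβ hr hm h hg) ?_
  have h' : (∃ i : ℤ, β + 1 = i) ∨ r + 2 ≤ 2 * (β + 1) + 1 :=
    h.imp (fun ⟨i, hi⟩ => ⟨i + 1, by rw [hi]; push_cast; rfl⟩) fun h => by linarith
  refine (cosDecay_singular (m + 1) (by linarith : 0 ≤ β + 1) (by linarith : 1 < r + 2)
    (by push_cast; linarith) h' hg).congr fun x hx => ?_
  rw [Real.rpow_add_one' (by linarith [hx.1]) (by linarith)]
  ring

end Singularity

/-- For `f(x) = (1−x)^α (1+x)^β log(1−x) g(x)` with `α` a positive integer, `β ≥ 0` and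
`g` smooth on `[−1,1]`, with `s = 2α` if `β` is an integer and `s = 2min{α,β}`
otherwise, the Clenshaw–Curtis error satisfies `E_n^C[f] = O(n^{−s−2})`. -/
theorem ccError_algebraic_log_singularity (α β : ℝ)
    (hα : ∃ k : ℤ, 0 < k ∧ α = (k : ℝ)) (hβ : 0 ≤ β)
    (g : ℝ → ℝ) (hg : ContDiffOn ℝ (⊤ : ℕ∞) g (Set.Icc (-1) 1))
    (f : ℝ → ℝ)
    (hf : ∀ x, f x = (1 - x) ^ α * (1 + x) ^ β * Real.log (1 - x) * g x)
    (s : ℝ)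
    (hs1 : (∃ i : ℤ, β = (i : ℝ)) → s = 2 * α)
    (hs2 : ¬(∃ i : ℤ, β = (i : ℝ)) → s = 2 * min α β) :
    (fun n : ℕ => ccError f n) =O[atTop] fun n : ℕ => (n : ℝ) ^ (-s - 2) := by
  obtain ⟨k, hk, rfl⟩ := hα
  obtain ⟨m, rfl⟩ : ∃ m : ℕ, k = (m + 1 : ℕ) := ⟨(k - 1).toNat, by omega⟩
  have hfeq : f = fun x => (1 - x) ^ (m + 1) * Real.log (1 - x) * (1 + x) ^ β * g x := by
    funext x
    rw [hf, Int.cast_natCast, Real.rpow_natCast]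
    ring
  have hm0 : (0 : ℝ) ≤ m := Nat.cast_nonneg m
  rw [hfeq, show -s - 2 = -((s + 1) + 1) by ring]
  by_cases hi : ∃ i : ℤ, β = i
  · have hs := hs1 hi
    push_cast at hs
    exact ccError_singular_isBigO m hβ (by linarith) (by linarith) (Or.inl hi) hg
  · have hs := hs2 hi
    have hβ0 : 0 < β := hβ.lt_of_ne fun h => hi ⟨0, by simp [← h]⟩
    push_cast at hs
    have h1 : 0 < min (m + 1 : ℝ) β := lt_min (by linarith) hβ0
    have h2 := min_le_left (m + 1 : ℝ) β
    have h3 := min_le_right (m + 1 : ℝ) β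
    exact ccError_singular_isBigO m hβ (by linarith) (by linarith) (Or.inr (by linarith)) hg
end

section
/- Let f be continuous on [−1,1] with Chebyshev coefficients a_n. Suppose there exist constants μ_k and a strictly increasing sequence of positive reals (d_k)_{k≥0} with d_k → ∞ and d_0 > 1, such that either (a) for every N ≥ 1, a_n − Σ_{k=0}^{N−1} μ_k n^{−d_k} = O(n^{−d_N}) as n → ∞, or (b) for every N ≥ 1, a_n − (−1)^n Σ_{k=0}^{N−1} μ_k n^{−d_k} = O(n^{−d_N}) as n → ∞. Then there exist constants ς_{j,k} (j, k ≥ 0), independent of n, such that for every real M > 0, the Clenshaw–Curtis error satisfies E_n^C[f] − Σ_{(j,k): d_k + 2j + 1 ≤ M} ς_{j,k} n^{−(d_k + 2j + 1)} = o(n^{−M}) as n → ∞ through even values of n. (The set {(j,k) : d_k + 2j + 1 ≤ M} is finite since d_k → ∞.) -/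
open Real Filter Finset

/-- The sequence `m ↦ m⁻²`. -/
noncomputable def invSq (m : ℕ) : ℝ := ((m : ℝ) ^ 2)⁻¹

/-- `u` is a polynomial in `m⁻²` up to an error `O(m^{-2K})`. -/
def HasInvSqExpansion (K : ℕ) (u : ℕ → ℝ) : Prop :=
  ∃ p : Polynomial ℝ, (fun m => u m - p.eval (invSq m)) =O[atTop] fun m => invSq m ^ K

lemma invSq_nonneg (m : ℕ) : 0 ≤ invSq m := by unfold invSq; positivity

lemma invSq_pos {m : ℕ} (hm : m ≠ 0) : 0 < invSq m := by unfold invSq; positivity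

lemma invSq_le_one (m : ℕ) : invSq m ≤ 1 := by
  rcases Nat.eq_zero_or_pos m with rfl | hm
  · simp [invSq]
  · unfold invSq
    apply inv_le_one_of_one_le₀
    have : (1 : ℝ) ≤ m := by exact_mod_cast hm
    nlinarith

lemma tendsto_invSq : Tendsto invSq atTop (nhds 0) := by
  unfold invSq
  exact ((tendsto_pow_atTop two_ne_zero).comp tendsto_natCast_atTop_atTop).inv_tendsto_atTop

lemma isBigO_invSq_pow_of_le {J K : ℕ} (h : K ≤ J) :
    (fun m => invSq m ^ J) =O[atTop] fun m => invSq m ^ K := by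
  refine Asymptotics.IsBigO.of_norm_le fun m => ?_
  rw [Real.norm_of_nonneg (pow_nonneg (invSq_nonneg m) _)]
  exact pow_le_pow_of_le_one (invSq_nonneg m) (invSq_le_one m) h

lemma isBigO_eval_invSq (p : Polynomial ℝ) :
    (fun m => p.eval (invSq m)) =O[atTop] fun _ => (1 : ℝ) := by
  have : Tendsto (fun m => p.eval (invSq m)) atTop (nhds (p.eval 0)) :=
    (p.continuous.tendsto 0).comp tendsto_invSq
  exact this.isBigO_one ℝ

namespace HasInvSqExpansion

lemma of_sub {K : ℕ} {u v : ℕ → ℝ} (hv : HasInvSqExpansion K v)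
    (h : (fun m => u m - v m) =O[atTop] fun m => invSq m ^ K) : HasInvSqExpansion K u := by
  obtain ⟨p, hp⟩ := hv
  exact ⟨p, (h.add hp).congr_left fun m => by ring⟩

lemma eval (K : ℕ) (p : Polynomial ℝ) : HasInvSqExpansion K fun m => p.eval (invSq m) :=
  ⟨p, by simpa using Asymptotics.isBigO_zero _ _⟩

lemma of_isBigO {K : ℕ} {u : ℕ → ℝ} (h : u =O[atTop] fun m => invSq m ^ K) :
    HasInvSqExpansion K u := ⟨0, by simpa using h⟩

lemma congr' {K : ℕ} {u v : ℕ → ℝ} (hv : HasInvSqExpansion K v) (h : u =ᶠ[atTop] v) :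
    HasInvSqExpansion K u := by
  refine hv.of_sub ?_
  refine (Asymptotics.isBigO_zero (fun m => invSq m ^ K) atTop).congr' ?_ EventuallyEq.rfl
  filter_upwards [h] with m hm
  simp [hm]

lemma add {K : ℕ} {u v : ℕ → ℝ} (hu : HasInvSqExpansion K u) (hv : HasInvSqExpansion K v) :
    HasInvSqExpansion K fun m => u m + v m := by
  obtain ⟨p, hp⟩ := hu
  obtain ⟨q, hq⟩ := hv
  exact ⟨p + q, (hp.add hq).congr_left fun m => by rw [Polynomial.eval_add]; ring⟩

lemma const_mul {K : ℕ} {u : ℕ → ℝ} (hu : HasInvSqExpansion K u) (c : ℝ) :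
    HasInvSqExpansion K fun m => c * u m := by
  obtain ⟨p, hp⟩ := hu
  exact ⟨Polynomial.C c * p, (hp.const_mul_left c).congr_left fun m => by
    rw [Polynomial.eval_mul, Polynomial.eval_C]; ring⟩

lemma sub {K : ℕ} {u v : ℕ → ℝ} (hu : HasInvSqExpansion K u) (hv : HasInvSqExpansion K v) :
    HasInvSqExpansion K fun m => u m - v m := by
  refine (hu.add (hv.const_mul (-1))).congr' (Eventually.of_forall fun m => ?_)
  simp only
  ring

lemma invSq_mul {K : ℕ} {u : ℕ → ℝ} (hu : HasInvSqExpansion K u) :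
    HasInvSqExpansion (K + 1) fun m => invSq m * u m := by
  obtain ⟨p, hp⟩ := hu
  refine ⟨Polynomial.X * p, (((Asymptotics.isBigO_refl invSq atTop).mul hp).congr_left
    fun m => ?_).congr_right fun m => ?_⟩
  · rw [Polynomial.eval_mul, Polynomial.eval_X]; ring
  · ring

lemma mono {J K : ℕ} {u : ℕ → ℝ} (hu : HasInvSqExpansion J u) (h : K ≤ J) :
    HasInvSqExpansion K u := by
  obtain ⟨p, hp⟩ := hu
  exact ⟨p, hp.trans (isBigO_invSq_pow_of_le h)⟩

lemma sum {ι : Type*} {K : ℕ} (s : Finset ι) {u : ι → ℕ → ℝ}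
    (h : ∀ i ∈ s, HasInvSqExpansion K (u i)) : HasInvSqExpansion K fun m => ∑ i ∈ s, u i m := by
  classical
  induction s using Finset.induction_on with
  | empty => simpa using eval K 0
  | insert a s ha ih =>
    simp_rw [Finset.sum_insert ha]
    exact (h a (by simp)).add (ih fun i hi => h i (by simp [hi]))

lemma invSq_pow_mul {K : ℕ} {u : ℕ → ℝ} (hu : HasInvSqExpansion K u) (j : ℕ) :
    HasInvSqExpansion K fun m => invSq m ^ j * u m := by
  induction j with
  | zero => simpa using hu
  | succ j ih =>
    refine (ih.invSq_mul.mono (Nat.le_succ K)).congr' (Eventually.of_forall fun m => ?_)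
    simp only
    ring

end HasInvSqExpansion

lemma X_pow_dvd_of_eval_invSq_isBigO (K : ℕ) (q : Polynomial ℝ)
    (h : (fun m => q.eval (invSq m)) =O[atTop] fun m => invSq m ^ K) : Polynomial.X ^ K ∣ q := by
  induction K generalizing q with
  | zero => simp
  | succ K ih =>
    have h0 : q.eval 0 = 0 := by
      have h1 : Tendsto (fun m => q.eval (invSq m)) atTop (nhds (q.eval 0)) :=
        (q.continuous.tendsto 0).comp tendsto_invSq
      have h2 : Tendsto (fun m => invSq m ^ (K + 1)) atTop (nhds 0) := by
        simpa using tendsto_invSq.pow (K + 1)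
      exact tendsto_nhds_unique h1 (h.trans_tendsto h2)
    obtain ⟨r, rfl⟩ : Polynomial.X ∣ q := Polynomial.X_dvd_iff.mpr (by
      rwa [Polynomial.coeff_zero_eq_eval_zero])
    rw [pow_succ']
    refine mul_dvd_mul_left _ (ih r ?_)
    have h3 := (Asymptotics.isBigO_refl (fun m => (invSq m)⁻¹) atTop).mul h
    refine h3.congr' ?_ ?_
    · filter_upwards [eventually_ne_atTop 0] with m hm
      have := (invSq_pos hm).ne'
      simp only [Polynomial.eval_mul, Polynomial.eval_X]
      field_simp
    · filter_upwards [eventually_ne_atTop 0] with m hm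
      have := (invSq_pos hm).ne'
      field_simp
      ring

lemma isBigO_eval_sub_sum_coeff (p : Polynomial ℝ) (K : ℕ) :
    (fun m => p.eval (invSq m) - ∑ j ∈ range K, p.coeff j * invSq m ^ j)
      =O[atTop] fun m => invSq m ^ K := by
  obtain ⟨r, hr⟩ : Polynomial.X ^ K ∣ p - ∑ j ∈ range K, Polynomial.monomial j (p.coeff j) := by
    rw [Polynomial.X_pow_dvd_iff]
    intro i hi
    simp [Polynomial.coeff_monomial, hi]
  have h := (Asymptotics.isBigO_refl (fun m => invSq m ^ K) atTop).mul (isBigO_eval_invSq r)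
  refine (h.congr_left fun m => ?_).congr_right fun m => mul_one _
  have := congrArg (Polynomial.eval (invSq m)) hr
  simp only [Polynomial.eval_sub, Polynomial.eval_finsetSum, Polynomial.eval_monomial,
    Polynomial.eval_mul, Polynomial.eval_pow, Polynomial.eval_X] at this
  exact this.symm

/-- Expansions of every order have compatible coefficients. -/
lemma exists_coeff_of_hasInvSqExpansion {u : ℕ → ℝ} (h : ∀ K, HasInvSqExpansion K u) :
    ∃ c : ℕ → ℝ, ∀ K, (fun m => u m - ∑ j ∈ range K, c j * invSq m ^ j)
      =O[atTop] fun m => invSq m ^ K := by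
  choose p hp using h
  refine ⟨fun j => (p (j + 1)).coeff j, fun K => ?_⟩
  have key : ∀ j < K, (p K).coeff j = (p (j + 1)).coeff j := by
    intro j hj
    have h1 := (hp (j + 1)).sub ((hp K).trans (isBigO_invSq_pow_of_le hj))
    have h2 := X_pow_dvd_of_eval_invSq_isBigO (j + 1) (p K - p (j + 1))
      (h1.congr_left fun m => by rw [Polynomial.eval_sub]; ring)
    have h3 := Polynomial.X_pow_dvd_iff.mp h2 j (Nat.lt_succ_self j)
    rwa [Polynomial.coeff_sub, sub_eq_zero] at h3
  refine ((hp K).add (isBigO_eval_sub_sum_coeff (p K) K)).congr_left fun m => ?_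
  rw [Finset.sum_congr rfl fun j hj => by rw [key j (Finset.mem_range.mp hj)]]
  ring

/-- The composite trapezoidal sum of `g` over the nodes `0, 1, …, m`. -/
noncomputable def trapSum (g : ℕ → ℝ) (m : ℕ) : ℝ := ∑ q ∈ range m, (g q + g (q + 1)) / 2

lemma trapSum_congr {g h : ℕ → ℝ} {m : ℕ} (H : ∀ q ≤ m, g q = h q) :
    trapSum g m = trapSum h m :=
  Finset.sum_congr rfl fun q hq => by
    have := Finset.mem_range.mp hq
    rw [H q (by omega), H (q + 1) (by omega)]

lemma trapSum_add (g h : ℕ → ℝ) (m : ℕ) :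
    trapSum (fun q => g q + h q) m = trapSum g m + trapSum h m := by
  simp only [trapSum, ← Finset.sum_add_distrib]
  exact Finset.sum_congr rfl fun q _ => by ring

lemma trapSum_sub (g h : ℕ → ℝ) (m : ℕ) :
    trapSum (fun q => g q - h q) m = trapSum g m - trapSum h m := by
  simp only [trapSum, ← Finset.sum_sub_distrib]
  exact Finset.sum_congr rfl fun q _ => by ring

lemma trapSum_const_mul (c : ℝ) (g : ℕ → ℝ) (m : ℕ) :
    trapSum (fun q => c * g q) m = c * trapSum g m := by
  simp only [trapSum, Finset.mul_sum]
  exact Finset.sum_congr rfl fun q _ => by ring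

lemma abs_trapSum_le {g : ℕ → ℝ} {m : ℕ} {B : ℝ} (h : ∀ q ≤ m, |g q| ≤ B) :
    |trapSum g m| ≤ m * B := by
  calc |trapSum g m| ≤ ∑ q ∈ range m, |(g q + g (q + 1)) / 2| := Finset.abs_sum_le_sum_abs _ _
    _ ≤ ∑ q ∈ range m, B := by
        refine Finset.sum_le_sum fun q hq => ?_
        have hq' := Finset.mem_range.mp hq
        have h1 := abs_le.mp (h q (by omega))
        have h2 := abs_le.mp (h (q + 1) (by omega))
        rw [abs_le]
        constructor <;> linarith [h1.1, h1.2, h2.1, h2.2]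
    _ = m * B := by simp

lemma HasSum.trapSum {F : ℕ → ℕ → ℝ} {G : ℕ → ℝ} {m : ℕ}
    (h : ∀ q ≤ m, HasSum (fun i => F i q) (G q)) :
    HasSum (fun i => trapSum (F i) m) (trapSum G m) := by
  refine hasSum_sum fun q hq => ?_
  have hq' := Finset.mem_range.mp hq
  exact ((h q (by omega)).add (h (q + 1) (by omega))).div_const 2

lemma abs_bernoulli_le_factorial (n : ℕ) : |bernoulli n| ≤ (n.factorial : ℚ) := by
  induction n using Nat.strong_induction_on with
  | _ n ih =>
    rcases Nat.eq_zero_or_pos n with rfl | hn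
    · simp
    have h := sum_bernoulli (n + 1)
    rw [Finset.sum_range_succ, if_neg (by omega)] at h
    have hch : (n + 1).choose n = n + 1 := by simp
    rw [hch] at h
    have hgeo : ∀ N : ℕ, ∑ k ∈ range N, (1 / 2 : ℚ) ^ (N - k) = 1 - (1 / 2) ^ N := by
      intro N
      induction N with
      | zero => simp
      | succ N ihN =>
        rw [Finset.sum_range_succ, Finset.sum_congr rfl fun k hk => by
          rw [show N + 1 - k = (N - k) + 1 by have := Finset.mem_range.mp hk; omega, pow_succ],
          ← Finset.sum_mul, ihN]
        simp
        ring
    have hbd : |∑ k ∈ range n, ((n + 1).choose k : ℚ) * bernoulli k|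
        ≤ ∑ k ∈ range n, ((n + 1).factorial : ℚ) * (1 / 2) ^ (n - k) := by
      refine (Finset.abs_sum_le_sum_abs _ _).trans (Finset.sum_le_sum fun k hk => ?_)
      have hk' := Finset.mem_range.mp hk
      rw [abs_mul, Nat.abs_cast]
      calc ((n + 1).choose k : ℚ) * |bernoulli k| ≤ (n + 1).choose k * k.factorial := by
            gcongr; exact ih k hk'
        _ = (n + 1).factorial / (n + 1 - k).factorial := by
            rw [eq_div_iff (by positivity)]
            exact_mod_cast Nat.choose_mul_factorial_mul_factorial (by omega : k ≤ n + 1)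
        _ ≤ (n + 1).factorial / 2 ^ (n - k) := by
            gcongr
            have := Nat.factorial_mul_pow_le_factorial (m := 1) (n := n - k)
            rw [Nat.factorial_one, one_mul, show 1 + (n - k) = n + 1 - k by omega] at this
            exact_mod_cast this
        _ = _ := by rw [one_div, inv_pow, div_eq_mul_inv]
    rw [← Finset.mul_sum, hgeo] at hbd
    have h1 : ((n : ℚ) + 1) * bernoulli n
        = -∑ k ∈ range n, ((n + 1).choose k : ℚ) * bernoulli k := by
      push_cast at h; linarith
    have h2 : ((n : ℚ) + 1) * |bernoulli n| ≤ ((n : ℚ) + 1) * n.factorial := by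
      calc ((n : ℚ) + 1) * |bernoulli n| = |((n : ℚ) + 1) * bernoulli n| := by
            rw [abs_mul, abs_of_nonneg (by positivity : (0 : ℚ) ≤ (n : ℚ) + 1)]
        _ ≤ ((n + 1).factorial : ℚ) * (1 - (1 / 2) ^ n) := by rw [h1, abs_neg]; exact hbd
        _ ≤ ((n + 1).factorial : ℚ) * 1 := by
            gcongr
            have : (0 : ℚ) ≤ (1 / 2) ^ n := by positivity
            linarith
        _ = _ := by rw [Nat.factorial_succ]; push_cast; ring
    exact le_of_mul_le_mul_left h2 (by positivity)

/-- The coefficient of `m^{-2j}` in `m⁻¹` times the trapezoidal sum of `(q / m)^{2i}`. -/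
noncomputable def faulhaberCoeff (i j : ℕ) : ℝ :=
  (bernoulli (2 * j) : ℝ) * ((2 * i + 1).choose (2 * j) : ℝ) / (2 * i + 1)

lemma abs_faulhaberCoeff_le (i j : ℕ) : |faulhaberCoeff i j| ≤ ((2 * (i : ℝ) + 1) ^ 2) ^ j := by
  have h1 : |(bernoulli (2 * j) : ℝ)| ≤ ((2 * j).factorial : ℝ) := by
    exact_mod_cast abs_bernoulli_le_factorial (2 * j)
  have h2 : ((2 * j).factorial : ℝ) * ((2 * i + 1).choose (2 * j) : ℝ)
      ≤ (2 * (i : ℝ) + 1) ^ (2 * j) := by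
    have := Nat.descFactorial_le_pow (2 * i + 1) (2 * j)
    rw [Nat.descFactorial_eq_factorial_mul_choose] at this
    exact_mod_cast this
  have hi : (1 : ℝ) ≤ 2 * i + 1 := by
    have : (0 : ℝ) ≤ i := Nat.cast_nonneg i
    linarith
  unfold faulhaberCoeff
  rw [abs_div, abs_mul, Nat.abs_cast, abs_of_pos (by linarith : (0 : ℝ) < 2 * i + 1), ← pow_mul]
  calc |(bernoulli (2 * j) : ℝ)| * ((2 * i + 1).choose (2 * j) : ℝ) / (2 * i + 1)
      ≤ |(bernoulli (2 * j) : ℝ)| * ((2 * i + 1).choose (2 * j) : ℝ) :=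
        div_le_self (by positivity) hi
    _ ≤ ((2 * j).factorial : ℝ) * ((2 * i + 1).choose (2 * j) : ℝ) := by gcongr
    _ ≤ _ := h2

lemma sum_range_eq_sum_even_add {F : ℕ → ℝ} (h : ∀ k, 1 ≤ k → F (2 * k + 1) = 0) (i : ℕ) :
    ∑ k ∈ range (2 * (i + 1) + 1), F k = ∑ j ∈ range (i + 2), F (2 * j) + F 1 := by
  induction i with
  | zero => simp [Finset.sum_range_succ]; ring
  | succ i ih =>
    rw [show 2 * (i + 1 + 1) + 1 = 2 * (i + 1) + 1 + 1 + 1 by ring, Finset.sum_range_succ,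
      Finset.sum_range_succ, ih, h (i + 1) (by omega), Finset.sum_range_succ _ (i + 2)]
    rw [show 2 * (i + 1) + 1 + 1 = 2 * (i + 2) by ring]
    ring

lemma trapSum_eq (g : ℕ → ℝ) (m : ℕ) :
    trapSum g m = ∑ q ∈ range m, g q + (g m - g 0) / 2 := by
  unfold trapSum
  induction m with
  | zero => simp
  | succ m ih => rw [Finset.sum_range_succ, ih, Finset.sum_range_succ]; ring

lemma trapSum_pow {m : ℕ} (hm : m ≠ 0) (i : ℕ) :
    trapSum (fun q => ((q : ℝ) / m) ^ (2 * i)) m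
      = m * ∑ j ∈ range (i + 1), faulhaberCoeff i j * invSq m ^ j := by
  have hm' : (m : ℝ) ≠ 0 := Nat.cast_ne_zero.mpr hm
  rcases i with _ | i
  · simp [trapSum, faulhaberCoeff]
  have hF := sum_range_pow m (2 * (i + 1))
  have hF' : ∑ q ∈ range m, (q : ℝ) ^ (2 * (i + 1)) = ∑ k ∈ range (2 * (i + 1) + 1),
      (bernoulli k : ℝ) * ((2 * (i + 1) + 1).choose k : ℝ) * (m : ℝ) ^ (2 * (i + 1) + 1 - k)
        / ((2 * (i + 1) : ℕ) + 1) := by exact_mod_cast congrArg (fun x : ℚ => (x : ℝ)) hF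
  rw [sum_range_eq_sum_even_add] at hF'
  · simp_rw [div_pow, div_eq_inv_mul, trapSum_const_mul]
    rw [trapSum_eq, hF', Nat.cast_zero, zero_pow (by omega), bernoulli_one, Nat.choose_one_right,
      inv_mul_eq_iff_eq_mul₀ (by positivity), mul_left_comm, ← mul_assoc, ← pow_succ', add_assoc]
    have e1 : ((-1 / 2 : ℚ) : ℝ) * ((2 * (i + 1) + 1 : ℕ) : ℝ) * (m : ℝ) ^ (2 * (i + 1) + 1 - 1)
        / ((2 * (i + 1) : ℕ) + 1) + ((m : ℝ) ^ (2 * (i + 1)) - 0) / 2 = 0 := by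
      rw [show 2 * (i + 1) + 1 - 1 = 2 * (i + 1) by omega]
      have : ((2 * (i + 1) : ℕ) : ℝ) + 1 ≠ 0 := by positivity
      push_cast at this ⊢
      field_simp
      ring
    rw [e1, add_zero, Finset.mul_sum]
    refine Finset.sum_congr rfl fun j hj => ?_
    have hj' := Finset.mem_range.mp hj
    obtain ⟨l, hl⟩ := Nat.exists_eq_add_of_le (by omega : 2 * j ≤ 2 * (i + 1) + 1)
    unfold faulhaberCoeff invSq
    rw [show 2 * (i + 1) + 1 - 2 * j = l by omega, hl, inv_pow, ← pow_mul, pow_add]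
    have : (2 * ((i + 1 : ℕ) : ℝ) + 1) ≠ 0 := by positivity
    push_cast at this ⊢
    field_simp
  · intro k hk
    rw [bernoulli_eq_zero_of_odd ⟨k, rfl⟩ (by omega)]
    simp

lemma abs_sum_faulhaberCoeff_le_one {m : ℕ} (hm : m ≠ 0) (i : ℕ) :
    |∑ j ∈ range (i + 1), faulhaberCoeff i j * invSq m ^ j| ≤ 1 := by
  have hm' : (0 : ℝ) < m := Nat.cast_pos.mpr (Nat.pos_of_ne_zero hm)
  have h : |trapSum (fun q => ((q : ℝ) / m) ^ (2 * i)) m| ≤ m * 1 := by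
    refine abs_trapSum_le fun q hq => ?_
    have h1 : (q : ℝ) / m ≤ 1 := (div_le_one hm').mpr (by exact_mod_cast hq)
    rw [abs_of_nonneg (by positivity)]
    exact pow_le_one₀ (by positivity) h1
  rw [trapSum_pow hm, abs_mul, abs_of_pos hm'] at h
  exact le_of_mul_le_mul_left h hm'

lemma abs_faulhaberCoeff_tail_le {m : ℕ} (hm : m ≠ 0) (i K : ℕ) :
    |∑ j ∈ range (i + 1), faulhaberCoeff i j * invSq m ^ j
        - ∑ j ∈ range K, faulhaberCoeff i j * invSq m ^ j|
      ≤ ((K + 2) * 4 ^ K) * (2 * (i : ℝ) + 1) ^ (2 * K) * invSq m ^ K := by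
  set y : ℝ := 4 * (2 * (i : ℝ) + 1) ^ 2 * invSq m with hy
  have hy0 : 0 ≤ y := by have := invSq_nonneg m; positivity
  have hterm : ∀ j, |faulhaberCoeff i j * invSq m ^ j| ≤ (1 / 4) ^ j * y ^ j := by
    intro j
    rw [abs_mul, abs_of_nonneg (pow_nonneg (invSq_nonneg m) j), ← mul_pow]
    calc |faulhaberCoeff i j| * invSq m ^ j ≤ ((2 * (i : ℝ) + 1) ^ 2) ^ j * invSq m ^ j := by
          have := pow_nonneg (invSq_nonneg m) j
          gcongr
          exact abs_faulhaberCoeff_le i j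
      _ = _ := by rw [← mul_pow, hy]; ring
  have hrhs : ((K + 2) * 4 ^ K) * (2 * (i : ℝ) + 1) ^ (2 * K) * invSq m ^ K = (K + 2) * y ^ K := by
    rw [hy, mul_pow, mul_pow, pow_mul]; ring
  rw [hrhs]
  have hyK := pow_nonneg hy0 K
  rcases le_or_gt 1 y with h1 | h1
  · have hs : |∑ j ∈ range K, faulhaberCoeff i j * invSq m ^ j| ≤ K * y ^ K := by
      calc _ ≤ ∑ j ∈ range K, |faulhaberCoeff i j * invSq m ^ j| := Finset.abs_sum_le_sum_abs _ _
        _ ≤ ∑ j ∈ range K, y ^ K := by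
            refine Finset.sum_le_sum fun j hj => (hterm j).trans ?_
            calc (1 / 4 : ℝ) ^ j * y ^ j ≤ 1 * y ^ K :=
                  mul_le_mul (pow_le_one₀ (by norm_num) (by norm_num))
                    (pow_le_pow_right₀ h1 (Finset.mem_range.mp hj).le) (by positivity) zero_le_one
              _ = y ^ K := one_mul _
        _ = K * y ^ K := by simp
    have ht := abs_sum_faulhaberCoeff_le_one hm i
    have := one_le_pow₀ h1 (n := K)
    calc _ ≤ _ := abs_sub _ _
      _ ≤ 1 + K * y ^ K := add_le_add ht hs
      _ ≤ _ := by linarith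
  · have hext : ∑ j ∈ range (i + 1), faulhaberCoeff i j * invSq m ^ j
        = ∑ j ∈ range (K + (i + 1)), faulhaberCoeff i j * invSq m ^ j := by
      refine Finset.sum_subset (by intro j; simp; omega) fun j _ hj => ?_
      have : i + 1 ≤ j := by simpa using hj
      simp [faulhaberCoeff, Nat.choose_eq_zero_of_lt (show 2 * i + 1 < 2 * j by omega)]
    rw [hext, Finset.sum_range_add, add_sub_cancel_left]
    have hg : ∑ j ∈ range (i + 1), (1 / 4 : ℝ) ^ j ≤ 2 := by
      calc _ ≤ ∑' j, (1 / 4 : ℝ) ^ j := Summable.sum_le_tsum _ (fun _ _ => by positivity)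
            (summable_geometric_of_lt_one (by norm_num) (by norm_num))
        _ = (1 - 1 / 4)⁻¹ := tsum_geometric_of_lt_one (by norm_num) (by norm_num)
        _ ≤ 2 := by norm_num
    calc _ ≤ ∑ j ∈ range (i + 1), |faulhaberCoeff i (K + j) * invSq m ^ (K + j)| :=
          Finset.abs_sum_le_sum_abs _ _
      _ ≤ ∑ j ∈ range (i + 1), y ^ K * (1 / 4 : ℝ) ^ j := by
          refine Finset.sum_le_sum fun j _ => (hterm _).trans ?_
          rw [pow_add, pow_add]
          have h3 : y ^ j ≤ 1 := pow_le_one₀ hy0 h1.le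
          have h4 : (1 / 4 : ℝ) ^ K ≤ 1 := pow_le_one₀ (by norm_num) (by norm_num)
          calc (1 / 4 : ℝ) ^ K * (1 / 4) ^ j * (y ^ K * y ^ j)
              ≤ 1 * (1 / 4) ^ j * (y ^ K * 1) := by gcongr
            _ = _ := by ring
      _ = y ^ K * ∑ j ∈ range (i + 1), (1 / 4 : ℝ) ^ j := by rw [Finset.mul_sum]
      _ ≤ y ^ K * 2 := by gcongr
      _ ≤ _ := by nlinarith [(Nat.cast_nonneg K : (0 : ℝ) ≤ K)]

/-- A sequence decaying faster than any power of its index. -/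
def RapidDecay (C : ℕ → ℝ) : Prop := ∀ N : ℕ, Summable fun i : ℕ => |C i| * (2 * (i : ℝ) + 1) ^ N

namespace RapidDecay

lemma summable_mul {C b : ℕ → ℝ} (hC : RapidDecay C) {B : ℝ} {N : ℕ}
    (hb : ∀ i : ℕ, |b i| ≤ B * (2 * (i : ℝ) + 1) ^ N) : Summable fun i => C i * b i := by
  refine Summable.of_norm_bounded ((hC N).mul_left B) fun i => ?_
  rw [Real.norm_eq_abs, abs_mul]
  calc |C i| * |b i| ≤ |C i| * (B * (2 * (i : ℝ) + 1) ^ N) := by gcongr; exact hb i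
    _ = _ := by ring

lemma abs_tsum_mul_le {C b : ℕ → ℝ} (hC : RapidDecay C) {B : ℝ} {N : ℕ}
    (hb : ∀ i : ℕ, |b i| ≤ B * (2 * (i : ℝ) + 1) ^ N) :
    |∑' i, C i * b i| ≤ B * ∑' i, |C i| * (2 * (i : ℝ) + 1) ^ N := by
  rw [← tsum_mul_left, ← Real.norm_eq_abs (∑' i, C i * b i)]
  refine tsum_of_norm_bounded (((hC N).mul_left B).hasSum) fun i => ?_
  rw [Real.norm_eq_abs, abs_mul]
  calc |C i| * |b i| ≤ |C i| * (B * (2 * (i : ℝ) + 1) ^ N) := by gcongr; exact hb i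
    _ = _ := by ring

lemma shift {C : ℕ → ℝ} (hC : RapidDecay C) : RapidDecay fun i => C (i + 1) := by
  intro N
  refine Summable.of_nonneg_of_le (fun i => by positivity) (fun i => ?_)
    ((summable_nat_add_iff 1).mpr (hC N))
  gcongr
  simp

end RapidDecay

lemma hasInvSqExpansion_tsum_faulhaber {C : ℕ → ℝ} (hC : RapidDecay C) (K : ℕ) :
    HasInvSqExpansion K fun m =>
      ∑' i, C i * ∑ j ∈ range (i + 1), faulhaberCoeff i j * invSq m ^ j := by
  have hbd : ∀ j i, |faulhaberCoeff i j| ≤ 1 * (2 * (i : ℝ) + 1) ^ (2 * j) := fun j i => by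
    rw [one_mul, pow_mul]; exact abs_faulhaberCoeff_le i j
  refine (HasInvSqExpansion.eval K (∑ j ∈ range K,
    Polynomial.monomial j (∑' i, C i * faulhaberCoeff i j))).of_sub ?_
  refine Asymptotics.IsBigO.of_bound
    (((K + 2) * 4 ^ K) * ∑' i, |C i| * (2 * (i : ℝ) + 1) ^ (2 * K)) ?_
  filter_upwards [eventually_ne_atTop 0] with m hm
  have h1 : Summable fun i => C i * ∑ j ∈ range (i + 1), faulhaberCoeff i j * invSq m ^ j :=
    hC.summable_mul (B := 1) (N := 0) fun i => by
      simpa using abs_sum_faulhaberCoeff_le_one hm i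
  have h2 : HasSum (fun i => C i * ∑ j ∈ range K, faulhaberCoeff i j * invSq m ^ j)
      (∑ j ∈ range K, (∑' i, C i * faulhaberCoeff i j) * invSq m ^ j) := by
    simp_rw [Finset.mul_sum, ← mul_assoc]
    exact hasSum_sum fun j _ => ((hC.summable_mul (hbd j)).hasSum).mul_right _
  have h3 := (h1.hasSum.sub h2).tsum_eq
  simp_rw [← mul_sub] at h3
  rw [Polynomial.eval_finsetSum]
  simp_rw [Polynomial.eval_monomial]
  rw [← h3, Real.norm_eq_abs, Real.norm_of_nonneg (pow_nonneg (invSq_nonneg m) K)]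
  refine (hC.abs_tsum_mul_le (B := ((K + 2) * 4 ^ K) * invSq m ^ K) (N := 2 * K) fun i => ?_).trans
    (le_of_eq (by ring))
  exact (abs_faulhaberCoeff_tail_le hm i K).trans (le_of_eq (by ring))

/-- `∫_{-1}^1 T_{2q}(x) dx`, with `T` the Chebyshev polynomials. -/
noncomputable def chebMoment (q : ℕ) : ℝ := 2 / (1 - 4 * (q : ℝ) ^ 2)

lemma one_sub_four_mul_sq_ne_zero (q : ℕ) : (1 : ℝ) - 4 * (q : ℝ) ^ 2 ≠ 0 := by
  have h : (1 : ℤ) - 4 * (q : ℤ) ^ 2 ≠ 0 := by omega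
  exact_mod_cast h

lemma abs_chebMoment_le (q : ℕ) : |chebMoment q| ≤ 2 := by
  have h : (1 : ℤ) ≤ |1 - 4 * (q : ℤ) ^ 2| := Int.one_le_abs (by omega)
  have h' : (1 : ℝ) ≤ |1 - 4 * (q : ℝ) ^ 2| := by exact_mod_cast h
  unfold chebMoment
  rw [abs_div, abs_two]
  exact div_le_self zero_le_two h'

lemma four_mul_sq_mul_chebMoment (q : ℕ) :
    4 * (q : ℝ) ^ 2 * chebMoment q = chebMoment q - 2 := by
  have := one_sub_four_mul_sq_ne_zero q
  unfold chebMoment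
  field_simp
  ring

lemma trapSum_chebMoment (m : ℕ) :
    trapSum chebMoment m = 2 * m / (4 * (m : ℝ) ^ 2 - 1) := by
  unfold trapSum
  induction m with
  | zero => simp
  | succ m ih =>
    rw [Finset.sum_range_succ, ih]
    unfold chebMoment
    have h1 := one_sub_four_mul_sq_ne_zero m
    have h2 := one_sub_four_mul_sq_ne_zero (m + 1)
    have h3 : 4 * (m : ℝ) ^ 2 - 1 ≠ 0 := fun h => h1 (by linarith)
    have h4 : 4 * ((m + 1 : ℕ) : ℝ) ^ 2 - 1 ≠ 0 := fun h => h2 (by linarith)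
    rw [div_add' _ _ _ h3, div_eq_div_iff h3 h4]
    have e1 : 2 / (1 - 4 * (m : ℝ) ^ 2) * (4 * (m : ℝ) ^ 2 - 1) = -2 := by
      field_simp; ring
    have e2 : 2 / (1 - 4 * ((m + 1 : ℕ) : ℝ) ^ 2) * (4 * ((m + 1 : ℕ) : ℝ) ^ 2 - 1) = -2 := by
      field_simp; ring
    have : (2 * (m : ℝ) + (2 / (1 - 4 * (m : ℝ) ^ 2) + 2 / (1 - 4 * ((m + 1 : ℕ) : ℝ) ^ 2)) / 2
        * (4 * (m : ℝ) ^ 2 - 1)) * (4 * ((m + 1 : ℕ) : ℝ) ^ 2 - 1)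
        = 2 * m * (4 * ((m + 1 : ℕ) : ℝ) ^ 2 - 1)
        + (2 / (1 - 4 * (m : ℝ) ^ 2) * (4 * (m : ℝ) ^ 2 - 1)) * (4 * ((m + 1 : ℕ) : ℝ) ^ 2 - 1) / 2
        + (2 / (1 - 4 * ((m + 1 : ℕ) : ℝ) ^ 2) * (4 * ((m + 1 : ℕ) : ℝ) ^ 2 - 1))
          * (4 * (m : ℝ) ^ 2 - 1) / 2 := by ring
    rw [this, e1, e2]
    push_cast
    ring

lemma hasInvSqExpansion_inv_four_sub (K : ℕ) :
    HasInvSqExpansion K fun m => (4 - invSq m)⁻¹ := by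
  have hbase : HasInvSqExpansion 0 fun m => (4 - invSq m)⁻¹ := by
    refine HasInvSqExpansion.of_isBigO (Asymptotics.IsBigO.of_bound 1
      (Eventually.of_forall fun m => ?_))
    have := invSq_le_one m
    rw [Real.norm_of_nonneg (inv_nonneg.mpr (by linarith))]
    simpa using inv_le_one_of_one_le₀ (by linarith : 1 ≤ 4 - invSq m)
  induction K with
  | zero => exact hbase
  | succ K ih =>
    refine ((HasInvSqExpansion.eval (K + 1) (Polynomial.C (1 / 4))).add
      (ih.invSq_mul.const_mul (1 / 4))).congr' (Eventually.of_forall fun m => ?_)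
    have h : 4 - invSq m ≠ 0 := by have := invSq_le_one m; linarith
    simp only [Polynomial.eval_C]
    field_simp
    ring

lemma abs_chebMoment_mul_pow_le {m q : ℕ} (hm : m ≠ 0) (hq : q ≤ m) (i : ℕ) :
    |chebMoment q * ((q : ℝ) / m) ^ (2 * i)| ≤ 2 := by
  have hm' : (0 : ℝ) < m := Nat.cast_pos.mpr (Nat.pos_of_ne_zero hm)
  have h1 : (q : ℝ) / m ≤ 1 := (div_le_one hm').mpr (by exact_mod_cast hq)
  rw [abs_mul, abs_of_nonneg (by positivity : 0 ≤ ((q : ℝ) / m) ^ (2 * i))]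
  calc |chebMoment q| * ((q : ℝ) / m) ^ (2 * i) ≤ 2 * 1 :=
        mul_le_mul (abs_chebMoment_le q) (pow_le_one₀ (by positivity) h1) (by positivity) zero_le_two
    _ = 2 := mul_one 2

lemma trapSum_chebMoment_mul_pow_succ {m : ℕ} (hm : m ≠ 0) (i : ℕ) :
    m * trapSum (fun q => chebMoment q * ((q : ℝ) / m) ^ (2 * (i + 1))) m
      = invSq m * (1 / 4 * (m * trapSum (fun q => chebMoment q * ((q : ℝ) / m) ^ (2 * i)) m))
        - 1 / 2 * ∑ j ∈ range (i + 1), faulhaberCoeff i j * invSq m ^ j := by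
  have hm' : (m : ℝ) ≠ 0 := Nat.cast_ne_zero.mpr hm
  have h : ∀ q ≤ m, chebMoment q * ((q : ℝ) / m) ^ (2 * (i + 1))
      = invSq m / 4 * (chebMoment q * ((q : ℝ) / m) ^ (2 * i))
        - invSq m / 2 * ((q : ℝ) / m) ^ (2 * i) := by
    intro q _
    have := four_mul_sq_mul_chebMoment q
    rw [show 2 * (i + 1) = 2 + 2 * i by ring, pow_add, div_pow (q : ℝ) _ 2, invSq]
    have e : chebMoment q * ((q : ℝ) ^ 2 / (m : ℝ) ^ 2)
        = ((m : ℝ) ^ 2)⁻¹ / 4 * (4 * (q : ℝ) ^ 2 * chebMoment q) := by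
      field_simp
    rw [← mul_assoc, e, this]
    ring
  rw [trapSum_congr h, trapSum_sub, trapSum_const_mul, trapSum_const_mul, trapSum_pow hm]
  have : (m : ℝ) * (invSq m * m) = 1 := by unfold invSq; field_simp
  linear_combination (-(1 / 2) * ∑ j ∈ range (i + 1), faulhaberCoeff i j * invSq m ^ j) * this

lemma hasInvSqExpansion_tsum_chebMoment {C : ℕ → ℝ} (hC : RapidDecay C) (K : ℕ) :
    HasInvSqExpansion K fun m =>
      ∑' i, C i * (m * trapSum (fun q => chebMoment q * ((q : ℝ) / m) ^ (2 * i)) m) := by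
  have hbd : ∀ {m : ℕ}, m ≠ 0 → ∀ i : ℕ,
      |m * trapSum (fun q => chebMoment q * ((q : ℝ) / m) ^ (2 * i)) m|
        ≤ (m * (m * 2)) * (2 * (i : ℝ) + 1) ^ 0 := by
    intro m hm i
    rw [pow_zero, mul_one, abs_mul, Nat.abs_cast]
    gcongr
    exact abs_trapSum_le fun q hq => abs_chebMoment_mul_pow_le hm hq i
  have hrec : ∀ {D : ℕ → ℝ}, RapidDecay D → ∀ᶠ m : ℕ in atTop,
      ∑' i, D i * (m * trapSum (fun q => chebMoment q * ((q : ℝ) / m) ^ (2 * i)) m)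
        = (2 * D 0 * (4 - invSq m)⁻¹ - 1 / 2 * ∑' i, D (i + 1)
            * ∑ j ∈ range (i + 1), faulhaberCoeff i j * invSq m ^ j)
          + invSq m * (1 / 4 * ∑' i, D (i + 1)
            * (m * trapSum (fun q => chebMoment q * ((q : ℝ) / m) ^ (2 * i)) m)) := by
    intro D hD
    filter_upwards [eventually_ne_atTop 0] with m hm
    have hm' : (m : ℝ) ≠ 0 := Nat.cast_ne_zero.mpr hm
    have s1 := (hD.shift.summable_mul (hbd hm)).hasSum
    have s2 : Summable fun i => D (i + 1)
        * ∑ j ∈ range (i + 1), faulhaberCoeff i j * invSq m ^ j :=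
      hD.shift.summable_mul (B := 1) (N := 0) fun i => by
        simpa using abs_sum_faulhaberCoeff_le_one hm i
    rw [(hD.summable_mul (hbd hm)).tsum_eq_zero_add]
    have h0 : (m : ℝ) * trapSum (fun q => chebMoment q * ((q : ℝ) / m) ^ (2 * 0)) m
        = 2 * (4 - invSq m)⁻¹ := by
      simp only [mul_zero, pow_zero, mul_one]
      have h1 := one_sub_four_mul_sq_ne_zero m
      have h3 : 4 * (m : ℝ) ^ 2 - 1 ≠ 0 := fun h => h1 (by linarith)
      rw [trapSum_chebMoment, invSq, show (4 : ℝ) - ((m : ℝ) ^ 2)⁻¹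
        = (4 * (m : ℝ) ^ 2 - 1) / (m : ℝ) ^ 2 by field_simp]
      field_simp
    have h2 := (((s1.mul_left (1 / 4)).mul_left (invSq m)).sub
      (s2.hasSum.mul_left (1 / 2))).tsum_eq
    rw [h0, tsum_congr fun i => show _ = invSq m * (1 / 4 * (D (i + 1)
      * (m * trapSum (fun q => chebMoment q * ((q : ℝ) / m) ^ (2 * i)) m)))
      - 1 / 2 * (D (i + 1) * ∑ j ∈ range (i + 1), faulhaberCoeff i j * invSq m ^ j) by
        rw [trapSum_chebMoment_mul_pow_succ hm]; ring, h2]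
    ring
  have hmain : ∀ {D : ℕ → ℝ}, RapidDecay D → ∀ K, HasInvSqExpansion K fun m =>
      2 * D 0 * (4 - invSq m)⁻¹ - 1 / 2 * ∑' i, D (i + 1)
        * ∑ j ∈ range (i + 1), faulhaberCoeff i j * invSq m ^ j := fun hD K =>
    ((hasInvSqExpansion_inv_four_sub K).const_mul _).sub
      ((hasInvSqExpansion_tsum_faulhaber hD.shift K).const_mul _)
  induction K generalizing C with
  | zero =>
    refine ((hmain hC 0).add (HasInvSqExpansion.of_isBigO
      (Asymptotics.IsBigO.of_bound (1 / 2 * ∑' i, |C (i + 1)|) ?_))).congr' (hrec hC)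
    filter_upwards [eventually_ne_atTop 0] with m hm
    have hm' : (m : ℝ) ≠ 0 := Nat.cast_ne_zero.mpr hm
    have h1 := hC.shift.abs_tsum_mul_le (hbd hm)
    simp only [pow_zero, mul_one, one_mem, CStarRing.norm_of_mem_unitary] at h1 ⊢
    rw [Real.norm_eq_abs, abs_mul, abs_mul, abs_of_nonneg (invSq_nonneg m),
      abs_of_pos (by norm_num : (0 : ℝ) < 1 / 4)]
    calc _ ≤ invSq m * (1 / 4 * (m * (m * 2) * ∑' i, |C (i + 1)|)) := by
          have := invSq_nonneg m
          gcongr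
      _ = _ := by unfold invSq; field_simp; ring
  | succ K ih =>
    exact ((hmain hC (K + 1)).add ((ih hC.shift).const_mul (1 / 4)).invSq_mul).congr' (hrec hC)

/-- The sum of `b` over all positive indices congruent to `± q` modulo `2m`, apart from `q`. -/
noncomputable def aliasSum (b : ℕ → ℝ) (m q : ℕ) : ℝ :=
  ∑' l : ℕ, (b (2 * (l + 1) * m - q) + b (2 * (l + 1) * m + q))

lemma cast_alias_sub {m q : ℕ} (hq : q ≤ m) (l : ℕ) :
    ((2 * (l + 1) * m - q : ℕ) : ℝ) = 2 * (l + 1) * m - q := by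
  rw [Nat.cast_sub (by nlinarith)]
  push_cast
  ring

lemma summable_alias {b : ℕ → ℝ} (hb : Summable b) {m q : ℕ} (hm : m ≠ 0) (hq : q ≤ m) :
    Summable fun l : ℕ => b (2 * (l + 1) * m - q) + b (2 * (l + 1) * m + q) := by
  have hinj : Function.Injective fun l : ℕ => 2 * (l + 1) * m := fun a c h => by
    have := Nat.eq_of_mul_eq_mul_right (Nat.pos_of_ne_zero hm) h
    omega
  refine Summable.add (hb.comp_injective (i := fun l : ℕ => 2 * (l + 1) * m - q) ?_)
    (hb.comp_injective (i := fun l : ℕ => 2 * (l + 1) * m + q) ?_)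
  · intro a c h
    refine hinj ?_
    have h1 : q ≤ 2 * (a + 1) * m := by nlinarith
    have h2 : q ≤ 2 * (c + 1) * m := by nlinarith
    simp only at h ⊢
    omega
  · intro a c h
    refine hinj ?_
    simp only at h ⊢
    omega

lemma hasSum_binomial (a : ℝ) {t : ℝ} (ht : |t| < 1) :
    HasSum (fun k => Ring.choose a k * t ^ k) ((1 + t) ^ a) := by
  have h := Real.one_add_rpow_hasFPowerSeriesOnBall_zero (a := a)
  have h1 := h.hasSum (y := t) (by simpa [Real.enorm_eq_ofReal_abs] using ht)
  simpa [binomialSeries, FormalMultilinearSeries.coeff_ofScalars, mul_comm] using h1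

lemma summable_abs_choose_mul_pow (a : ℝ) {r : ℝ} (h0 : 0 ≤ r) (h1 : r < 1) :
    Summable fun k => |Ring.choose a k| * r ^ k := by
  have h := (hasSum_binomial a (t := r) (by rwa [abs_of_nonneg h0])).summable.abs
  refine h.congr fun k => ?_
  rw [abs_mul, abs_of_nonneg (pow_nonneg h0 k)]

lemma hasSum_binomial_even (a : ℝ) {t : ℝ} (ht : |t| < 1) :
    HasSum (fun i => 2 * Ring.choose a (2 * i) * t ^ (2 * i)) ((1 - t) ^ a + (1 + t) ^ a) := by
  have h := (hasSum_binomial a (t := -t) (by rwa [abs_neg])).add (hasSum_binomial a ht)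
  have hinj : Function.Injective fun i : ℕ => 2 * i := fun a b h => by simp only at h; omega
  rw [← hinj.hasSum_iff] at h
  · convert! h using 2 with i
    simp only [Function.comp]
    rw [(even_two_mul i).neg_pow]
    ring
  · intro k hk
    have hk' : Odd k := by
      rw [← Nat.not_even_iff_odd]
      rintro ⟨i, hi⟩
      exact hk ⟨i, by simp only; omega⟩
    rw [hk'.neg_pow]
    ring

lemma summable_rpow_succ {s : ℝ} (hs : 1 < s) : Summable fun l : ℕ => ((l : ℝ) + 1) ^ (-s) := by
  have h := (summable_nat_add_iff 1).mpr (Real.summable_nat_rpow.mpr (by linarith : -s < -1))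
  exact_mod_cast h

lemma rapidDecay_of_le_choose (a : ℝ) {C : ℕ → ℝ} {B : ℝ}
    (h : ∀ i, |C i| ≤ B * (|Ring.choose a (2 * i)| * (1 / 2) ^ (2 * i))) : RapidDecay C := by
  intro N
  obtain ⟨A, hA⟩ := (summable_abs_choose_mul_pow a (r := 3 / 4) (by norm_num)
    (by norm_num)).tendsto_atTop_zero.bddAbove_range
  have hA' : ∀ k, |Ring.choose a k| * (3 / 4) ^ k ≤ A := fun k => hA ⟨k, rfl⟩
  have hA0 : 0 ≤ A := le_trans (by positivity) (hA' 0)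
  have hg := summable_pow_mul_geometric_of_norm_lt_one N (r := (2 / 3 : ℝ)) (by norm_num)
  have hg' := hg.comp_injective (i := fun i : ℕ => 2 * i + 1) fun a b h => by
    simp only at h; omega
  refine Summable.of_nonneg_of_le (fun i => by positivity) (fun i => ?_)
    (hg'.mul_left (|B| * A * (3 / 2)))
  have e : (1 / 2 : ℝ) ^ (2 * i) = (3 / 4) ^ (2 * i) * (2 / 3) ^ (2 * i) := by
    rw [← mul_pow]; norm_num
  calc |C i| * (2 * (i : ℝ) + 1) ^ N
      ≤ (|B| * (|Ring.choose a (2 * i)| * (1 / 2) ^ (2 * i))) * (2 * (i : ℝ) + 1) ^ N := by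
        gcongr
        exact (h i).trans (by gcongr; exact le_abs_self B)
    _ = |B| * (|Ring.choose a (2 * i)| * (3 / 4) ^ (2 * i)) * (2 / 3) ^ (2 * i)
          * (2 * (i : ℝ) + 1) ^ N := by rw [e]; ring
    _ ≤ |B| * A * (2 / 3) ^ (2 * i) * (2 * (i : ℝ) + 1) ^ N := by
        gcongr
        exact hA' _
    _ = _ := by
        simp only [Function.comp]
        push_cast
        rw [pow_succ]
        ring

lemma exists_hasSum_alias_rpow {s : ℝ} (hs : 1 < s) :
    ∃ C : ℕ → ℝ, RapidDecay C ∧ ∀ m q : ℕ, m ≠ 0 → q ≤ m →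
      HasSum (fun l : ℕ => ((2 * (l + 1) * m - q : ℕ) : ℝ) ^ (-s)
        + ((2 * (l + 1) * m + q : ℕ) : ℝ) ^ (-s))
        ((m : ℝ) ^ (-s) * ∑' i, C i * ((q : ℝ) / m) ^ (2 * i)) := by
  set β : ℕ → ℝ := fun i => Ring.choose (-s) (2 * i) with hβ
  set Z : ℕ → ℝ := fun l => (2 * ((l : ℝ) + 1)) ^ (-s) with hZ
  set w : ℕ → ℝ := fun l => (2 * ((l : ℝ) + 1))⁻¹ with hw
  have hZs : Summable Z := by
    have := (summable_rpow_succ hs).mul_left ((2 : ℝ) ^ (-s))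
    refine this.congr fun l => ?_
    simp only [hZ]
    rw [Real.mul_rpow zero_le_two (by positivity)]
  have hZ0 : ∀ l, 0 ≤ Z l := fun l => by positivity
  have hw0 : ∀ l, 0 ≤ w l := fun l => by positivity
  have hw1 : ∀ l, w l ≤ 1 / 2 := fun l => by
    rw [one_div]
    exact inv_anti₀ zero_lt_two (by have : (0 : ℝ) ≤ l := Nat.cast_nonneg l
                                    linarith)
  have hβs : Summable fun i => 2 * (|β i| * (1 / 2) ^ (2 * i)) :=
    ((summable_abs_choose_mul_pow (-s) (r := 1 / 2) (by norm_num) (by norm_num)).comp_injective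
      (i := fun i : ℕ => 2 * i) fun a b h => by simp only at h; omega).mul_left 2
  have hprod : ∀ y : ℝ, 0 ≤ y → y ≤ 1 →
      Summable fun p : ℕ × ℕ => Z p.1 * (2 * β p.2 * (w p.1 * y) ^ (2 * p.2)) := by
    intro y hy0 hy1
    have h := hZs.mul_of_nonneg hβs hZ0 (fun i => by positivity)
    refine Summable.of_norm_bounded h fun p => ?_
    have := hw0 p.1
    rw [Real.norm_eq_abs, abs_mul, abs_mul, abs_mul, abs_two, abs_of_nonneg (hZ0 _),
      abs_of_nonneg (by positivity : 0 ≤ (w p.1 * y) ^ (2 * p.2)), mul_assoc 2]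
    have h2 : w p.1 * y ≤ 1 / 2 := by nlinarith [hw1 p.1]
    have := hZ0 p.1
    gcongr
  set C : ℕ → ℝ := fun i => ∑' l, Z l * (2 * β i * w l ^ (2 * i)) with hC
  have hCs : ∀ i, Summable fun l => Z l * (2 * β i * w l ^ (2 * i)) := fun i => by
    simpa using (hprod 1 zero_le_one le_rfl).prod_symm.prod_factor i
  refine ⟨C, rapidDecay_of_le_choose (-s) (B := 2 * ∑' l, Z l) fun i => ?_, fun m q hm hq => ?_⟩
  · rw [hC, ← Real.norm_eq_abs]
    refine tsum_of_norm_bounded (g := fun l => Z l * (2 * (|β i| * (1 / 2) ^ (2 * i)))) ?_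
      fun l => ?_
    · convert! hZs.hasSum.mul_right (2 * (|β i| * (1 / 2) ^ (2 * i))) using 1
      ring
    · have := hw0 l
      rw [Real.norm_eq_abs, abs_mul, abs_mul, abs_mul, abs_two, abs_of_nonneg (hZ0 _),
        abs_of_nonneg (by positivity : 0 ≤ w l ^ (2 * i)), mul_assoc 2]
      have := hZ0 l
      have := hw1 l
      gcongr
  · have hm' : (0 : ℝ) < m := Nat.cast_pos.mpr (Nat.pos_of_ne_zero hm)
    set y : ℝ := (q : ℝ) / m with hy
    have hy0 : 0 ≤ y := by positivity
    have hy1 : y ≤ 1 := (div_le_one hm').mpr (by exact_mod_cast hq)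
    have hP := hprod y hy0 hy1
    have hrow := hP.hasSum.prod_fiberwise (g := fun l => Z l * ((1 - w l * y) ^ (-s)
      + (1 + w l * y) ^ (-s))) fun l => (hasSum_binomial_even (-s) (by
        rw [abs_of_nonneg (mul_nonneg (hw0 l) hy0)]
        nlinarith [hw1 l, hw0 l])).mul_left (Z l)
    have hcol := hP.prod_symm.hasSum.prod_fiberwise (g := fun i => C i * y ^ (2 * i)) fun i => by
      convert! (hCs i).hasSum.mul_right (y ^ (2 * i)) using 2 with l
      simp only [Prod.swap]
      rw [mul_pow]
      ring
    have htot : ∑' p : ℕ × ℕ, Z p.1 * (2 * β p.2 * (w p.1 * y) ^ (2 * p.2))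
        = ∑' i, C i * y ^ (2 * i) := by
      rw [hcol.tsum_eq]
      exact ((Equiv.prodComm ℕ ℕ).tsum_eq
        fun p : ℕ × ℕ => Z p.1 * (2 * β p.2 * (w p.1 * y) ^ (2 * p.2))).symm
    rw [htot] at hrow
    convert! hrow.mul_left ((m : ℝ) ^ (-s)) using 2 with l
    have hl : (0 : ℝ) < 2 * ((l : ℝ) + 1) := by positivity
    have hwy : w l * y ≤ 1 := by nlinarith [hw1 l, hw0 l]
    have hwl : 2 * ((l : ℝ) + 1) * w l = 1 := mul_inv_cancel₀ hl.ne'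
    have hmy : (m : ℝ) * y = q := mul_div_cancel₀ _ hm'.ne'
    rw [cast_alias_sub hq, show (2 * ((l : ℝ) + 1) * m - q)
      = m * (2 * ((l : ℝ) + 1) * (1 - w l * y)) by
        linear_combination hmy + (m : ℝ) * y * hwl,
      show ((2 * (l + 1) * m + q : ℕ) : ℝ) = m * (2 * ((l : ℝ) + 1) * (1 + w l * y)) by
        push_cast
        linear_combination -hmy - (m : ℝ) * y * hwl]
    rw [Real.mul_rpow hm'.le (mul_nonneg hl.le (by linarith)),
      Real.mul_rpow hl.le (by linarith : 0 ≤ 1 - w l * y),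
      Real.mul_rpow hm'.le (mul_nonneg hl.le (by have := mul_nonneg (hw0 l) hy0; linarith)),
      Real.mul_rpow hl.le (by have := mul_nonneg (hw0 l) hy0; linarith : 0 ≤ 1 + w l * y)]
    ring

/-- The Clenshaw–Curtis error on `2m + 1` nodes, in terms of the coefficients `b` of the
even-degree Chebyshev polynomials. -/
noncomputable def aliasError (b : ℕ → ℝ) (m : ℕ) : ℝ :=
  trapSum (fun q => aliasSum (fun k => b k * chebMoment k) m q
    - chebMoment q * aliasSum b m q) m

lemma Summable.mul_chebMoment {b : ℕ → ℝ} (hb : Summable b) :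
    Summable fun k => b k * chebMoment k := by
  refine Summable.of_norm_bounded (hb.norm.mul_right 2) fun k => ?_
  rw [norm_mul]
  gcongr
  exact abs_chebMoment_le k

lemma aliasSum_add {a b : ℕ → ℝ} (ha : Summable a) (hb : Summable b) {m q : ℕ} (hm : m ≠ 0)
    (hq : q ≤ m) : aliasSum (fun k => a k + b k) m q = aliasSum a m q + aliasSum b m q := by
  unfold aliasSum
  rw [← (summable_alias ha hm hq).tsum_add (summable_alias hb hm hq)]
  exact tsum_congr fun l => by ring

lemma aliasSum_const_mul (c : ℝ) (b : ℕ → ℝ) (m q : ℕ) :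
    aliasSum (fun k => c * b k) m q = c * aliasSum b m q := by
  unfold aliasSum
  rw [← tsum_mul_left]
  exact tsum_congr fun l => by ring

lemma aliasError_add {a b : ℕ → ℝ} (ha : Summable a) (hb : Summable b) {m : ℕ} (hm : m ≠ 0) :
    aliasError (fun k => a k + b k) m = aliasError a m + aliasError b m := by
  unfold aliasError
  rw [← trapSum_add]
  refine trapSum_congr fun q hq => ?_
  rw [aliasSum_add ha hb hm hq]
  simp_rw [add_mul]
  rw [aliasSum_add ha.mul_chebMoment hb.mul_chebMoment hm hq]
  ring

lemma aliasError_const_mul (c : ℝ) (b : ℕ → ℝ) (m : ℕ) :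
    aliasError (fun k => c * b k) m = c * aliasError b m := by
  unfold aliasError
  rw [← trapSum_const_mul]
  refine trapSum_congr fun q _ => ?_
  simp_rw [mul_assoc]
  rw [aliasSum_const_mul, aliasSum_const_mul]
  ring

lemma aliasError_sum {ι : Type*} (s : Finset ι) {b : ι → ℕ → ℝ} (hb : ∀ i ∈ s, Summable (b i))
    {m : ℕ} (hm : m ≠ 0) :
    aliasError (fun k => ∑ i ∈ s, b i k) m = ∑ i ∈ s, aliasError (b i) m := by
  classical
  induction s using Finset.induction_on with
  | empty => simpa using aliasError_const_mul 0 0 m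
  | insert a s ha ih =>
    simp_rw [Finset.sum_insert ha]
    have h1 : ∀ i ∈ s, Summable (b i) := fun i hi => hb i (by simp [hi])
    rw [aliasError_add (hb a (by simp)) (summable_sum h1) hm, ih h1]

lemma abs_aliasSum_le {b : ℕ → ℝ} {s B : ℝ} (hs : 1 < s) {m q : ℕ} (hm : m ≠ 0) (hq : q ≤ m)
    (hb : ∀ k, m ≤ k → |b k| ≤ B * (k : ℝ) ^ (-s)) :
    |aliasSum b m q| ≤ 2 * B * (∑' l : ℕ, ((l : ℝ) + 1) ^ (-s)) * (m : ℝ) ^ (-s) := by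
  have hm' : (0 : ℝ) < m := Nat.cast_pos.mpr (Nat.pos_of_ne_zero hm)
  have hB : 0 ≤ B := by
    have := (abs_nonneg _).trans (hb m le_rfl)
    exact nonneg_of_mul_nonneg_left this (by positivity)
  have key : ∀ l k : ℕ, (l + 1) * m ≤ k → |b k| ≤ B * (((l : ℝ) + 1) ^ (-s) * (m : ℝ) ^ (-s)) := by
    intro l k hk
    refine (hb k (le_trans (by nlinarith) hk)).trans ?_
    rw [← Real.mul_rpow (by positivity) hm'.le]
    gcongr ?_ * ?_
    exact Real.rpow_le_rpow_of_nonpos (by positivity) (by exact_mod_cast hk) (by linarith)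
  unfold aliasSum
  rw [← Real.norm_eq_abs]
  refine tsum_of_norm_bounded
    (g := fun l : ℕ => 2 * B * (((l : ℝ) + 1) ^ (-s)) * (m : ℝ) ^ (-s)) ?_ fun l => ?_
  · exact ((summable_rpow_succ hs).hasSum.mul_left _).mul_right _
  · have h1 := key l (2 * (l + 1) * m - q) (by
      have : (l + 1) * m + q ≤ 2 * (l + 1) * m := by nlinarith
      omega)
    have h2 := key l (2 * (l + 1) * m + q) (by nlinarith)
    refine (norm_add_le _ _).trans ?_
    rw [Real.norm_eq_abs, Real.norm_eq_abs]
    linarith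

lemma isBigO_aliasError {b : ℕ → ℝ} {s : ℝ} (hs : 1 < s)
    (hb : b =O[atTop] fun k : ℕ => (k : ℝ) ^ (-s)) :
    (fun m => aliasError b m) =O[atTop] fun m : ℕ => (m : ℝ) ^ (1 - s) := by
  obtain ⟨B, hB⟩ := hb.bound
  obtain ⟨N, hN⟩ := eventually_atTop.mp hB
  set S := ∑' l : ℕ, ((l : ℝ) + 1) ^ (-s) with hS
  refine Asymptotics.IsBigO.of_bound (8 * B * S) ?_
  filter_upwards [eventually_ge_atTop N, eventually_ne_atTop 0] with m hmN hm
  have hm' : (0 : ℝ) < m := Nat.cast_pos.mpr (Nat.pos_of_ne_zero hm)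
  have hb1 : ∀ k, m ≤ k → |b k| ≤ B * (k : ℝ) ^ (-s) := fun k hk => by
    have := hN k (hmN.trans hk)
    rwa [Real.norm_eq_abs, Real.norm_of_nonneg (by positivity)] at this
  have hb2 : ∀ k, m ≤ k → |b k * chebMoment k| ≤ (2 * B) * (k : ℝ) ^ (-s) := fun k hk => by
    rw [abs_mul]
    calc |b k| * |chebMoment k| ≤ (B * (k : ℝ) ^ (-s)) * 2 :=
          mul_le_mul (hb1 k hk) (abs_chebMoment_le k) (abs_nonneg _)
            ((abs_nonneg _).trans (hb1 k hk))
      _ = _ := by ring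
  rw [Real.norm_eq_abs, Real.norm_of_nonneg (by positivity : (0 : ℝ) ≤ (m : ℝ) ^ (1 - s))]
  refine (abs_trapSum_le (B := 8 * B * S * (m : ℝ) ^ (-s)) fun q hq => ?_).trans (le_of_eq ?_)
  · have h1 := abs_aliasSum_le hs hm hq hb1
    have h2 := abs_aliasSum_le hs hm hq hb2
    calc _ ≤ |aliasSum (fun k => b k * chebMoment k) m q| + |chebMoment q * aliasSum b m q| :=
          abs_sub _ _
      _ ≤ 2 * (2 * B) * S * (m : ℝ) ^ (-s) + 2 * (2 * B * S * (m : ℝ) ^ (-s)) := by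
          rw [abs_mul]
          gcongr
          exact abs_chebMoment_le q
      _ = _ := by ring
  · rw [sub_eq_add_neg, Real.rpow_add hm', Real.rpow_one]
    ring

lemma aliasSum_congr {a b : ℕ → ℝ} {m q : ℕ} (hm : m ≠ 0) (hq : q ≤ m)
    (h : ∀ k, k ≠ 0 → a k = b k) : aliasSum a m q = aliasSum b m q := by
  have hm' := Nat.pos_of_ne_zero hm
  refine tsum_congr fun l => ?_
  have h1 : q < 2 * (l + 1) * m := by nlinarith
  rw [h _ (by omega), h _ (by omega)]

lemma summable_rpow_neg {s : ℝ} (hs : 1 < s) : Summable fun k : ℕ => (k : ℝ) ^ (-s) :=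
  Real.summable_nat_rpow.mpr (by linarith)

lemma rpow_neg_mul_chebMoment (s : ℝ) (J : ℕ) {k : ℕ} (hk : k ≠ 0) :
    (k : ℝ) ^ (-s) * chebMoment k
      = ∑ j ∈ range J, -2 * (1 / 4) ^ (j + 1) * (k : ℝ) ^ (-(s + 2 * ((j + 1 : ℕ) : ℝ)))
        + (1 / 4) ^ J * ((k : ℝ) ^ (-(s + 2 * (J : ℝ))) * chebMoment k) := by
  have hk' : (0 : ℝ) < k := Nat.cast_pos.mpr (Nat.pos_of_ne_zero hk)
  induction J with
  | zero => simp
  | succ J ih =>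
    rw [Finset.sum_range_succ, add_assoc, ih]
    congr 1
    have e : (k : ℝ) ^ (-(s + 2 * (J : ℝ)))
        = (k : ℝ) ^ (-(s + 2 * ((J + 1 : ℕ) : ℝ))) * (k : ℝ) ^ 2 := by
      rw [← Real.rpow_natCast (k : ℝ) 2, ← Real.rpow_add hk']
      congr 1
      push_cast
      ring
    rw [e, pow_succ]
    linear_combination ((1 / 4 : ℝ) ^ J * (1 / 4) * (k : ℝ) ^ (-(s + 2 * ((J + 1 : ℕ) : ℝ))))
      * four_mul_sq_mul_chebMoment k

lemma hasInvSqExpansion_trapSum_aliasSum_rpow {s : ℝ} (hs : 1 < s) (K : ℕ) :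
    HasInvSqExpansion K fun m : ℕ => (m : ℝ) ^ (s - 1)
      * trapSum (fun q => aliasSum (fun k => (k : ℝ) ^ (-s)) m q) m := by
  obtain ⟨C, hC, h⟩ := exists_hasSum_alias_rpow hs
  refine (hasInvSqExpansion_tsum_faulhaber hC K).congr' ?_
  filter_upwards [eventually_ne_atTop 0] with m hm
  have hm' : (0 : ℝ) < m := Nat.cast_pos.mpr (Nat.pos_of_ne_zero hm)
  rw [trapSum_congr fun q hq =>
    show aliasSum (fun k => (k : ℝ) ^ (-s)) m q = _ from (h m q hm hq).tsum_eq, trapSum_const_mul]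
  have h1 : HasSum (fun i => C i * (m * ∑ j ∈ range (i + 1), faulhaberCoeff i j * invSq m ^ j))
      (trapSum (fun q => ∑' i, C i * ((q : ℝ) / m) ^ (2 * i)) m) := by
    simp_rw [← trapSum_pow hm, ← trapSum_const_mul]
    refine HasSum.trapSum fun q hq => (hC.summable_mul (B := 1) (N := 0) fun i => ?_).hasSum
    have h1 : (q : ℝ) / m ≤ 1 := (div_le_one hm').mpr (by exact_mod_cast hq)
    rw [abs_of_nonneg (by positivity)]
    simpa using pow_le_one₀ (by positivity) h1
  rw [← h1.tsum_eq, tsum_congr fun i => mul_left_comm (C i) _ _, tsum_mul_left, ← mul_assoc,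
    ← mul_assoc, ← Real.rpow_add hm', ← Real.rpow_add_one hm'.ne', show s - 1 + -s + 1 = 0 by ring,
    Real.rpow_zero, one_mul]

lemma hasInvSqExpansion_trapSum_chebMoment_mul_aliasSum_rpow {s : ℝ} (hs : 1 < s) (K : ℕ) :
    HasInvSqExpansion K fun m : ℕ => (m : ℝ) ^ (s + 1)
      * trapSum (fun q => chebMoment q * aliasSum (fun k => (k : ℝ) ^ (-s)) m q) m := by
  obtain ⟨C, hC, h⟩ := exists_hasSum_alias_rpow hs
  refine (hasInvSqExpansion_tsum_chebMoment hC K).congr' ?_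
  filter_upwards [eventually_ne_atTop 0] with m hm
  have hm' : (0 : ℝ) < m := Nat.cast_pos.mpr (Nat.pos_of_ne_zero hm)
  have h1 : HasSum
      (fun i => C i * trapSum (fun q => chebMoment q * ((q : ℝ) / m) ^ (2 * i)) m)
      (trapSum (fun q => ∑' i, C i * (chebMoment q * ((q : ℝ) / m) ^ (2 * i))) m) := by
    simp_rw [← trapSum_const_mul]
    refine HasSum.trapSum fun q hq => (hC.summable_mul (B := 2) (N := 0) fun i => ?_).hasSum
    simpa using abs_chebMoment_mul_pow_le hm hq i
  have h2 : trapSum (fun q => chebMoment q * aliasSum (fun k => (k : ℝ) ^ (-s)) m q) m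
      = (m : ℝ) ^ (-s)
        * trapSum (fun q => ∑' i, C i * (chebMoment q * ((q : ℝ) / m) ^ (2 * i))) m := by
    rw [← trapSum_const_mul]
    refine trapSum_congr fun q hq => ?_
    rw [show aliasSum (fun k => (k : ℝ) ^ (-s)) m q = _ from (h m q hm hq).tsum_eq,
      tsum_congr fun i => mul_left_comm (C i) _ _, tsum_mul_left]
    ring
  rw [h2, ← h1.tsum_eq, tsum_congr fun i => mul_left_comm (C i) _ _, tsum_mul_left, ← mul_assoc,
    ← Real.rpow_add hm']
  norm_num

lemma rpow_eq_invSq_pow_mul {m : ℕ} (hm : m ≠ 0) (a : ℝ) (j : ℕ) :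
    (m : ℝ) ^ (a - 2 * (j : ℝ)) = invSq m ^ j * (m : ℝ) ^ a := by
  have hm' : (0 : ℝ) < m := Nat.cast_pos.mpr (Nat.pos_of_ne_zero hm)
  rw [invSq, inv_pow, ← pow_mul, ← Real.rpow_natCast, ← Real.rpow_neg hm'.le,
    ← Real.rpow_add hm']
  congr 1
  push_cast
  ring

/-- The error for the monomial coefficients `k^{-s}` expands in powers `m^{-s-1-2j}`. -/
lemma hasInvSqExpansion_aliasError_rpow {s : ℝ} (hs : 1 < s) (K : ℕ) :
    HasInvSqExpansion K fun m : ℕ => (m : ℝ) ^ (s + 1)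
      * aliasError (fun k => (k : ℝ) ^ (-s)) m := by
  set J := K + 1 with hJ
  have hsJ : ∀ j : ℕ, 1 < s + 2 * (j : ℝ) := fun j => by
    have : (0 : ℝ) ≤ j := Nat.cast_nonneg j
    linarith
  have hmain : HasInvSqExpansion K fun m : ℕ =>
      ∑ j ∈ range J, -2 * (1 / 4) ^ (j + 1) * (invSq m ^ j
        * ((m : ℝ) ^ ((s + 2 * ((j + 1 : ℕ) : ℝ)) - 1) * trapSum (fun q =>
          aliasSum (fun k => (k : ℝ) ^ (-(s + 2 * ((j + 1 : ℕ) : ℝ)))) m q) m)) :=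
    HasInvSqExpansion.sum _ fun j _ => ((hasInvSqExpansion_trapSum_aliasSum_rpow
      (hsJ (j + 1)) K).invSq_pow_mul j).const_mul _
  have hrem : HasInvSqExpansion K fun m : ℕ => (m : ℝ) ^ (s + 1) * trapSum (fun q =>
      aliasSum (fun k => (1 / 4) ^ J * ((k : ℝ) ^ (-(s + 2 * (J : ℝ))) * chebMoment k)) m q) m := by
    refine HasInvSqExpansion.of_isBigO (Asymptotics.IsBigO.of_bound
      (2 * 2 * ∑' l : ℕ, ((l : ℝ) + 1) ^ (-(s + 2 * (J : ℝ)))) ?_)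
    filter_upwards [eventually_ne_atTop 0] with m hm
    have hm' : (0 : ℝ) < m := Nat.cast_pos.mpr (Nat.pos_of_ne_zero hm)
    have hb : ∀ k : ℕ, m ≤ k →
        |(1 / 4) ^ J * ((k : ℝ) ^ (-(s + 2 * (J : ℝ))) * chebMoment k)|
          ≤ 2 * (k : ℝ) ^ (-(s + 2 * (J : ℝ))) := fun k _ => by
      have h0 : (0 : ℝ) ≤ (k : ℝ) ^ (-(s + 2 * (J : ℝ))) := by positivity
      rw [abs_mul, abs_mul, abs_of_nonneg h0, abs_of_nonneg (by positivity : (0 : ℝ) ≤ (1 / 4) ^ J)]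
      calc (1 / 4 : ℝ) ^ J * ((k : ℝ) ^ (-(s + 2 * (J : ℝ))) * |chebMoment k|)
          ≤ 1 * ((k : ℝ) ^ (-(s + 2 * (J : ℝ))) * 2) := by
            gcongr
            · exact pow_le_one₀ (by norm_num) (by norm_num)
            · exact abs_chebMoment_le k
        _ = _ := by ring
    have h1 := abs_trapSum_le fun q hq => abs_aliasSum_le (hsJ J) hm hq hb
    have h0 := invSq_nonneg m
    rw [norm_mul, Real.norm_of_nonneg (by positivity), Real.norm_eq_abs,
      Real.norm_of_nonneg (by positivity)]
    calc _ ≤ (m : ℝ) ^ (s + 1) * _ := mul_le_mul_of_nonneg_left h1 (by positivity)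
      _ = _ := by
        rw [show -(s + 2 * (J : ℝ)) = (-s) - 2 * (J : ℝ) by ring, rpow_eq_invSq_pow_mul hm, hJ,
          pow_succ]
        have e1 : (m : ℝ) ^ (s + 1) * (m : ℝ) ^ (-s) = m := by
          rw [← Real.rpow_add hm']; norm_num
        have e2 : (m : ℝ) * (invSq m * m) = 1 := by unfold invSq; field_simp
        rw [show ∀ S : ℝ, (m : ℝ) ^ (s + 1) * (m * (2 * 2 * S * (invSq m ^ K * invSq m
          * (m : ℝ) ^ (-s)))) = 2 * 2 * S * invSq m ^ K * (((m : ℝ) ^ (s + 1) * (m : ℝ) ^ (-s))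
            * (invSq m * m)) by intro S; ring, e1, e2, mul_one]
  refine ((hmain.add hrem).sub
    (hasInvSqExpansion_trapSum_chebMoment_mul_aliasSum_rpow hs K)).congr' ?_
  filter_upwards [eventually_ne_atTop 0] with m hm
  have hm' : (0 : ℝ) < m := Nat.cast_pos.mpr (Nat.pos_of_ne_zero hm)
  rw [aliasError, trapSum_sub, mul_sub]
  congr 1
  have hsum : ∀ j : ℕ, Summable fun k : ℕ =>
      -2 * (1 / 4 : ℝ) ^ (j + 1) * (k : ℝ) ^ (-(s + 2 * ((j + 1 : ℕ) : ℝ))) := fun j =>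
    (summable_rpow_neg (hsJ (j + 1))).mul_left _
  have hsum' : Summable fun k : ℕ =>
      (1 / 4 : ℝ) ^ J * ((k : ℝ) ^ (-(s + 2 * (J : ℝ))) * chebMoment k) :=
    (summable_rpow_neg (hsJ J)).mul_chebMoment.mul_left _
  have hal : ∀ q ≤ m, aliasSum (fun k => (k : ℝ) ^ (-s) * chebMoment k) m q
      = ∑ j ∈ range J, -2 * (1 / 4) ^ (j + 1)
          * aliasSum (fun k => (k : ℝ) ^ (-(s + 2 * ((j + 1 : ℕ) : ℝ)))) m q
        + aliasSum (fun k => (1 / 4) ^ J * ((k : ℝ) ^ (-(s + 2 * (J : ℝ))) * chebMoment k)) m q := by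
    intro q hq
    rw [aliasSum_congr hm hq fun k hk => rpow_neg_mul_chebMoment s J hk,
      aliasSum_add (summable_sum fun j _ => hsum j) hsum' hm hq]
    congr 1
    generalize J = J'
    induction J' with
    | zero => simp [aliasSum]
    | succ J' ih =>
      simp_rw [Finset.sum_range_succ]
      rw [aliasSum_add (summable_sum fun j _ => hsum j) (hsum J') hm hq, ih, aliasSum_const_mul]
  rw [trapSum_congr hal, trapSum_add, mul_add]
  congr 1
  have htr : ∀ F : ℕ → ℕ → ℝ, trapSum (fun q => ∑ j ∈ range J, F j q) m
      = ∑ j ∈ range J, trapSum (F j) m := by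
    intro F
    generalize J = J'
    induction J' with
    | zero => simp [trapSum]
    | succ J' ih =>
      simp_rw [Finset.sum_range_succ]
      rw [trapSum_add, ih]
  rw [htr, Finset.mul_sum]
  refine Finset.sum_congr rfl fun j _ => ?_
  rw [trapSum_const_mul, ← mul_assoc (invSq m ^ j), ← rpow_eq_invSq_pow_mul hm,
    show s + 2 * ((j + 1 : ℕ) : ℝ) - 1 - 2 * (j : ℝ) = s + 1 by push_cast; ring]
  ring

lemma trapSum_eq_sum_ccDelta {n : ℕ} (hn : n ≠ 0) (g : ℕ → ℝ) :
    trapSum g n = ∑ j ∈ range (n + 1), ccDelta n j * g j := by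
  obtain ⟨n, rfl⟩ := Nat.exists_eq_succ_of_ne_zero hn
  rw [trapSum_eq, Finset.sum_range_succ (fun j => ccDelta _ j * g j),
    Finset.sum_range_succ' (fun j => ccDelta _ j * g j), Finset.sum_range_succ' g]
  have h : ∀ j ∈ range n, ccDelta n.succ (j + 1) * g (j + 1) = g (j + 1) := fun j hj => by
    have := Finset.mem_range.mp hj
    rw [ccDelta, if_neg (by omega), one_mul]
  rw [Finset.sum_congr rfl h]
  simp [ccDelta]
  ring

lemma trapSum_cos {n : ℕ} (hn : n ≠ 0) (i : ℤ) :
    trapSum (fun j => Real.cos (i * (j * π / n))) n = if (2 * n : ℤ) ∣ i then (n : ℝ) else 0 := by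
  have hn' : (n : ℝ) ≠ 0 := Nat.cast_ne_zero.mpr hn
  split_ifs with h
  · obtain ⟨k, rfl⟩ := h
    have h1 : ∀ j : ℕ, Real.cos (((2 * n * k : ℤ) : ℝ) * (j * π / n)) = 1 := fun j => by
      rw [← Real.cos_int_mul_two_pi (k * j)]
      congr 1
      push_cast
      field_simp
    simp only [trapSum, h1]
    simp
  · set θ : ℝ := i * (π / n) with hθ
    have hs : Real.sin (θ / 2) ≠ 0 := fun h0 => by
      obtain ⟨k, hk⟩ := Real.sin_eq_zero_iff.mp h0
      refine h ⟨k, ?_⟩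
      have : (i : ℝ) = 2 * n * k := by
        rw [hθ] at hk
        field_simp at hk
        linarith
      exact_mod_cast this
    have key : ∀ N : ℕ, Real.sin (θ / 2) * trapSum (fun j => Real.cos (i * (j * π / n))) N
        = Real.cos (θ / 2) * Real.sin (N * θ) / 2 := fun N => by
      induction N with
      | zero => simp [trapSum]
      | succ N ih =>
        have e : trapSum (fun j : ℕ => Real.cos (i * (j * π / n))) (N + 1)
            = trapSum (fun j : ℕ => Real.cos (i * (j * π / n))) N
              + (Real.cos (N * θ) + Real.cos (N * θ + θ)) / 2 := by
          rw [trapSum, Finset.sum_range_succ, ← trapSum, hθ]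
          congr 4 <;> (push_cast; ring)
        have e2 : ((N + 1 : ℕ) : ℝ) * θ = N * θ + θ := by push_cast; ring
        have e3 : θ = 2 * (θ / 2) := by ring
        rw [e, mul_add, ih, e2, Real.cos_add, Real.sin_add]
        have c := Real.cos_two_mul (θ / 2)
        have s := Real.sin_two_mul (θ / 2)
        have p := Real.sin_sq_add_cos_sq (θ / 2)
        rw [← e3] at c s
        rw [c, s]
        linear_combination (-Real.cos (θ / 2) * Real.sin (N * θ)) * p
    have := key n
    have e : (n : ℝ) * θ = i * π := by rw [hθ]; field_simp
    rw [e, Real.sin_int_mul_pi, mul_zero, zero_div] at this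
    exact (mul_eq_zero.mp this).resolve_left hs

lemma trapSum_comm (F : ℕ → ℕ → ℝ) (m n : ℕ) :
    trapSum (fun j => trapSum (fun k => F j k) m) n
      = trapSum (fun k => trapSum (fun j => F j k) n) m := by
  simp only [trapSum, ← Finset.sum_add_distrib, Finset.sum_div]
  rw [Finset.sum_comm]
  exact Finset.sum_congr rfl fun _ _ => Finset.sum_congr rfl fun _ _ => by ring

lemma ccWeight_two_mul {m : ℕ} (hm : m ≠ 0) (j : ℕ) :
    ccWeight (2 * m) j = ccDelta (2 * m) j *
      (1 / m * trapSum (fun k => chebMoment k * Real.cos ((2 * k : ℤ) * (j * π / (2 * m : ℕ)))) m) := by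
  rw [trapSum_eq_sum_ccDelta hm, ccWeight, Nat.mul_div_cancel_left m two_pos, Finset.mul_sum,
    Finset.mul_sum, Finset.mul_sum]
  refine Finset.sum_congr rfl fun k _ => ?_
  have h1 : ccDelta (2 * m) (2 * k) = ccDelta m k := by simp [ccDelta]
  have h2 : 2 * (j : ℝ) * k * π / (2 * m : ℕ) = (2 * k : ℤ) * (j * π / (2 * m : ℕ)) := by
    push_cast; ring
  have hm' : (m : ℝ) ≠ 0 := Nat.cast_ne_zero.mpr hm
  rw [h1, h2, chebMoment]
  have := one_sub_four_mul_sq_ne_zero k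
  push_cast
  field_simp
  ring

/-- The Clenshaw–Curtis rule applied to the Chebyshev polynomial of degree `p`. -/
noncomputable def ccMoment (n : ℕ) (p : ℤ) : ℝ :=
  ∑ j ∈ range (n + 1), ccWeight n j * Real.cos (p * (j * π / n))

lemma ccMoment_neg (n : ℕ) (p : ℤ) : ccMoment n (-p) = ccMoment n p := by
  simp [ccMoment]

lemma ccMoment_eq {m : ℕ} (hm : m ≠ 0) (p : ℤ) :
    ccMoment (2 * m) p = trapSum (fun k => chebMoment k *
      ((if (4 * m : ℤ) ∣ p - 2 * k then 1 else 0) + if (4 * m : ℤ) ∣ p + 2 * k then 1 else 0)) m := by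
  have hm' : (m : ℝ) ≠ 0 := Nat.cast_ne_zero.mpr hm
  have h2m : 2 * m ≠ 0 := by omega
  have h1 : ccMoment (2 * m) p = trapSum (fun j => trapSum (fun k => 1 / m * (chebMoment k *
      (1 / 2 * (Real.cos ((p - 2 * k : ℤ) * (j * π / (2 * m : ℕ)))
        + Real.cos ((p + 2 * k : ℤ) * (j * π / (2 * m : ℕ))))))) m) (2 * m) := by
    rw [trapSum_eq_sum_ccDelta h2m]
    refine Finset.sum_congr rfl fun j _ => ?_
    rw [ccWeight_two_mul hm, mul_assoc, ← trapSum_const_mul, mul_comm (trapSum _ _),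
      ← trapSum_const_mul]
    congr 1
    refine trapSum_congr fun k _ => ?_
    push_cast
    rw [sub_mul, add_mul, Real.cos_sub, Real.cos_add]
    ring
  rw [h1, trapSum_comm]
  refine trapSum_congr fun k _ => ?_
  rw [trapSum_const_mul, trapSum_const_mul, trapSum_const_mul, trapSum_add, trapSum_cos h2m,
    trapSum_cos h2m]
  have e : (2 * (2 * m : ℕ) : ℤ) = 4 * m := by push_cast; ring
  rw [e]
  push_cast
  split_ifs <;> field_simp <;> ring

lemma ccMoment_odd {m : ℕ} (hm : m ≠ 0) {p : ℤ} (hp : Odd p) : ccMoment (2 * m) p = 0 := by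
  rw [ccMoment_eq hm]
  have h : ∀ i : ℤ, Odd i → ¬ (4 * m : ℤ) ∣ i := fun i ⟨c, hc⟩ ⟨e, he⟩ => by
    have h4 : (4 * m * e : ℤ) = 2 * (2 * m * e) := by ring
    omega
  rw [trapSum_congr (h := fun _ => 0) fun k _ => ?_]
  · simp [trapSum]
  · rw [if_neg (h _ (hp.sub_even (even_two_mul _))), if_neg (h _ (hp.add_even (even_two_mul _)))]
    simp

lemma ccMoment_two_mul {m q : ℕ} (hm : m ≠ 0) (hq : q ≤ m) {r : ℤ} (hr : (2 * m : ℤ) ∣ r - q) :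
    ccMoment (2 * m) (2 * r) = chebMoment q := by
  obtain ⟨c, hc⟩ := hr
  have hr' : r = 2 * m * c + q := by linarith
  have h1 : ∀ k ≤ m, ((4 * m : ℤ) ∣ 2 * r - 2 * k ↔ k = q) := fun k hk => by
    have e : 2 * r - 2 * k = 2 * ((q : ℤ) - k) + 4 * m * c := by rw [hr']; ring
    rw [e, Int.dvd_add_left (Dvd.intro _ rfl)]
    constructor
    · intro h
      have := Int.eq_zero_of_abs_lt_dvd h (by rw [abs_lt]; omega)
      omega
    · rintro rfl; simp
  have h2 : ∀ k ≤ m, ((4 * m : ℤ) ∣ 2 * r + 2 * k ↔ k = q ∧ (k = 0 ∨ k = m)) := fun k hk => by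
    have e : 2 * r + 2 * k = 2 * ((q : ℤ) + k) + 4 * m * c := by rw [hr']; ring
    rw [e, Int.dvd_add_left (Dvd.intro _ rfl)]
    constructor
    · rintro ⟨i, hi⟩
      have h0 : 0 ≤ i := by
        by_contra hneg
        have := mul_le_mul_of_nonneg_left (show i ≤ -1 by omega) (show (0 : ℤ) ≤ 4 * m by omega)
        omega
      have h1 : i ≤ 1 := by
        by_contra hneg
        have := mul_le_mul_of_nonneg_left (show 2 ≤ i by omega) (show (0 : ℤ) ≤ 4 * m by omega)
        omega
      have : i = 0 ∨ i = 1 := by omega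
      rcases this with rfl | rfl <;> omega
    · rintro ⟨rfl, rfl | rfl⟩
      · simp
      · exact ⟨1, by ring⟩
  rw [ccMoment_eq hm, trapSum_eq_sum_ccDelta hm, Finset.sum_eq_single q]
  · simp only [h1 q hq, h2 q hq, ccDelta, true_and, if_true]
    split_ifs <;> ring
  · intro k hk hkq
    have hk' : k ≤ m := by have := Finset.mem_range.mp hk; omega
    simp [h1 k hk', h2 k hk', hkq]
  · intro h
    exact absurd (Finset.mem_range.mpr (by omega)) h

lemma continuous_comp_cos {f : ℝ → ℝ} (hf : ContinuousOn f (Set.Icc (-1) 1)) :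
    Continuous fun t => f (Real.cos t) :=
  hf.comp_continuous Real.continuous_cos fun t => ⟨Real.neg_one_le_cos t, Real.cos_le_one t⟩

/-- `f ∘ cos` as a continuous function on the circle. -/
noncomputable def cosLift {f : ℝ → ℝ} (hf : ContinuousOn f (Set.Icc (-1) 1)) :
    C(AddCircle (2 * π), ℂ) where
  toFun := Function.Periodic.lift (f := fun t : ℝ => ((f (Real.cos t) : ℝ) : ℂ)) (c := 2 * π)
    fun t => by simp
  continuous_toFun := (Complex.continuous_ofReal.comp (continuous_comp_cos hf)).quotient_lift _

lemma integral_symm_exp_mul {g : ℝ → ℝ} (hg : Continuous g) (heven : ∀ t, g (-t) = g t) (n : ℤ) :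
    ∫ t in (-π)..π, Complex.exp (-(n * t * Complex.I)) * (g t : ℂ)
      = ((2 * ∫ t in (0 : ℝ)..π, g t * Real.cos (n * t) : ℝ) : ℂ) := by
  set F : ℝ → ℂ := fun t => Complex.exp (-(n * t * Complex.I)) * (g t : ℂ) with hF
  have hFc : Continuous F := by fun_prop
  have hFc' : Continuous fun t => F (-t) := hFc.comp continuous_neg
  have h1 : ∫ t in (-π)..0, F t = ∫ t in (0 : ℝ)..π, F (-t) := by
    rw [intervalIntegral.integral_comp_neg F, neg_zero]
  rw [← intervalIntegral.integral_add_adjacent_intervals (hFc.intervalIntegrable _ 0)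
    (hFc.intervalIntegrable 0 _), h1, ← intervalIntegral.integral_add
    (hFc'.intervalIntegrable _ _) (hFc.intervalIntegrable _ _),
    ← intervalIntegral.integral_const_mul, ← intervalIntegral.integral_ofReal]
  refine intervalIntegral.integral_congr fun t _ => ?_
  simp only [hF, heven]
  push_cast
  rw [Complex.cos, show -((n : ℂ) * -t * Complex.I) = n * t * Complex.I by ring,
    show -((n : ℂ) * t) * Complex.I = -(n * t * Complex.I) by ring]
  ring

lemma fourierCoeff_cosLift {f : ℝ → ℝ} (hf : ContinuousOn f (Set.Icc (-1) 1)) (n : ℤ) :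
    haveI : Fact (0 < 2 * π) := ⟨Real.two_pi_pos⟩
    fourierCoeff (cosLift hf) n = ((chebCoeff f n.natAbs / 2 : ℝ) : ℂ) := by
  have : Fact (0 < 2 * π) := ⟨Real.two_pi_pos⟩
  have hpi := Real.pi_ne_zero
  have hcos : ∀ t : ℝ, Real.cos ((n.natAbs : ℝ) * t) = Real.cos (n * t) := fun t => by
    rcases Int.natAbs_eq n with h | h
    · conv_rhs => rw [h]
      simp
    · conv_rhs => rw [h]
      simp
  have h := integral_symm_exp_mul (continuous_comp_cos hf) (fun t => by rw [Real.cos_neg]) n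
  rw [fourierCoeff_eq_intervalIntegral _ n (-π), show -π + 2 * π = π by ring, chebCoeff]
  simp_rw [hcos]
  have e : ∫ t in (-π)..π, (fourier (-n) (t : AddCircle (2 * π))) • cosLift hf t
      = ∫ t in (-π)..π, Complex.exp (-(n * t * Complex.I)) * ((f (Real.cos t) : ℝ) : ℂ) := by
    refine intervalIntegral.integral_congr fun t _ => ?_
    simp only [fourier_coe_apply, smul_eq_mul]
    congr 2
    push_cast
    have : (π : ℂ) ≠ 0 := by exact_mod_cast hpi
    field_simp
  rw [e, h, Complex.real_smul, ← Complex.ofReal_mul]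
  congr 1
  field_simp

lemma hasSum_chebCoeff {f : ℝ → ℝ} (hf : ContinuousOn f (Set.Icc (-1) 1))
    (hs : Summable (chebCoeff f)) (t : ℝ) :
    HasSum (fun p : ℕ => chebCoeff f p * Real.cos (p * t))
      (f (Real.cos t) + chebCoeff f 0 / 2) := by
  have : Fact (0 < 2 * π) := ⟨Real.two_pi_pos⟩
  have hsum : Summable (fourierCoeff (cosLift hf)) := by
    have h2 : Summable fun n : ℕ => ((chebCoeff f n / 2 : ℝ) : ℂ) :=
      Complex.ofRealCLM.summable (hs.div_const 2)
    refine Summable.of_nat_of_neg ?_ ?_ <;> simpa [fourierCoeff_cosLift] using h2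
  have h := (has_pointwise_sum_fourier_series_of_summable hsum (t : AddCircle (2 * π))).nat_add_neg
  have h' := Complex.reCLM.hasSum h
  have hpi : (π : ℂ) ≠ 0 := by exact_mod_cast Real.pi_ne_zero
  convert h' using 1
  · funext p
    simp only [fourierCoeff_cosLift, Int.natAbs_neg, Int.natAbs_natCast,
      fourier_coe_apply, smul_eq_mul, Complex.reCLM_apply, Complex.add_re, Complex.re_ofReal_mul]
    have e1 : 2 * (π : ℂ) * Complex.I * ((p : ℤ) : ℂ) * t / ((2 * π : ℝ) : ℂ)
        = ((p * t : ℝ) : ℂ) * Complex.I := by push_cast; field_simp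
    have e2 : 2 * (π : ℂ) * Complex.I * ((-(p : ℤ) : ℤ) : ℂ) * t / ((2 * π : ℝ) : ℂ)
        = ((-(p * t) : ℝ) : ℂ) * Complex.I := by push_cast; field_simp
    rw [e1, e2, Complex.exp_ofReal_mul_I_re, Complex.exp_ofReal_mul_I_re, Real.cos_neg]
    ring
  · have e : cosLift hf (t : AddCircle (2 * π)) = ((f (Real.cos t) : ℝ) : ℂ) := rfl
    rw [e]
    simp [fourierCoeff_cosLift]

lemma integral_eq_integral_comp_cos {f : ℝ → ℝ} (hf : ContinuousOn f (Set.Icc (-1) 1)) :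
    ∫ x in (-1 : ℝ)..1, f x = ∫ t in (0 : ℝ)..π, f (Real.cos t) * Real.sin t := by
  have himg : Real.cos '' Set.Icc 0 π ⊆ Set.Icc (-1) 1 := by
    rintro _ ⟨t, _, rfl⟩
    exact ⟨Real.neg_one_le_cos t, Real.cos_le_one t⟩
  have h := intervalIntegral.integral_comp_mul_deriv''' (a := 0) (b := π) (f := Real.cos)
    (f' := fun t => -Real.sin t) (g := f) Real.continuous_cos.continuousOn
    (fun t _ => (Real.hasDerivAt_cos t).hasDerivWithinAt) ?_ ?_ ?_
  · rw [Real.cos_zero, Real.cos_pi] at h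
    rw [intervalIntegral.integral_symm, ← h, ← intervalIntegral.integral_neg]
    exact intervalIntegral.integral_congr fun t _ => by simp
  · refine hf.mono (subset_trans (Set.image_mono ?_) himg)
    rw [min_eq_left Real.pi_pos.le, max_eq_right Real.pi_pos.le]
    exact Set.Ioo_subset_Icc_self
  · rw [Set.uIcc_of_le Real.pi_pos.le]
    exact hf.integrableOn_Icc.mono_set himg
  · exact (((continuous_comp_cos hf).mul Real.continuous_sin.neg).continuousOn).integrableOn_compact
      isCompact_uIcc

lemma integral_cos_mul_sin_even (q : ℕ) :
    ∫ t in (0 : ℝ)..π, Real.cos ((2 * q : ℕ) * t) * Real.sin t = chebMoment q := by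
  have h1 : (2 * (q : ℝ) + 1) ≠ 0 := by positivity
  have h2 : (2 * (q : ℝ) - 1) ≠ 0 := by
    have : (2 * (q : ℤ) - 1) ≠ 0 := by omega
    exact_mod_cast this
  have hd : ∀ t : ℝ, HasDerivAt (fun t => (-Real.cos ((2 * q + 1) * t) / (2 * q + 1)
      + Real.cos ((2 * q - 1) * t) / (2 * q - 1)) / 2)
      (Real.cos ((2 * q : ℕ) * t) * Real.sin t) t := fun t => by
    have a1 : HasDerivAt (fun t : ℝ => (2 * (q : ℝ) + 1) * t) (2 * (q : ℝ) + 1) t := by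
      simpa using (hasDerivAt_id t).const_mul (2 * (q : ℝ) + 1)
    have a2 : HasDerivAt (fun t : ℝ => (2 * (q : ℝ) - 1) * t) (2 * (q : ℝ) - 1) t := by
      simpa using (hasDerivAt_id t).const_mul (2 * (q : ℝ) - 1)
    refine (((a1.cos.neg.div_const (2 * (q : ℝ) + 1)).add
      (a2.cos.div_const (2 * (q : ℝ) - 1))).div_const 2).congr_deriv ?_
    rw [add_mul, sub_mul, one_mul, Real.sin_add, Real.sin_sub]
    push_cast
    field_simp
    ring
  rw [intervalIntegral.integral_eq_sub_of_hasDerivAt (fun t _ => hd t)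
    (Continuous.intervalIntegrable (by fun_prop) _ _)]
  have c1 : Real.cos ((2 * q + 1) * π) = -1 := by
    rw [add_mul, one_mul, Real.cos_add_pi, show 2 * (q : ℝ) * π = q * (2 * π) by ring,
      Real.cos_nat_mul_two_pi]
  have c2 : Real.cos ((2 * q - 1) * π) = -1 := by
    rw [sub_mul, one_mul, Real.cos_sub_pi, show 2 * (q : ℝ) * π = q * (2 * π) by ring,
      Real.cos_nat_mul_two_pi]
  rw [c1, c2, mul_zero, mul_zero, Real.cos_zero, chebMoment]
  have h3 := one_sub_four_mul_sq_ne_zero q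
  rw [show (1 : ℝ) - 4 * q ^ 2 = -((2 * q + 1) * (2 * q - 1)) by ring]
  field_simp
  ring

lemma integral_cos_mul_sin_odd {p : ℕ} (hp : Odd p) :
    ∫ t in (0 : ℝ)..π, Real.cos (p * t) * Real.sin t = 0 := by
  have h := intervalIntegral.integral_comp_sub_left (a := 0) (b := π)
    (fun t => Real.cos (p * t) * Real.sin t) π
  simp only [sub_self, sub_zero] at h
  have e : ∀ t : ℝ, Real.cos (p * (π - t)) * Real.sin (π - t)
      = -(Real.cos (p * t) * Real.sin t) := fun t => by
    rw [mul_sub, Real.cos_nat_mul_pi_sub, hp.neg_one_pow, Real.sin_pi_sub]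
    ring
  simp only [e, intervalIntegral.integral_neg] at h
  linarith

lemma trapSum_reflect (g : ℕ → ℝ) (m : ℕ) :
    trapSum (fun q => g (m - q)) m = trapSum g m := by
  unfold trapSum
  rw [← Finset.sum_range_reflect]
  refine Finset.sum_congr rfl fun q hq => ?_
  have := Finset.mem_range.mp hq
  simp only
  rw [show m - (m - 1 - q) = q + 1 by omega, show m - (m - 1 - q + 1) = q by omega, add_comm]

lemma trapSum_add_length (g : ℕ → ℝ) (a b : ℕ) :
    trapSum g (a + b) = trapSum g a + trapSum (fun q => g (a + q)) b := by
  simp only [trapSum, Finset.sum_range_add, add_assoc]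

lemma trapSum_odd_mul (g : ℕ → ℝ) (m L : ℕ) :
    trapSum g ((2 * L + 1) * m) = trapSum g m
      + ∑ l ∈ range L, trapSum (fun q => g (2 * (l + 1) * m - q) + g (2 * (l + 1) * m + q)) m := by
  induction L with
  | zero => simp
  | succ L ih =>
    rw [Finset.sum_range_succ, ← add_assoc, ← ih, trapSum_add,
      show (2 * (L + 1) + 1) * m = (2 * L + 1) * m + m + m by ring, trapSum_add_length,
      trapSum_add_length, ← trapSum_reflect (fun q => g ((2 * L + 1) * m + q)),
      show (2 * L + 1) * m + m = 2 * (L + 1) * m by ring, add_assoc]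
    congr 2
    refine trapSum_congr fun q hq => ?_
    congr 1
    have : 2 * (L + 1) * m = (2 * L + 1) * m + m := by ring
    omega

lemma tsum_eq_trapSum_add_aliasSum {g : ℕ → ℝ} (hg : Summable g) {m : ℕ} (hm : m ≠ 0) :
    ∑' q, g q - g 0 / 2 = trapSum g m + trapSum (aliasSum g m) m := by
  have h1 : Tendsto (trapSum g) atTop (nhds (∑' q, g q - g 0 / 2)) := by
    have h := hg.hasSum.tendsto_sum_nat.add ((hg.tendsto_atTop_zero.sub_const (g 0)).div_const 2)
    rw [show ∑' q, g q + (0 - g 0) / 2 = ∑' q, g q - g 0 / 2 by ring] at h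
    exact h.congr fun N => (trapSum_eq g N).symm
  have h2 : Tendsto (fun L : ℕ => (2 * L + 1) * m) atTop atTop :=
    tendsto_atTop_mono (fun L => (show L ≤ 2 * L + 1 by omega).trans
      (Nat.le_mul_of_pos_right _ (Nat.pos_of_ne_zero hm))) tendsto_id
  have h3 : HasSum (fun l : ℕ => trapSum (fun q => g (2 * (l + 1) * m - q)
      + g (2 * (l + 1) * m + q)) m) (trapSum (aliasSum g m) m) :=
    HasSum.trapSum fun q hq => (summable_alias hg hm hq).hasSum
  have h4 := (h3.tendsto_sum_nat.const_add (trapSum g m)).congr fun L =>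
    (trapSum_odd_mul g m L).symm
  exact tendsto_nhds_unique (h1.comp h2) h4

lemma hasSum_integral_chebCoeff {f : ℝ → ℝ} (hf : ContinuousOn f (Set.Icc (-1) 1))
    (hs : Summable (chebCoeff f)) :
    HasSum (fun p : ℕ => chebCoeff f p * ∫ t in (0 : ℝ)..π, Real.cos (p * t) * Real.sin t)
      ((∫ x in (-1 : ℝ)..1, f x) + chebCoeff f 0 / 2 * chebMoment 0) := by
  have h := intervalIntegral.hasSum_integral_of_dominated_convergence (a := 0) (b := π)
    (μ := MeasureTheory.volume)
    (F := fun (p : ℕ) t => chebCoeff f p * (Real.cos (p * t) * Real.sin t))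
    (f := fun t => (f (Real.cos t) + chebCoeff f 0 / 2) * Real.sin t)
    (fun p _ => |chebCoeff f p|) (fun p => by fun_prop)
    (fun p => MeasureTheory.ae_of_all _ fun t _ => ?_)
    (MeasureTheory.ae_of_all _ fun t _ => hs.abs) (by simp)
    (MeasureTheory.ae_of_all _ fun t _ => by
      simpa only [mul_assoc] using (hasSum_chebCoeff hf hs t).mul_right (Real.sin t))
  · simp only [intervalIntegral.integral_const_mul] at h
    have hc := continuous_comp_cos hf
    have h0 := integral_cos_mul_sin_even 0
    simp only [mul_zero, Nat.cast_zero, zero_mul, Real.cos_zero, one_mul] at h0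
    have hcs : Continuous fun t => f (Real.cos t) * Real.sin t := hc.mul Real.continuous_sin
    simp_rw [add_mul] at h
    rwa [intervalIntegral.integral_add (hcs.intervalIntegrable _ _)
      (Continuous.intervalIntegrable (by fun_prop) _ _), ← integral_eq_integral_comp_cos hf,
      intervalIntegral.integral_const_mul, h0] at h
  · rw [Real.norm_eq_abs, abs_mul, abs_mul]
    exact mul_le_of_le_one_right (abs_nonneg _)
      (mul_le_one₀ (Real.abs_cos_le_one _) (abs_nonneg _) (Real.abs_sin_le_one _))

lemma hasSum_ccQuad_s14 {f : ℝ → ℝ} (hf : ContinuousOn f (Set.Icc (-1) 1))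
    (hs : Summable (chebCoeff f)) (n : ℕ) :
    HasSum (fun p : ℕ => chebCoeff f p * ccMoment n p)
      (ccQuad f n + chebCoeff f 0 / 2 * ccMoment n 0) := by
  have h := hasSum_sum (s := range (n + 1)) fun j _ =>
    (hasSum_chebCoeff hf hs (j * π / n)).mul_left (ccWeight n j)
  have e1 : (fun p : ℕ => chebCoeff f p * ccMoment n p) = fun p : ℕ => ∑ j ∈ range (n + 1),
      ccWeight n j * (chebCoeff f p * Real.cos (p * (j * π / n))) := by
    funext p
    rw [ccMoment, Finset.mul_sum]
    exact Finset.sum_congr rfl fun j _ => by push_cast; ring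
  have e2 : ccQuad f n + chebCoeff f 0 / 2 * ccMoment n 0 = ∑ j ∈ range (n + 1),
      ccWeight n j * (f (Real.cos (j * π / n)) + chebCoeff f 0 / 2) := by
    unfold ccQuad ccMoment
    rw [Finset.mul_sum, ← Finset.sum_add_distrib]
    refine Finset.sum_congr rfl fun j _ => ?_
    simp
    ring
  rw [e1, e2]
  exact h

lemma ccError_two_mul_eq_aliasError {f : ℝ → ℝ} (hf : ContinuousOn f (Set.Icc (-1) 1))
    (hs : Summable (chebCoeff f)) {m : ℕ} (hm : m ≠ 0) :
    ccError f (2 * m) = aliasError (fun k => chebCoeff f (2 * k)) m := by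
  have hinj : Function.Injective fun q : ℕ => 2 * q := mul_right_injective₀ two_ne_zero
  set b : ℕ → ℝ := fun k => chebCoeff f (2 * k) with hb
  have hbs : Summable b := hs.comp_injective hinj
  set G : ℕ → ℝ := fun q => b q * chebMoment q - b q * ccMoment (2 * m) (2 * q : ℤ) with hG
  have hzero : ccMoment (2 * m) 0 = chebMoment 0 := by
    simpa using ccMoment_two_mul hm (Nat.zero_le m) (r := 0) (by simp)
  have h1 : HasSum G (ccError f (2 * m)) := by
    have h := (hasSum_integral_chebCoeff hf hs).sub (hasSum_ccQuad_s14 hf hs (2 * m))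
    rw [hzero, add_sub_add_right_eq_sub, ← ccError, ← hinj.hasSum_iff] at h
    · have e : G = (fun p : ℕ => (chebCoeff f p * ∫ t in (0 : ℝ)..π, Real.cos (p * t) * Real.sin t)
          - chebCoeff f p * ccMoment (2 * m) p) ∘ fun q => 2 * q := by
        funext q
        simp only [hG, hb, Function.comp, integral_cos_mul_sin_even]
        push_cast
        rfl
      rw [e]
      exact h
    · intro p hp
      have hodd : Odd p := by
        rw [← Nat.not_even_iff_odd]
        rintro ⟨q, hq⟩
        exact hp ⟨q, by simp only; omega⟩
      rw [integral_cos_mul_sin_odd hodd, ccMoment_odd hm (by exact_mod_cast hodd)]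
      simp
  have h2 : ∀ q ≤ m, G q = 0 := fun q hq => by
    simp only [hG]
    rw [ccMoment_two_mul hm hq (by simp), sub_self]
  have h3 := tsum_eq_trapSum_add_aliasSum h1.summable hm
  rw [h1.tsum_eq, h2 0 (Nat.zero_le m), zero_div, sub_zero, trapSum_congr h2] at h3
  rw [h3, aliasError]
  simp only [trapSum_eq (fun _ => (0 : ℝ)), Finset.sum_const_zero, sub_self, zero_div, zero_add]
  refine trapSum_congr fun q hq => ?_
  rw [aliasSum, aliasSum, aliasSum, ← tsum_mul_left,
    ← (summable_alias hbs.mul_chebMoment hm hq).tsum_sub ((summable_alias hbs hm hq).mul_left _)]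
  refine tsum_congr fun l => ?_
  have hle : q ≤ 2 * (l + 1) * m := by nlinarith
  have e1 : ccMoment (2 * m) (2 * ((2 * (l + 1) * m - q : ℕ) : ℤ)) = chebMoment q := by
    rw [← ccMoment_neg, ← mul_neg]
    refine ccMoment_two_mul hm hq ⟨-(l + 1), ?_⟩
    push_cast [hle]
    ring
  have e2 : ccMoment (2 * m) (2 * ((2 * (l + 1) * m + q : ℕ) : ℤ)) = chebMoment q := by
    refine ccMoment_two_mul hm hq ⟨l + 1, ?_⟩
    push_cast
    ring
  simp only [hG]
  rw [e1, e2]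
  ring

lemma isLittleO_natCast_rpow {a b : ℝ} (h : a < b) :
    (fun m : ℕ => (m : ℝ) ^ a) =o[atTop] fun m : ℕ => (m : ℝ) ^ b := by
  have h1 : (fun m : ℕ => (m : ℝ) ^ (-(b - a))) =o[atTop] fun _ => (1 : ℝ) :=
    (Asymptotics.isLittleO_one_iff ℝ).mpr
      ((tendsto_rpow_neg_atTop (sub_pos.mpr h)).comp tendsto_natCast_atTop_atTop)
  refine (h1.mul_isBigO (Asymptotics.isBigO_refl (fun m : ℕ => (m : ℝ) ^ b) atTop)).congr' ?_ ?_
  · filter_upwards [eventually_gt_atTop 0] with m hm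
    rw [← Real.rpow_add (Nat.cast_pos.mpr hm)]
    congr 1
    ring
  · exact Eventually.of_forall fun m => one_mul _

lemma isLittleO_inf_principal_even {u v : ℕ → ℝ}
    (h : (fun m => u (2 * m)) =o[atTop] fun m => v (2 * m)) :
    u =o[atTop ⊓ 𝓟 {n : ℕ | Even n}] v := by
  have ht : Tendsto (fun n : ℕ => n / 2) (atTop ⊓ 𝓟 {n : ℕ | Even n}) atTop :=
    (Nat.tendsto_div_const_atTop two_ne_zero).mono_left inf_le_left
  have he : ∀ᶠ n in atTop ⊓ 𝓟 {n : ℕ | Even n}, 2 * (n / 2) = n :=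
    eventually_inf_principal.mpr (Eventually.of_forall fun n hn => Nat.two_mul_div_two_of_even hn)
  refine (h.comp_tendsto ht).congr' ?_ ?_ <;>
  · filter_upwards [he] with n hn
    simp only [Function.comp, hn]

lemma exists_aliasError_rpow_expansion {s : ℝ} (hs : 1 < s) :
    ∃ c : ℕ → ℝ, ∀ K : ℕ, (fun m => aliasError (fun k => (k : ℝ) ^ (-s)) m
        - ∑ j ∈ range K, c j * (m : ℝ) ^ (-(s + 2 * (j : ℝ) + 1)))
      =O[atTop] fun m : ℕ => (m : ℝ) ^ (-(s + 2 * (K : ℝ) + 1)) := by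
  obtain ⟨c, hc⟩ := exists_coeff_of_hasInvSqExpansion (hasInvSqExpansion_aliasError_rpow hs)
  have hpow : ∀ m : ℕ, m ≠ 0 → ∀ j : ℕ,
      (m : ℝ) ^ (-(s + 2 * (j : ℝ) + 1)) = invSq m ^ j * (m : ℝ) ^ (-(s + 1)) := fun m hm j => by
    rw [← rpow_eq_invSq_pow_mul hm]
    congr 1
    ring
  refine ⟨c, fun K => ?_⟩
  refine ((hc K).mul (Asymptotics.isBigO_refl (fun m : ℕ => (m : ℝ) ^ (-(s + 1))) atTop)).congr'
    ?_ ?_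
  · filter_upwards [eventually_ne_atTop 0] with m hm
    have hm' : (0 : ℝ) < m := Nat.cast_pos.mpr (Nat.pos_of_ne_zero hm)
    have h1 : (m : ℝ) ^ (s + 1) * (m : ℝ) ^ (-(s + 1)) = 1 := by
      rw [← Real.rpow_add hm', add_neg_cancel, Real.rpow_zero]
    rw [sub_mul, Finset.sum_mul, mul_right_comm, h1, one_mul]
    congr 1
    exact Finset.sum_congr rfl fun j _ => by rw [hpow m hm, mul_assoc]
  · filter_upwards [eventually_ne_atTop 0] with m hm
    rw [hpow m hm]

lemma exists_aliasError_expansion {b ν d : ℕ → ℝ} (hd : ∀ k, 1 < d k) (hd_mono : StrictMono d)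
    (hd_top : Tendsto d atTop atTop)
    (hb : ∀ N : ℕ, 1 ≤ N → (fun n : ℕ => b n - ∑ k ∈ range N, ν k * (n : ℝ) ^ (-(d k)))
      =O[atTop] fun n : ℕ => (n : ℝ) ^ (-(d N))) :
    ∃ c : ℕ → ℕ → ℝ, ∀ M : ℝ, ∃ s : Finset (ℕ × ℕ),
      (∀ q : ℕ × ℕ, d q.2 + 2 * (q.1 : ℝ) + 1 ≤ M → q ∈ s) ∧
      (fun m : ℕ => aliasError b m - ∑ q ∈ s, Set.indicator
          {q : ℕ × ℕ | d q.2 + 2 * (q.1 : ℝ) + 1 ≤ M}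
          (fun q => c q.1 q.2 * (m : ℝ) ^ (-(d q.2 + 2 * (q.1 : ℝ) + 1))) q)
        =o[atTop] fun m : ℕ => (m : ℝ) ^ (-M) := by
  choose c hc using fun k => exists_aliasError_rpow_expansion (hd k)
  refine ⟨fun j k => ν k * c k j, fun M => ?_⟩
  obtain ⟨N, hNM, hN⟩ := ((hd_top.eventually_gt_atTop (M + 1)).and (eventually_ge_atTop 1)).exists
  obtain ⟨K, hK⟩ := exists_nat_gt M
  have hlt : ∀ k j : ℕ, K ≤ j → M < d k + 2 * (j : ℝ) + 1 := fun k j h => by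
    have h1 : (K : ℝ) ≤ j := Nat.cast_le.mpr h
    have h2 : (0 : ℝ) ≤ K := Nat.cast_nonneg K
    linarith [hd k]
  refine ⟨range K ×ˢ range N, fun q hq => ?_, ?_⟩
  · rw [Finset.mem_product, Finset.mem_range, Finset.mem_range]
    constructor <;> by_contra! h
    · exact absurd hq (not_le.mpr (hlt q.2 q.1 h))
    · have h1 := hd_mono.monotone h
      have h2 : (0 : ℝ) ≤ q.1 := Nat.cast_nonneg _
      linarith
  · set R : ℕ → ℝ := fun n => b n - ∑ k ∈ range N, ν k * (n : ℝ) ^ (-(d k)) with hR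
    have hRs : Summable R := summable_of_isBigO_nat (summable_rpow_neg (hd N)) (hb N hN)
    have hdecomp : ∀ m : ℕ, m ≠ 0 → aliasError b m = aliasError R m
        + ∑ k ∈ range N, ν k * aliasError (fun n => (n : ℝ) ^ (-(d k))) m := fun m hm => by
      have hsum : ∀ k ∈ range N, Summable fun n : ℕ => ν k * (n : ℝ) ^ (-(d k)) := fun k _ =>
        (summable_rpow_neg (hd k)).mul_left _
      have e : b = fun n => R n + ∑ k ∈ range N, ν k * (n : ℝ) ^ (-(d k)) := by
        funext n
        simp [hR]
      conv_lhs => rw [e]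
      rw [aliasError_add hRs (summable_sum hsum) hm, aliasError_sum _ hsum hm]
      simp only [aliasError_const_mul]
    have h1 : (fun m => aliasError R m) =o[atTop] fun m : ℕ => (m : ℝ) ^ (-M) :=
      (isBigO_aliasError (hd N) (hb N hN)).trans_isLittleO
        (isLittleO_natCast_rpow (by linarith))
    have h2 : (fun m : ℕ => ∑ k ∈ range N, ν k * (aliasError (fun n => (n : ℝ) ^ (-(d k))) m
        - ∑ j ∈ range K, c k j * (m : ℝ) ^ (-(d k + 2 * (j : ℝ) + 1))))
        =o[atTop] fun m : ℕ => (m : ℝ) ^ (-M) :=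
      Asymptotics.IsLittleO.fun_sum fun k _ => (((hc k K).trans_isLittleO
        (isLittleO_natCast_rpow (neg_lt_neg (hlt k K le_rfl)))).const_mul_left _)
    have h3 : (fun m : ℕ => ∑ q ∈ range K ×ˢ range N, Set.indicator
          {q : ℕ × ℕ | d q.2 + 2 * (q.1 : ℝ) + 1 ≤ M}ᶜ
          (fun q => ν q.2 * c q.2 q.1 * (m : ℝ) ^ (-(d q.2 + 2 * (q.1 : ℝ) + 1))) q)
        =o[atTop] fun m : ℕ => (m : ℝ) ^ (-M) := by
      refine Asymptotics.IsLittleO.fun_sum fun q _ => ?_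
      by_cases hq : d q.2 + 2 * (q.1 : ℝ) + 1 ≤ M
      · simp [Set.indicator, hq]
      · simpa only [Set.indicator, Set.mem_compl_iff, Set.mem_ofPred_eq, hq, not_false_eq_true, if_true]
          using (isLittleO_natCast_rpow (neg_lt_neg (not_le.mp hq))).const_mul_left _
    refine ((h1.add h2).add h3).congr' ?_ EventuallyEq.rfl
    filter_upwards [eventually_ne_atTop 0] with m hm
    rw [hdecomp m hm, add_assoc, add_sub_assoc]
    congr 1
    have e : ∑ k ∈ range N, ∑ j ∈ range K, ν k * (c k j * (m : ℝ) ^ (-(d k + 2 * (j : ℝ) + 1)))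
        = ∑ q ∈ range K ×ˢ range N,
          ν q.2 * c q.2 q.1 * (m : ℝ) ^ (-(d q.2 + 2 * (q.1 : ℝ) + 1)) := by
      rw [Finset.sum_product_right]
      simp only [mul_assoc]
    simp only [mul_sub, Finset.mul_sum, Finset.sum_sub_distrib]
    rw [e, sub_add, sub_right_inj, ← Finset.sum_sub_distrib]
    refine Finset.sum_congr rfl fun q _ => ?_
    rw [sub_eq_iff_eq_add, Set.indicator_self_add_compl_apply]

/-- The even-indexed Chebyshev coefficients inherit the expansion, whichever sign pattern holds. -/
lemma isBigO_chebCoeff_even_sub {f : ℝ → ℝ} {μ d : ℕ → ℝ}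
    (hcheb :
      (∀ N : ℕ, 1 ≤ N →
        (fun n : ℕ => chebCoeff f n - ∑ k ∈ Finset.range N, μ k * (n : ℝ) ^ (-(d k)))
          =O[atTop] fun n : ℕ => (n : ℝ) ^ (-(d N))) ∨
      (∀ N : ℕ, 1 ≤ N →
        (fun n : ℕ => chebCoeff f n -
            (-1 : ℝ) ^ n * ∑ k ∈ Finset.range N, μ k * (n : ℝ) ^ (-(d k)))
          =O[atTop] fun n : ℕ => (n : ℝ) ^ (-(d N)))) (N : ℕ) (hN : 1 ≤ N) :
    (fun n : ℕ => chebCoeff f (2 * n) - ∑ k ∈ range N, μ k * 2 ^ (-(d k)) * (n : ℝ) ^ (-(d k)))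
      =O[atTop] fun n : ℕ => (n : ℝ) ^ (-(d N)) := by
  have h2 : Tendsto (fun n : ℕ => 2 * n) atTop atTop :=
    tendsto_id.const_mul_atTop' two_pos
  have hpow : ∀ (n : ℕ) (a : ℝ), ((2 * n : ℕ) : ℝ) ^ a = 2 ^ a * (n : ℝ) ^ a := fun n a => by
    rw [Nat.cast_mul, Nat.cast_two, Real.mul_rpow two_pos.le (Nat.cast_nonneg n)]
  have key : (fun n : ℕ => chebCoeff f (2 * n)
        - ∑ k ∈ range N, μ k * ((2 * n : ℕ) : ℝ) ^ (-(d k)))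
      =O[atTop] fun n : ℕ => ((2 * n : ℕ) : ℝ) ^ (-(d N)) := by
    rcases hcheb with h | h
    · exact (h N hN).comp_tendsto h2
    · simpa [Function.comp_def] using (h N hN).comp_tendsto h2
  simp only [hpow, ← mul_assoc] at key
  exact key.trans (Asymptotics.isBigO_const_mul_self _ _ _)

lemma summable_chebCoeff {f : ℝ → ℝ} {μ d : ℕ → ℝ} (hd_mono : StrictMono d) (hd0 : 1 < d 0)
    (hcheb :
      (∀ N : ℕ, 1 ≤ N →
        (fun n : ℕ => chebCoeff f n - ∑ k ∈ Finset.range N, μ k * (n : ℝ) ^ (-(d k)))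
          =O[atTop] fun n : ℕ => (n : ℝ) ^ (-(d N))) ∨
      (∀ N : ℕ, 1 ≤ N →
        (fun n : ℕ => chebCoeff f n -
            (-1 : ℝ) ^ n * ∑ k ∈ Finset.range N, μ k * (n : ℝ) ^ (-(d k)))
          =O[atTop] fun n : ℕ => (n : ℝ) ^ (-(d N)))) :
    Summable (chebCoeff f) := by
  have h1 : (fun n : ℕ => (n : ℝ) ^ (-(d 1))) =O[atTop] fun n : ℕ => (n : ℝ) ^ (-(d 0)) :=
    (isLittleO_natCast_rpow (neg_lt_neg (hd_mono one_pos))).isBigO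
  refine summable_of_isBigO_nat (summable_rpow_neg hd0) ?_
  have h0 : (fun n : ℕ => μ 0 * (n : ℝ) ^ (-(d 0))) =O[atTop] fun n : ℕ => (n : ℝ) ^ (-(d 0)) :=
    Asymptotics.isBigO_const_mul_self _ _ _
  rcases hcheb with h | h
  · refine (((h 1 le_rfl).trans h1).add h0).congr_left fun n => ?_
    simp
  · have h0' : (fun n : ℕ => (-1 : ℝ) ^ n * (μ 0 * (n : ℝ) ^ (-(d 0))))
        =O[atTop] fun n : ℕ => (n : ℝ) ^ (-(d 0)) := by
      refine Asymptotics.IsBigO.trans (Asymptotics.IsBigO.of_norm_le fun n => ?_) h0.norm_left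
      rw [norm_mul, norm_pow, norm_neg, norm_one, one_pow, one_mul]
    refine (((h 1 le_rfl).trans h1).add h0').congr_left fun n => ?_
    simp

/-- Asymptotic error expansion of Clenshaw–Curtis quadrature: if the Chebyshev
coefficients of a continuous `f` admit an asymptotic expansion
`a_n ~ Σ_k μ_k n^{−d_k}` (or `a_n ~ (−1)^n Σ_k μ_k n^{−d_k}`) with `d` strictly
increasing, positive, tending to `∞` and `d 0 > 1`, then there exist constants
`ς_{j,k}` such that for every `M > 0`,
`E_n^C[f] − Σ_{(j,k): d_k+2j+1 ≤ M} ς_{j,k} n^{−(d_k+2j+1)} = o(n^{−M})` as `n → ∞`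
through even values of `n`. -/
theorem ccError_asymptotic_expansion (f : ℝ → ℝ)
    (hf : ContinuousOn f (Set.Icc (-1) 1))
    (μ d : ℕ → ℝ) (hd_pos : ∀ k, 0 < d k) (hd_mono : StrictMono d)
    (hd_top : Tendsto d atTop atTop) (hd0 : 1 < d 0)
    (hcheb :
      (∀ N : ℕ, 1 ≤ N →
        (fun n : ℕ => chebCoeff f n - ∑ k ∈ Finset.range N, μ k * (n : ℝ) ^ (-(d k)))
          =O[atTop] fun n : ℕ => (n : ℝ) ^ (-(d N))) ∨
      (∀ N : ℕ, 1 ≤ N →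
        (fun n : ℕ => chebCoeff f n -
            (-1 : ℝ) ^ n * ∑ k ∈ Finset.range N, μ k * (n : ℝ) ^ (-(d k)))
          =O[atTop] fun n : ℕ => (n : ℝ) ^ (-(d N)))) :
    ∃ ς : ℕ → ℕ → ℝ, ∀ M : ℝ, 0 < M →
      (fun n : ℕ => ccError f n -
          ∑ᶠ p : ℕ × ℕ,
            Set.indicator {q : ℕ × ℕ | d q.2 + 2 * (q.1 : ℝ) + 1 ≤ M}
              (fun q => ς q.1 q.2 * (n : ℝ) ^ (-(d q.2 + 2 * (q.1 : ℝ) + 1))) p)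
        =o[atTop ⊓ 𝓟 {n : ℕ | Even n}] fun n : ℕ => (n : ℝ) ^ (-M) := by
  have hd : ∀ k, 1 < d k := fun k => hd0.trans_le (hd_mono.monotone (Nat.zero_le k))
  have hs := summable_chebCoeff hd_mono hd0 hcheb
  obtain ⟨c, hc⟩ := exists_aliasError_expansion hd hd_mono hd_top (isBigO_chebCoeff_even_sub hcheb)
  have hpow : ∀ (m : ℕ) (a : ℝ), (m : ℝ) ^ (-a) = 2 ^ a * ((2 * m : ℕ) : ℝ) ^ (-a) := fun m a => by
    rw [Nat.cast_mul, Nat.cast_two, Real.mul_rpow two_pos.le (Nat.cast_nonneg m), ← mul_assoc,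
      ← Real.rpow_add two_pos, add_neg_cancel, Real.rpow_zero, one_mul]
  refine ⟨fun j k => c j k * 2 ^ (d k + 2 * (j : ℝ) + 1), fun M _ => ?_⟩
  obtain ⟨s, hmem, hlit⟩ := hc M
  refine isLittleO_inf_principal_even ?_
  have hbig : (fun m : ℕ => (m : ℝ) ^ (-M)) =O[atTop] fun m : ℕ => ((2 * m : ℕ) : ℝ) ^ (-M) := by
    exact (Asymptotics.isBigO_const_mul_self (2 ^ M : ℝ) _ _).congr_left fun m => (hpow m M).symm
  refine (hlit.trans_isBigO hbig).congr' ?_ EventuallyEq.rfl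
  filter_upwards [eventually_ne_atTop 0] with m hm
  rw [ccError_two_mul_eq_aliasError hf hs hm, finsum_eq_sum_of_support_subset (s := s)]
  · congr 1
    refine Finset.sum_congr rfl fun q _ => ?_
    simp only [Set.indicator, hpow m, mul_assoc]
  · intro q hq
    exact hmem q (Set.indicator_apply_ne_zero.mp hq).1
end
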